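/- arXiv:1605.07757 — 2 statements merged into one kernel-verified Lean document; each statement's English description precedes it below -/
import Mathlib

section
/- Let K have characteristic 2, let k ≥ 2 be even, s ≥ 3, and let a, c ∈ K be nonzero. If c is a square in K, then dim_K T₁(A^{k,s}(a,c))^⊥ = dim_K T₁(A^{k,s}(a,0))^⊥. If c is not a square in K, then dim_K T₁(A^{k,s}(a,c))^⊥ = dim_K T₁(A^{k,s}(a,0))^⊥ + 1. -/
namespace QT

/-- The generators of the free algebra: the two vertex idempotents `e1, e2`,
the loops `al` (α at vertex 1) and `et` (η at vertex 2), and the arrows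
`be` (β : 1 → 2) and `ga` (γ : 2 → 1). -/
inductive Gen : Type
  | e1 : Gen
  | e2 : Gen
  | al : Gen
  | be : Gen
  | ga : Gen
  | et : Gen

open Gen

/-- Generators as elements of the free algebra. -/
noncomputable def gen (K : Type) [Field K] (g : Gen) : FreeAlgebra K Gen :=
  FreeAlgebra.ι K g

/-- The defining relations of the algebra `A^{k,s}(a,c)`: the path-algebra
relations for the quiver with two vertices, loops α, η and arrows β, γ
(paths composed left to right), together with the relations
βη = (αβγ)^{k−1}αβ, ηγ = (γαβ)^{k−1}γα, α² = a(βγα)^{k−1}βγ + c(βγα)^k,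
γβ = η^{s−1}, α²β = 0, γα² = 0. -/
inductive Rel (K : Type) [Field K] (k s : ℕ) (a c : K) :
    FreeAlgebra K Gen → FreeAlgebra K Gen → Prop
  | idem1 : Rel K k s a c (gen K e1 * gen K e1) (gen K e1)
  | idem2 : Rel K k s a c (gen K e2 * gen K e2) (gen K e2)
  | orth12 : Rel K k s a c (gen K e1 * gen K e2) 0
  | orth21 : Rel K k s a c (gen K e2 * gen K e1) 0
  | sum_idem : Rel K k s a c (gen K e1 + gen K e2) 1
  | al_left : Rel K k s a c (gen K e1 * gen K al) (gen K al)
  | al_right : Rel K k s a c (gen K al * gen K e1) (gen K al)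
  | be_left : Rel K k s a c (gen K e1 * gen K be) (gen K be)
  | be_right : Rel K k s a c (gen K be * gen K e2) (gen K be)
  | ga_left : Rel K k s a c (gen K e2 * gen K ga) (gen K ga)
  | ga_right : Rel K k s a c (gen K ga * gen K e1) (gen K ga)
  | et_left : Rel K k s a c (gen K e2 * gen K et) (gen K et)
  | et_right : Rel K k s a c (gen K et * gen K e2) (gen K et)
  | rel_beta_eta : Rel K k s a c (gen K be * gen K et)
      ((gen K al * gen K be * gen K ga) ^ (k - 1) * (gen K al * gen K be))
  | rel_eta_gamma : Rel K k s a c (gen K et * gen K ga)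
      ((gen K ga * gen K al * gen K be) ^ (k - 1) * (gen K ga * gen K al))
  | rel_alpha_sq : Rel K k s a c (gen K al * gen K al)
      (a • ((gen K be * gen K ga * gen K al) ^ (k - 1) * (gen K be * gen K ga)) +
        c • (gen K be * gen K ga * gen K al) ^ k)
  | rel_gamma_beta : Rel K k s a c (gen K ga * gen K be) ((gen K et) ^ (s - 1))
  | rel_alpha_sq_beta : Rel K k s a c (gen K al * gen K al * gen K be) 0
  | rel_gamma_alpha_sq : Rel K k s a c (gen K ga * (gen K al * gen K al)) 0

/-- The algebra `A^{k,s}(a,c)` of quaternion type with two simple modules. -/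
abbrev Aa (K : Type) [Field K] (k s : ℕ) (a c : K) : Type :=
  RingQuot (Rel K k s a c)

variable (K : Type) [Field K] (k s : ℕ) (a c : K)

/-- The idempotent e₁ in `A^{k,s}(a,c)`. -/
noncomputable def E1 : Aa K k s a c := RingQuot.mkAlgHom K (Rel K k s a c) (gen K e1)
/-- The idempotent e₂ in `A^{k,s}(a,c)`. -/
noncomputable def E2 : Aa K k s a c := RingQuot.mkAlgHom K (Rel K k s a c) (gen K e2)
/-- The loop α in `A^{k,s}(a,c)`. -/
noncomputable def Al : Aa K k s a c := RingQuot.mkAlgHom K (Rel K k s a c) (gen K al)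
/-- The arrow β in `A^{k,s}(a,c)`. -/
noncomputable def Be : Aa K k s a c := RingQuot.mkAlgHom K (Rel K k s a c) (gen K be)
/-- The arrow γ in `A^{k,s}(a,c)`. -/
noncomputable def Ga : Aa K k s a c := RingQuot.mkAlgHom K (Rel K k s a c) (gen K ga)
/-- The loop η in `A^{k,s}(a,c)`. -/
noncomputable def Et : Aa K k s a c := RingQuot.mkAlgHom K (Rel K k s a c) (gen K et)

/-- The commutator subspace [A,A]: the K-subspace spanned by all commutators. -/
noncomputable def comm : Submodule K (Aa K k s a c) :=
  Submodule.span K {z : Aa K k s a c | ∃ u v : Aa K k s a c, z = u * v - v * u}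

/-- Index type for the basis B = B₁ ∪ B₂ ∪ B₃ ∪ B₄ of `A^{k,s}(a,c)`. -/
abbrev BIdx (k s : ℕ) : Type :=
  ((Fin k ⊕ Fin k) ⊕ (Fin (k - 1) ⊕ Fin (k + 1))) ⊕
    ((Fin (s + 1) ⊕ Fin (k - 1)) ⊕ ((Fin k ⊕ Fin k) ⊕ (Fin k ⊕ Fin k)))

/-- The family of elements of `A^{k,s}(a,c)` given by
B₁ = {α(βγα)^n, (βγα)^nβγ : 0 ≤ n ≤ k−1} ∪ {(βγα)^m : 1 ≤ m ≤ k−1} ∪ {(αβγ)^ℓ : 0 ≤ ℓ ≤ k},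
B₂ = {η^t : 0 ≤ t ≤ s} ∪ {(γαβ)^m : 1 ≤ m ≤ k−1},
B₃ = {(βγα)^nβ, α(βγα)^nβ : 0 ≤ n ≤ k−1},
B₄ = {(γαβ)^nγ, (γαβ)^nγα : 0 ≤ n ≤ k−1}. -/
noncomputable def bVec : BIdx k s → Aa K k s a c := fun i =>
  let α := Al K k s a c
  let β := Be K k s a c
  let γ := Ga K k s a c
  let η := Et K k s a c
  match i with
  | .inl (.inl (.inl n)) => α * (β * γ * α) ^ (n : ℕ)
  | .inl (.inl (.inr n)) => (β * γ * α) ^ (n : ℕ) * (β * γ)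
  | .inl (.inr (.inl m)) => (β * γ * α) ^ ((m : ℕ) + 1)
  | .inl (.inr (.inr l)) => (α * β * γ) ^ (l : ℕ)
  | .inr (.inl (.inl t)) => η ^ (t : ℕ)
  | .inr (.inl (.inr m)) => (γ * α * β) ^ ((m : ℕ) + 1)
  | .inr (.inr (.inl (.inl n))) => (β * γ * α) ^ (n : ℕ) * β
  | .inr (.inr (.inl (.inr n))) => α * (β * γ * α) ^ (n : ℕ) * β
  | .inr (.inr (.inr (.inl n))) => (γ * α * β) ^ (n : ℕ) * γ
  | .inr (.inr (.inr (.inr n))) => (γ * α * β) ^ (n : ℕ) * (γ * α)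

/-- `ψ` is the linear form on `A^{k,s}(a,c)` sending η^s and (αβγ)^k to 1 and every
other element of the basis B to 0. -/
noncomputable def IsPsi (ψ : Aa K k s a c →ₗ[K] K) : Prop :=
  ψ ((Et K k s a c) ^ s) = 1 ∧
  ψ ((Al K k s a c * Be K k s a c * Ga K k s a c) ^ k) = 1 ∧
  ∀ i : BIdx k s, bVec K k s a c i ≠ (Et K k s a c) ^ s →
    bVec K k s a c i ≠ (Al K k s a c * Be K k s a c * Ga K k s a c) ^ k →
    ψ (bVec K k s a c i) = 0

/-- The set T₁(A) = {x ∈ A : x² ∈ [A,A]} (characteristic 2). -/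
noncomputable def T1 : Set (Aa K k s a c) :=
  {z : Aa K k s a c | z ^ 2 ∈ comm K k s a c}

/-- The orthogonal space T₁(A)^⊥ of T₁(A) with respect to the symmetrising form
⟨u,v⟩ = ψ(uv): the space of all z with ψ(z·m) = 0 for all m ∈ T₁(A). -/
noncomputable def perp (ψ : Aa K k s a c →ₗ[K] K) : Submodule K (Aa K k s a c) :=
  ⨅ m ∈ T1 K k s a c, LinearMap.ker (ψ ∘ₗ LinearMap.mulRight K m)

end QT

namespace QW

/-- generators and relations inside an abstract algebra -/
structure Dat (K A : Type) [Field K] [Ring A] [Algebra K A] (k s : ℕ) (a c : K) where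
  e1 : A
  e2 : A
  al : A
  be : A
  ga : A
  et : A
  hk : 2 ≤ k
  hs : 3 ≤ s
  idem1 : e1 * e1 = e1
  idem2 : e2 * e2 = e2
  orth12 : e1 * e2 = 0
  orth21 : e2 * e1 = 0
  sum_idem : e1 + e2 = 1
  al_left : e1 * al = al
  al_right : al * e1 = al
  be_left : e1 * be = be
  be_right : be * e2 = be
  ga_left : e2 * ga = ga
  ga_right : ga * e1 = ga
  et_left : e2 * et = et
  et_right : et * e2 = et
  rbe : be * et = (al * be * ga) ^ (k - 1) * (al * be)
  reg : et * ga = (ga * al * be) ^ (k - 1) * (ga * al)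
  raa : al * al = a • ((be * ga * al) ^ (k - 1) * (be * ga)) + c • (be * ga * al) ^ k
  rgb : ga * be = et ^ (s - 1)
  raab : al * al * be = 0
  rgaa : ga * (al * al) = 0
  adj : Algebra.adjoin K ({e1, e2, al, be, ga, et} : Set A) = ⊤

namespace Dat
variable {K A : Type} [Field K] [Ring A] [Algebra K A] {k s : ℕ} {a c : K}
  (D : Dat K A k s a c)

def ar (p : ℕ) : A := if p % 3 = 0 then D.al else if p % 3 = 1 then D.be else D.ga
def ev (p : ℕ) : A := if p % 3 = 2 then D.e2 else D.e1
def W : ℕ → ℕ → A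
  | p, 0 => D.ev p
  | p, L + 1 => D.ar p * W (p + 1) L

lemma mod3 (p : ℕ) : p % 3 = 0 ∨ p % 3 = 1 ∨ p % 3 = 2 := by omega

lemma ar_congr {p q : ℕ} (h : p % 3 = q % 3) : D.ar p = D.ar q := by simp [ar, h]
lemma ev_congr {p q : ℕ} (h : p % 3 = q % 3) : D.ev p = D.ev q := by simp [ev, h]
lemma W_congr {p q : ℕ} (L : ℕ) (h : p % 3 = q % 3) : D.W p L = D.W q L := by
  induction L generalizing p q with
  | zero => exact D.ev_congr h
  | succ L ih =>
    simp only [W]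
    rw [D.ar_congr h, ih (p := p + 1) (q := q + 1) (by omega)]

lemma ar0 {p : ℕ} (h : p % 3 = 0) : D.ar p = D.al := by simp [ar, h]
lemma ar1 {p : ℕ} (h : p % 3 = 1) : D.ar p = D.be := by simp [ar, h]
lemma ar2 {p : ℕ} (h : p % 3 = 2) : D.ar p = D.ga := by simp [ar, h]
lemma ev0 {p : ℕ} (h : p % 3 = 0) : D.ev p = D.e1 := by simp [ev, h]
lemma ev1 {p : ℕ} (h : p % 3 = 1) : D.ev p = D.e1 := by simp [ev, h]
lemma ev2 {p : ℕ} (h : p % 3 = 2) : D.ev p = D.e2 := by simp [ev, h]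

lemma ev_ar (p : ℕ) : D.ev p * D.ar p = D.ar p := by
  rcases mod3 p with h | h | h
  · rw [D.ev0 h, D.ar0 h, D.al_left]
  · rw [D.ev1 h, D.ar1 h, D.be_left]
  · rw [D.ev2 h, D.ar2 h, D.ga_left]

lemma ar_ev (p : ℕ) : D.ar p * D.ev (p + 1) = D.ar p := by
  rcases mod3 p with h | h | h
  · rw [D.ev1 (p := p + 1) (by omega), D.ar0 h, D.al_right]
  · rw [D.ev2 (p := p + 1) (by omega), D.ar1 h, D.be_right]
  · rw [D.ev0 (p := p + 1) (by omega), D.ar2 h, D.ga_right]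

lemma ev_idem (p : ℕ) : D.ev p * D.ev p = D.ev p := by
  rcases mod3 p with h | h | h
  · rw [D.ev0 h, D.idem1]
  · rw [D.ev1 h, D.idem1]
  · rw [D.ev2 h, D.idem2]

lemma ev_W (p L : ℕ) : D.ev p * D.W p L = D.W p L := by
  cases L with
  | zero => exact D.ev_idem p
  | succ L => simp only [W]; rw [← mul_assoc, D.ev_ar]

lemma W_add (p L M : ℕ) : D.W p L * D.W (p + L) M = D.W p (L + M) := by
  induction L generalizing p with
  | zero => simpa [W] using D.ev_W p M
  | succ L ih =>
    rw [show L + 1 + M = (L + M) + 1 by omega]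
    simp only [W]
    rw [mul_assoc, show p + (L + 1) = (p + 1) + L by omega, ih]

lemma W_mul {p L q M : ℕ} (h : q % 3 = (p + L) % 3) : D.W p L * D.W q M = D.W p (L + M) := by
  rw [D.W_congr M h, W_add]

lemma W_one (p : ℕ) : D.W p 1 = D.ar p := by simp [W, D.ar_ev]

lemma W_ev (p L : ℕ) : D.W p L * D.ev (p + L) = D.W p L := by
  have := D.W_add p L 0
  simpa [W] using this

lemma W_zero (p : ℕ) : D.W p 0 = D.ev p := rfl

lemma W_succ' (p L : ℕ) : D.W p (L + 1) = D.W p L * D.ar (p + L) := by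
  rw [← W_add, W_one]

lemma W_pow (p n r : ℕ) : D.W p (3 * n + r) = (D.ar p * D.ar (p + 1) * D.ar (p + 2)) ^ n * D.W p r := by
  induction n with
  | zero => simp
  | succ n ih =>
    rw [show 3 * (n + 1) + r = (3 * n + r) + 1 + 1 + 1 by omega]
    simp only [W]
    rw [D.W_congr (p := p + 1 + 1 + 1) (q := p) _ (by omega), ih, pow_succ']
    simp only [mul_assoc]

lemma W_two (p : ℕ) : D.W p 2 = D.ar p * D.ar (p + 1) := by
  rw [show 2 = 1 + 1 by rfl, W_succ', W_one]

lemma W_three (p n : ℕ) (hn : 1 ≤ n) :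
    D.W p (3 * n) = (D.ar p * D.ar (p + 1) * D.ar (p + 2)) ^ n := by
  obtain ⟨m, rfl⟩ : ∃ m, n = m + 1 := ⟨n - 1, by omega⟩
  rw [show 3 * (m + 1) = 3 * m + 3 by ring, W_pow, pow_succ]
  congr 1
  rw [show (3:ℕ) = 2 + 1 by rfl, W_succ', W_two]

lemma A0 : D.ar 0 = D.al := rfl
lemma A1 : D.ar 1 = D.be := rfl
lemma A2 : D.ar 2 = D.ga := rfl
lemma A3 : D.ar 3 = D.al := rfl
lemma A4 : D.ar 4 = D.be := rfl

lemma be_et : D.be * D.et = D.W 0 (3 * k - 1) := by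
  have := D.hk
  rw [D.rbe, show 3 * k - 1 = 3 * (k - 1) + 2 by omega, W_pow, W_two]
  rfl
lemma et_ga : D.et * D.ga = D.W 2 (3 * k - 1) := by
  have := D.hk
  rw [D.reg, show 3 * k - 1 = 3 * (k - 1) + 2 by omega, W_pow, W_two]
  rfl
lemma al_al : D.al * D.al = a • D.W 1 (3 * k - 1) + c • D.W 1 (3 * k) := by
  have := D.hk
  rw [D.raa, show 3 * k - 1 = 3 * (k - 1) + 2 by omega, W_pow, W_two, W_three _ _ _ (by omega)]
  rfl

-- vertex orthogonality
lemma al_e2 : D.al * D.e2 = 0 := by rw [← D.al_right, mul_assoc, D.orth12, mul_zero]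
lemma e2_al : D.e2 * D.al = 0 := by rw [← D.al_left, ← mul_assoc, D.orth21, zero_mul]
lemma be_e1 : D.be * D.e1 = 0 := by rw [← D.be_right, mul_assoc, D.orth21, mul_zero]
lemma e2_be : D.e2 * D.be = 0 := by rw [← D.be_left, ← mul_assoc, D.orth21, zero_mul]
lemma ga_e2 : D.ga * D.e2 = 0 := by rw [← D.ga_right, mul_assoc, D.orth12, mul_zero]
lemma e1_ga : D.e1 * D.ga = 0 := by rw [← D.ga_left, ← mul_assoc, D.orth12, zero_mul]
lemma et_e1 : D.et * D.e1 = 0 := by rw [← D.et_right, mul_assoc, D.orth21, mul_zero]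
lemma e1_et : D.e1 * D.et = 0 := by rw [← D.et_left, ← mul_assoc, D.orth12, zero_mul]
lemma al_ga : D.al * D.ga = 0 := by rw [← D.ga_left, ← mul_assoc, D.al_e2, zero_mul]
lemma be_be : D.be * D.be = 0 := by
  rw [← D.be_left, ← mul_assoc, mul_assoc _ D.be, D.be_e1, mul_zero, zero_mul]
lemma be_al : D.be * D.al = 0 := by rw [← D.al_left, ← mul_assoc, D.be_e1, zero_mul]
lemma ga_ga : D.ga * D.ga = 0 := by
  rw [← D.ga_left, ← mul_assoc, mul_assoc _ D.ga, D.ga_e2, mul_zero, zero_mul]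
lemma al_et : D.al * D.et = 0 := by rw [← D.et_left, ← mul_assoc, D.al_e2, zero_mul]
lemma et_al : D.et * D.al = 0 := by rw [← D.et_right, mul_assoc, D.e2_al, mul_zero]
lemma ga_et : D.ga * D.et = 0 := by rw [← D.et_left, ← mul_assoc, D.ga_e2, zero_mul]
lemma et_be : D.et * D.be = 0 := by rw [← D.et_right, mul_assoc, D.e2_be, mul_zero]

-- `η²γ = 0`, `βη² = 0`
lemma eeg : D.et * (D.et * D.ga) = 0 := by
  have := D.hk
  rw [D.et_ga]
  obtain ⟨n, hn⟩ : ∃ n, 3 * k - 1 = n + 1 + 1 := ⟨3 * k - 3, by omega⟩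
  have h2 : D.W 2 (3 * k - 1) = D.ga * D.W 3 (n + 1) := by rw [hn]; rfl
  have h3 : D.W 2 (3 * k - 1) = D.W 2 n * (D.ga * D.al) := by
    rw [hn, W_succ', W_succ', D.ar2 (by omega), D.ar0 (by omega), mul_assoc]
  have h4 : D.W 3 (n + 1) = D.al * D.W 4 n := rfl
  rw [h2, ← mul_assoc, D.et_ga, h3, h4, show D.W 2 n * (D.ga * D.al) * (D.al * D.W 4 n) =
    D.W 2 n * (D.ga * (D.al * D.al)) * D.W 4 n by simp only [mul_assoc], D.rgaa]
  simp

lemma bee : D.be * D.et * D.et = 0 := by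
  have := D.hk
  rw [D.be_et]
  obtain ⟨n, hn⟩ : ∃ n, 3 * k - 1 = n + 1 + 1 := ⟨3 * k - 3, by omega⟩
  have h2 : D.W 0 (3 * k - 1) = D.W 0 n * D.al * D.be := by
    rw [hn, W_succ', W_succ', D.ar0 (p := 0 + n) (by omega), D.ar1 (by omega)]
  have h3 : D.W 0 (3 * k - 1) = D.al * (D.be * D.W 2 n) := by rw [hn]; rfl
  rw [h2, mul_assoc _ D.be, D.be_et, h3, show D.W 0 n * D.al * (D.al * (D.be * D.W 2 n)) =
    D.W 0 n * (D.al * D.al * D.be) * D.W 2 n by simp only [mul_assoc], D.raab]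
  simp

lemma be_pow {t : ℕ} (ht : 2 ≤ t) : D.be * D.et ^ t = 0 := by
  obtain ⟨n, rfl⟩ : ∃ n, t = 2 + n := ⟨t - 2, by omega⟩
  rw [pow_add, pow_two, ← mul_assoc, ← mul_assoc, D.bee, zero_mul]
lemma pow_ga {t : ℕ} (ht : 2 ≤ t) : D.et ^ t * D.ga = 0 := by
  obtain ⟨n, rfl⟩ : ∃ n, t = n + 2 := ⟨t - 2, by omega⟩
  rw [pow_add, pow_two, mul_assoc, mul_assoc, D.eeg, mul_zero]

lemma gbg : D.ga * D.be * D.ga = 0 := by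
  have := D.hs
  rw [D.rgb, D.pow_ga (by omega)]
lemma bgb : D.be * (D.ga * D.be) = 0 := by
  have := D.hs
  rw [D.rgb, D.be_pow (by omega)]

/-- mismatched products vanish -/
lemma W_mul0 {p L q M : ℕ} (h : q % 3 ≠ (p + L) % 3) (hL : 1 ≤ L) (hM : 1 ≤ M) (hLM : 3 ≤ L + M) :
    D.W p L * D.W q M = 0 := by
  obtain ⟨L, rfl⟩ : ∃ n, L = n + 1 := ⟨L - 1, by omega⟩
  obtain ⟨M, rfl⟩ : ∃ n, M = n + 1 := ⟨M - 1, by omega⟩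
  have h1 : D.W q (M + 1) = D.ar q * D.W (q + 1) M := rfl
  have key : D.ar (p + L) * D.ar q = 0 → D.W p (L + 1) * D.W q (M + 1) = 0 := by
    intro h2
    rw [h1, W_succ', mul_assoc, ← mul_assoc (D.ar _), h2, zero_mul, mul_zero]
  have keyR : D.ar (p + L) * D.ar q * D.ar (q + 1) = 0 → 1 ≤ M →
      D.W p (L + 1) * D.W q (M + 1) = 0 := by
    intro h2 hM
    obtain ⟨M, rfl⟩ : ∃ n, M = n + 1 := ⟨M - 1, by omega⟩
    have h3 : D.W (q + 1) (M + 1) = D.ar (q + 1) * D.W (q + 1 + 1) M := rfl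
    rw [h1, W_succ', h3, show D.W p L * D.ar (p + L) * (D.ar q * (D.ar (q + 1) * D.W (q + 1 + 1) M))
      = D.W p L * (D.ar (p + L) * D.ar q * D.ar (q + 1)) * D.W (q + 1 + 1) M by
      simp only [mul_assoc], h2]
    simp
  have keyL : ∀ i, i % 3 = (p + L + 2) % 3 → D.ar i * (D.ar (p + L) * D.ar q) = 0 → 1 ≤ L →
      D.W p (L + 1) * D.W q (M + 1) = 0 := by
    intro i hi h2 hL
    obtain ⟨L, rfl⟩ : ∃ n, L = n + 1 := ⟨L - 1, by omega⟩
    rw [h1, W_succ', W_succ', D.ar_congr (p := p + L) (q := i) (by omega),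
      show D.W p L * D.ar i * D.ar (p + (L + 1)) * (D.ar q * D.W (q + 1) M)
      = D.W p L * (D.ar i * (D.ar (p + (L + 1)) * D.ar q)) * D.W (q + 1) M by
      simp only [mul_assoc], h2]
    simp
  rcases mod3 (p + L) with hp | hp | hp <;> rcases mod3 q with hq | hq | hq
  · by_cases hM1 : 1 ≤ M
    · refine keyR ?_ hM1
      rw [D.ar0 hp, D.ar0 hq, D.ar1 (by omega), D.raab]
    · refine keyL 2 (by omega) ?_ (by omega)
      rw [D.ar0 hp, D.ar0 hq, D.ar2 (by omega), D.rgaa]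
  · omega
  · exact key (by rw [D.ar0 hp, D.ar2 hq, D.al_ga])
  · exact key (by rw [D.ar1 hp, D.ar0 hq, D.be_al])
  · exact key (by rw [D.ar1 hp, D.ar1 hq, D.be_be])
  · omega
  · omega
  · by_cases hM1 : 1 ≤ M
    · refine keyR ?_ hM1
      rw [D.ar2 hp, D.ar1 hq, D.ar2 (by omega), D.gbg]
    · refine keyL 1 (by omega) ?_ (by omega)
      rw [D.ar2 hp, D.ar1 hq, D.ar1 (by omega), D.bgb]
  · exact key (by rw [D.ar2 hp, D.ar2 hq, D.ga_ga])

lemma z1_eq : D.W 0 (3 * k) = D.W 1 (3 * k) := by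
  have := D.hk
  have h1 : D.be * D.et * D.ga = D.W 0 (3 * k) := by
    rw [D.be_et, ← D.A2, D.ar_congr (p := 2) (q := 0 + (3 * k - 1)) (by omega), ← W_succ']
    congr 1; omega
  have h2 : D.be * D.et * D.ga = D.W 1 (3 * k) := by
    rw [mul_assoc, D.et_ga, show 3 * k = (3 * k - 1) + 1 by omega]
    rfl
  rw [← h1, h2]

lemma W_top (p : ℕ) : D.W p (3 * k + 1) = 0 := by
  have := D.hk
  rcases mod3 p with h | h | h
  · rw [show D.W p (3 * k + 1) = D.ar p * D.W (p + 1) (3 * k) from rfl,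
      D.W_congr (p := p + 1) (q := 1) _ (by omega), ← D.z1_eq, ← W_one,
      D.W_mul0 (by omega) (by omega) (by omega) (by omega)]
  · rw [W_succ', D.W_congr (q := 1) _ (by omega), ← D.z1_eq, ← W_one,
      D.W_mul0 (by omega) (by omega) (by omega) (by omega)]
  · rw [show D.W p (3 * k + 1) = D.ar p * D.W (p + 1) (3 * k) from rfl,
      D.W_congr (p := p + 1) (q := 0) _ (by omega), D.z1_eq, ← W_one,
      D.W_mul0 (by omega) (by omega) (by omega) (by omega)]

lemma W_big {p L : ℕ} (h : 3 * k < L) : D.W p L = 0 := by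
  obtain ⟨n, rfl⟩ : ∃ n, L = (3 * k + 1) + n := ⟨L - (3 * k + 1), by omega⟩
  rw [← W_add, W_top, zero_mul]

lemma z2_eq : D.et ^ s = D.W 2 (3 * k) := by
  have := D.hk
  have := D.hs
  have h : D.et ^ s = D.et * D.et ^ (s - 1) := by
    rw [← pow_succ']; congr 1; omega
  rw [h, ← D.rgb, ← mul_assoc, D.et_ga, ← D.A1,
    D.ar_congr (p := 1) (q := 2 + (3 * k - 1)) (by omega), ← W_succ']
  congr 1; omega

/-- products with eta -/
lemma W_et {p L : ℕ} (h : 2 ≤ L) : D.W p L * D.et = 0 := by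
  have := D.hk
  obtain ⟨L, rfl⟩ : ∃ n, L = n + 1 := ⟨L - 1, by omega⟩
  rw [W_succ', mul_assoc]
  rcases mod3 (p + L) with hp | hp | hp
  · rw [D.ar0 hp, D.al_et, mul_zero]
  · rw [D.ar1 hp, D.be_et, D.W_mul0 (by omega) (by omega) (by omega) (by omega)]
  · rw [D.ar2 hp, D.ga_et, mul_zero]
lemma et_W {p L : ℕ} (h : 2 ≤ L) : D.et * D.W p L = 0 := by
  have := D.hk
  obtain ⟨L, rfl⟩ : ∃ n, L = n + 1 := ⟨L - 1, by omega⟩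
  rw [show D.W p (L + 1) = D.ar p * D.W (p + 1) L from rfl, ← mul_assoc]
  rcases mod3 p with hp | hp | hp
  · rw [D.ar0 hp, D.et_al, zero_mul]
  · rw [D.ar1 hp, D.et_be, zero_mul]
  · rw [D.ar2 hp, D.et_ga, D.W_mul0 (by omega) (by omega) (by omega) (by omega)]

lemma W_etp {p L t : ℕ} (hL : 1 ≤ L) (ht : 2 ≤ t) : D.W p L * D.et ^ t = 0 := by
  obtain ⟨L, rfl⟩ : ∃ n, L = n + 1 := ⟨L - 1, by omega⟩
  obtain ⟨t, rfl⟩ : ∃ n, t = n + 1 := ⟨t - 1, by omega⟩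
  rw [W_succ', mul_assoc]
  rcases mod3 (p + L) with hp | hp | hp
  · rw [D.ar0 hp, pow_succ', ← mul_assoc D.al, D.al_et, zero_mul, mul_zero]
  · rw [D.ar1 hp, D.be_pow ht, mul_zero]
  · rw [D.ar2 hp, pow_succ', ← mul_assoc D.ga, D.ga_et, zero_mul, mul_zero]
lemma etp_W {p L t : ℕ} (hL : 1 ≤ L) (ht : 2 ≤ t) : D.et ^ t * D.W p L = 0 := by
  obtain ⟨L, rfl⟩ : ∃ n, L = n + 1 := ⟨L - 1, by omega⟩
  obtain ⟨t, rfl⟩ : ∃ n, t = n + 1 := ⟨t - 1, by omega⟩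
  rw [show D.W p (L + 1) = D.ar p * D.W (p + 1) L from rfl, ← mul_assoc]
  rcases mod3 p with hp | hp | hp
  · rw [D.ar0 hp, pow_succ, mul_assoc (D.et ^ t), D.et_al, mul_zero, zero_mul]
  · rw [D.ar1 hp, pow_succ, mul_assoc (D.et ^ t), D.et_be, mul_zero, zero_mul]
  · rw [D.ar2 hp, D.pow_ga ht, zero_mul]

lemma etp_big {t : ℕ} (h : s < t) : D.et ^ t = 0 := by
  have := D.hk
  obtain ⟨n, rfl⟩ : ∃ n, t = s + 1 + n := ⟨t - (s + 1), by omega⟩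
  rw [pow_add, pow_succ, z2_eq, D.W_et (by omega), zero_mul]

lemma W_et' (p L : ℕ) (h : 1 ≤ L) : D.W p L * D.et = if L = 1 ∧ p % 3 = 1 then D.W 0 (3 * k - 1) else 0 := by
  by_cases h2 : 2 ≤ L
  · rw [D.W_et h2, if_neg (by omega)]
  · have : L = 1 := by omega
    subst this
    rw [W_one]
    rcases mod3 p with hp | hp | hp
    · rw [D.ar0 hp, D.al_et, if_neg (by omega)]
    · rw [D.ar1 hp, D.be_et, if_pos (by omega)]
    · rw [D.ar2 hp, D.ga_et, if_neg (by omega)]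
lemma et_W' (p L : ℕ) (h : 1 ≤ L) : D.et * D.W p L = if L = 1 ∧ p % 3 = 2 then D.W 2 (3 * k - 1) else 0 := by
  by_cases h2 : 2 ≤ L
  · rw [D.et_W h2, if_neg (by omega)]
  · have : L = 1 := by omega
    subst this
    rw [W_one]
    rcases mod3 p with hp | hp | hp
    · rw [D.ar0 hp, D.et_al, if_neg (by omega)]
    · rw [D.ar1 hp, D.et_be, if_neg (by omega)]
    · rw [D.ar2 hp, D.et_ga, if_pos (by omega)]

/-- 1 by 1 products -/
lemma W11 (p q : ℕ) (h : q % 3 ≠ (p + 1) % 3) : D.W p 1 * D.W q 1 =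
    if p % 3 = 0 ∧ q % 3 = 0 then a • D.W 1 (3 * k - 1) + c • D.W 1 (3 * k)
    else if p % 3 = 2 ∧ q % 3 = 1 then D.et ^ (s - 1) else 0 := by
  rw [W_one, W_one]
  rcases mod3 p with hp | hp | hp <;> rcases mod3 q with hq | hq | hq <;> try omega
  all_goals simp only [hp, hq]; simp
  · rw [D.ar0 hp, D.ar0 hq, D.al_al]
  · rw [D.ar0 hp, D.ar2 hq, D.al_ga]
  · rw [D.ar1 hp, D.ar0 hq, D.be_al]
  · rw [D.ar1 hp, D.ar1 hq, D.be_be]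
  · rw [D.ar2 hp, D.ar1 hq, D.rgb]
  · rw [D.ar2 hp, D.ar2 hq, D.ga_ga]

lemma e1_W {p L : ℕ} : D.e1 * D.W p L = if p % 3 = 2 then 0 else D.W p L := by
  rw [← D.ev_W p L, ← mul_assoc]
  rcases mod3 p with hp | hp | hp
  · rw [D.ev0 hp, D.idem1, if_neg (by omega)]
  · rw [D.ev1 hp, D.idem1, if_neg (by omega)]
  · rw [D.ev2 hp, D.orth12, if_pos (by omega), zero_mul]
lemma e2_W {p L : ℕ} : D.e2 * D.W p L = if p % 3 = 2 then D.W p L else 0 := by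
  rw [← D.ev_W p L, ← mul_assoc]
  rcases mod3 p with hp | hp | hp
  · rw [D.ev0 hp, D.orth21, if_neg (by omega), zero_mul]
  · rw [D.ev1 hp, D.orth21, if_neg (by omega), zero_mul]
  · rw [D.ev2 hp, D.idem2, if_pos (by omega)]
lemma W_e1 {p L : ℕ} : D.W p L * D.e1 = if (p + L) % 3 = 2 then 0 else D.W p L := by
  rw [← D.W_ev p L, mul_assoc]
  rcases mod3 (p + L) with hp | hp | hp
  · rw [D.ev0 hp, D.idem1, if_neg (by omega)]
  · rw [D.ev1 hp, D.idem1, if_neg (by omega)]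
  · rw [D.ev2 hp, D.orth21, if_pos (by omega), mul_zero]
lemma W_e2 {p L : ℕ} : D.W p L * D.e2 = if (p + L) % 3 = 2 then D.W p L else 0 := by
  rw [← D.W_ev p L, mul_assoc]
  rcases mod3 (p + L) with hp | hp | hp
  · rw [D.ev0 hp, D.orth12, if_neg (by omega), mul_zero]
  · rw [D.ev1 hp, D.orth12, if_neg (by omega), mul_zero]
  · rw [D.ev2 hp, D.idem2, if_pos (by omega)]
lemma e1_etp {t : ℕ} (h : 1 ≤ t) : D.e1 * D.et ^ t = 0 := by
  obtain ⟨t, rfl⟩ : ∃ n, t = n + 1 := ⟨t - 1, by omega⟩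
  rw [pow_succ', ← mul_assoc, D.e1_et, zero_mul]
lemma etp_e1 {t : ℕ} (h : 1 ≤ t) : D.et ^ t * D.e1 = 0 := by
  obtain ⟨t, rfl⟩ : ∃ n, t = n + 1 := ⟨t - 1, by omega⟩
  rw [pow_succ, mul_assoc, D.et_e1, mul_zero]
lemma e2_etp {t : ℕ} (h : 1 ≤ t) : D.e2 * D.et ^ t = D.et ^ t := by
  obtain ⟨t, rfl⟩ : ∃ n, t = n + 1 := ⟨t - 1, by omega⟩
  rw [pow_succ', ← mul_assoc, D.et_left]
lemma etp_e2 {t : ℕ} (h : 1 ≤ t) : D.et ^ t * D.e2 = D.et ^ t := by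
  obtain ⟨t, rfl⟩ : ∃ n, t = n + 1 := ⟨t - 1, by omega⟩
  rw [pow_succ, mul_assoc, D.et_right]
/-- index type of the spanning family -/
abbrev J (k s : ℕ) : Type := (Fin 2 ⊕ Fin 2) ⊕ (Fin (s - 1) ⊕ (Fin 3 × Fin (3 * k - 1)))

def v : J k s → A
  | .inl (.inl i) => if i = 0 then D.e1 else D.e2
  | .inl (.inr i) => if i = 0 then D.W 0 (3 * k) else D.W 2 (3 * k)
  | .inr (.inl t) => D.et ^ ((t : ℕ) + 1)
  | .inr (.inr pl) => D.W (pl.1 : ℕ) ((pl.2 : ℕ) + 1)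

lemma span_e1 : D.e1 ∈ Submodule.span K (Set.range D.v) :=
  Submodule.subset_span ⟨.inl (.inl 0), by simp [v]⟩
lemma span_e2 : D.e2 ∈ Submodule.span K (Set.range D.v) :=
  Submodule.subset_span ⟨.inl (.inl 1), by simp [v]⟩

lemma W_mod (p L : ℕ) : D.W p L = D.W (p % 3) L := D.W_congr L (by omega)

lemma span_W (p L : ℕ) : D.W p L ∈ Submodule.span K (Set.range D.v) := by
  have := D.hk
  rcases Nat.eq_zero_or_pos L with rfl | hL
  · rw [W_zero]
    rcases mod3 p with h | h | h
    · rw [D.ev0 h]; exact D.span_e1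
    · rw [D.ev1 h]; exact D.span_e1
    · rw [D.ev2 h]; exact D.span_e2
  by_cases h1 : L < 3 * k
  · refine Submodule.subset_span ⟨.inr (.inr (⟨p % 3, by omega⟩, ⟨L - 1, by omega⟩)), ?_⟩
    simp only [v]
    rw [D.W_mod p, show L - 1 + 1 = L by omega]
  by_cases h2 : L = 3 * k
  · subst h2
    rcases mod3 p with h | h | h
    · exact Submodule.subset_span ⟨.inl (.inr 0), by simp only [v]; rw [D.W_mod p, h]; simp⟩
    · exact Submodule.subset_span ⟨.inl (.inr 0), by
        simp only [v]; rw [D.W_mod p, h, ← D.z1_eq]; simp⟩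
    · exact Submodule.subset_span ⟨.inl (.inr 1), by simp only [v]; rw [D.W_mod p, h]; simp⟩
  · rw [D.W_big (by omega)]; exact Submodule.zero_mem _

lemma span_et (t : ℕ) (ht : 1 ≤ t) : D.et ^ t ∈ Submodule.span K (Set.range D.v) := by
  have := D.hs
  by_cases h1 : t < s
  · refine Submodule.subset_span ⟨.inr (.inl ⟨t - 1, by omega⟩), ?_⟩
    simp only [v]
    congr 1; omega
  by_cases h2 : t = s
  · rw [h2, z2_eq]; exact D.span_W _ _
  · rw [D.etp_big (by omega)]; exact Submodule.zero_mem _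

lemma W1_W_span (q p L : ℕ) : D.W q 1 * D.W p L ∈ Submodule.span K (Set.range D.v) := by
  have := D.hk
  have := D.hs
  by_cases h : p % 3 = (q + 1) % 3
  · rw [D.W_mul h]; exact D.span_W _ _
  rcases Nat.lt_trichotomy L 1 with hL | hL | hL
  · have : L = 0 := by omega
    subst this
    rw [W_zero]
    rcases mod3 p with h | h | h
    · rw [D.ev0 h, D.W_e1]; split_ifs
      · exact Submodule.zero_mem _
      · exact D.span_W _ _
    · rw [D.ev1 h, D.W_e1]; split_ifs
      · exact Submodule.zero_mem _
      · exact D.span_W _ _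
    · rw [D.ev2 h, D.W_e2]; split_ifs
      · exact D.span_W _ _
      · exact Submodule.zero_mem _
  · subst hL
    rw [D.W11 _ _ h]
    split_ifs
    · exact Submodule.add_mem _ (Submodule.smul_mem _ _ (D.span_W _ _))
        (Submodule.smul_mem _ _ (D.span_W _ _))
    · exact D.span_et _ (by omega)
    · exact Submodule.zero_mem _
  · rw [D.W_mul0 h (by omega) (by omega) (by omega)]; exact Submodule.zero_mem _

/-- multiplication on the spanning family by an element -/
lemma mul_span {g : A} (h1 : g * D.e1 ∈ Submodule.span K (Set.range D.v))
    (h2 : g * D.e2 ∈ Submodule.span K (Set.range D.v))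
    (h3 : ∀ p L, 1 ≤ L → g * D.W p L ∈ Submodule.span K (Set.range D.v))
    (h4 : ∀ t, 1 ≤ t → g * D.et ^ t ∈ Submodule.span K (Set.range D.v))
    (x : A) (hx : x ∈ Submodule.span K (Set.range D.v)) :
    g * x ∈ Submodule.span K (Set.range D.v) := by
  have := D.hk
  induction hx using Submodule.span_induction with
  | mem x hx =>
    obtain ⟨j, rfl⟩ := hx
    rcases j with (i | i) | (t | pl)
    · simp only [v]; split_ifs
      · exact h1
      · exact h2
    · simp only [v]; split_ifs
      · exact h3 _ _ (by omega)
      · exact h3 _ _ (by omega)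
    · exact h4 _ (by omega)
    · exact h3 _ _ (by omega)
  | zero => simp
  | add x y _ _ hx hy => rw [mul_add]; exact Submodule.add_mem _ hx hy
  | smul r x _ hx => rw [mul_smul_comm]; exact Submodule.smul_mem _ _ hx

lemma ar_span (q : ℕ) (x : A) (hx : x ∈ Submodule.span K (Set.range D.v)) :
    D.ar q * x ∈ Submodule.span K (Set.range D.v) := by
  rw [← W_one]
  refine D.mul_span ?_ ?_ (fun p L _ => D.W1_W_span q p L) ?_ x hx
  · exact D.W1_W_span q 0 0
  · exact D.W1_W_span q 2 0
  · intro t ht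
    by_cases h : t = 1
    · subst h
      rw [pow_one, D.W_et' _ _ le_rfl]
      split_ifs
      · exact D.span_W _ _
      · exact Submodule.zero_mem _
    · rw [D.W_etp le_rfl (by omega)]; exact Submodule.zero_mem _

lemma span_top : Submodule.span K (Set.range D.v) = ⊤ := by
  rw [eq_top_iff]
  have key : ∀ x : A, ∀ y ∈ Submodule.span K (Set.range D.v),
      x * y ∈ Submodule.span K (Set.range D.v) := by
    intro x
    have hx : x ∈ Algebra.adjoin K ({D.e1, D.e2, D.al, D.be, D.ga, D.et} : Set A) := by
      rw [D.adj]; trivial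
    induction hx using Algebra.adjoin_induction with
    | mem x hx =>
      intro y hy
      simp only [Set.mem_insert_iff, Set.mem_singleton_iff] at hx
      rcases hx with rfl | rfl | rfl | rfl | rfl | rfl
      · refine D.mul_span ?_ ?_ ?_ ?_ y hy
        · rw [D.idem1]; exact D.span_e1
        · rw [D.orth12]; exact Submodule.zero_mem _
        · intro p L _
          rw [D.e1_W]; split_ifs
          · exact Submodule.zero_mem _
          · exact D.span_W _ _
        · intro t ht; rw [D.e1_etp ht]; exact Submodule.zero_mem _
      · refine D.mul_span ?_ ?_ ?_ ?_ y hy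
        · rw [D.orth21]; exact Submodule.zero_mem _
        · rw [D.idem2]; exact D.span_e2
        · intro p L _
          rw [D.e2_W]; split_ifs
          · exact D.span_W _ _
          · exact Submodule.zero_mem _
        · intro t ht; rw [D.e2_etp ht]; exact D.span_et _ ht
      · exact D.ar_span 0 y hy
      · exact D.ar_span 1 y hy
      · exact D.ar_span 2 y hy
      · refine D.mul_span ?_ ?_ ?_ ?_ y hy
        · rw [D.et_e1]; exact Submodule.zero_mem _
        · rw [D.et_right]; simpa using D.span_et 1 le_rfl
        · intro p L h
          rw [D.et_W' _ _ h]; split_ifs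
          · exact D.span_W _ _
          · exact Submodule.zero_mem _
        · intro t ht; rw [← pow_succ']; exact D.span_et _ (by omega)
    | algebraMap r =>
      intro y hy
      rw [← Algebra.smul_def]; exact Submodule.smul_mem _ _ hy
    | add x y _ _ hx hy =>
      intro z hz; rw [add_mul]; exact Submodule.add_mem _ (hx z hz) (hy z hz)
    | mul x y _ _ hx hy =>
      intro z hz; rw [mul_assoc]; exact hx _ (hy z hz)
  intro x _
  rw [← mul_one x, ← D.sum_idem]
  exact key _ _ (Submodule.add_mem _ D.span_e1 D.span_e2)

/-- induction principle -/
lemma ind {P : A → Prop} (hadd : ∀ x y, P x → P y → P (x + y)) (hsmul : ∀ (r : K) x, P x → P (r • x))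
    (h1 : P D.e1) (h2 : P D.e2) (h3 : ∀ t, 1 ≤ t → t < s → P (D.et ^ t))
    (h4 : ∀ p L, p < 3 → 1 ≤ L → L ≤ 3 * k → P (D.W p L)) (x : A) : P x := by
  have := D.hk
  have hx : x ∈ Submodule.span K (Set.range D.v) := by rw [D.span_top]; trivial
  induction hx using Submodule.span_induction with
  | mem x hx =>
    obtain ⟨j, rfl⟩ := hx
    rcases j with (i | i) | (t | pl)
    · simp only [v]; split_ifs
      · exact h1
      · exact h2
    · simp only [v]; split_ifs
      · exact h4 _ _ (by omega) (by omega) (by omega)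
      · exact h4 _ _ (by omega) (by omega) (by omega)
    · exact h3 _ (by omega) (by omega)
    · exact h4 _ _ (by omega) (by omega) (by omega)
  | zero => simpa using hsmul 0 _ h1
  | add x y _ _ hx hy => exact hadd _ _ hx hy
  | smul r x _ hx => exact hsmul _ _ hx

/-- the values of the form -/
structure Psi (ψ : A →ₗ[K] K) : Prop where
  W0 : ∀ p L, 1 ≤ L → L < 3 * k → ψ (D.W p L) = 0
  Wt : ∀ p, ψ (D.W p (3 * k)) = 1
  E0 : ∀ t, 1 ≤ t → t < s → ψ (D.et ^ t) = 0

variable {D} {ψ : A →ₗ[K] K} (H : D.Psi ψ)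
include H

lemma psiW (p L : ℕ) (hL : 1 ≤ L) : ψ (D.W p L) = if L = 3 * k then 1 else 0 := by
  split_ifs with h
  · rw [h, H.Wt]
  · by_cases h2 : L < 3 * k
    · exact H.W0 _ _ hL h2
    · rw [D.W_big (by omega), map_zero]

lemma psiE (t : ℕ) (ht : 1 ≤ t) : ψ (D.et ^ t) = if t = s then 1 else 0 := by
  split_ifs with h
  · rw [h, D.z2_eq, H.Wt]
  · by_cases h2 : t < s
    · exact H.E0 _ ht h2
    · rw [D.etp_big (by omega), map_zero]

lemma psiWW (p L q M : ℕ) (hL : 1 ≤ L) (hM : 1 ≤ M) : ψ (D.W p L * D.W q M) =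
    if q % 3 = (p + L) % 3 then (if L + M = 3 * k then 1 else 0)
    else if p % 3 = 0 ∧ q % 3 = 0 ∧ L = 1 ∧ M = 1 then c else 0 := by
  have := D.hk
  have := D.hs
  by_cases h : q % 3 = (p + L) % 3
  · rw [if_pos h, D.W_mul h, psiW H _ _ (by omega)]
  rw [if_neg h]
  by_cases h2 : 3 ≤ L + M
  · rw [D.W_mul0 h hL hM h2, if_neg (by omega), map_zero]
  have h3 : L = 1 := by omega
  have h4 : M = 1 := by omega
  subst h3 h4
  rw [D.W11 _ _ h]
  by_cases h5 : p % 3 = 0 ∧ q % 3 = 0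
  · rw [if_pos h5, if_pos (by omega), map_add, map_smul, map_smul, H.Wt, H.W0 _ _ (by omega) (by omega)]
    simp
  · have h6 : ¬ (p % 3 = 0 ∧ q % 3 = 0 ∧ 1 = 1 ∧ 1 = 1) := by tauto
    rw [if_neg h5, if_neg h6]
    split_ifs
    · exact H.E0 _ (by omega) (by omega)
    · simp

lemma psiWE (p L t : ℕ) (hL : 1 ≤ L) (ht : 1 ≤ t) : ψ (D.W p L * D.et ^ t) = 0 := by
  have := D.hk
  by_cases h : 2 ≤ t
  · rw [D.W_etp hL h, map_zero]
  · rw [show t = 1 by omega, pow_one, D.W_et' _ _ hL]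
    split_ifs
    · exact H.W0 _ _ (by omega) (by omega)
    · simp

lemma psiEW (p L t : ℕ) (hL : 1 ≤ L) (ht : 1 ≤ t) : ψ (D.et ^ t * D.W p L) = 0 := by
  have := D.hk
  by_cases h : 2 ≤ t
  · rw [D.etp_W hL h, map_zero]
  · rw [show t = 1 by omega, pow_one, D.et_W' _ _ hL]
    split_ifs
    · exact H.W0 _ _ (by omega) (by omega)
    · simp

lemma psiW_e1 (p L : ℕ) (hL : 1 ≤ L) : ψ (D.W p L * D.e1) = if L = 3 * k ∧ p % 3 ≠ 2 then 1 else 0 := by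
  rw [D.W_e1]
  split_ifs
  · omega
  · simp
  · rw [psiW H _ _ hL, if_pos (by omega)]
  · rw [psiW H _ _ hL, if_neg (by omega)]
lemma psie1_W (p L : ℕ) (hL : 1 ≤ L) : ψ (D.e1 * D.W p L) = if L = 3 * k ∧ p % 3 ≠ 2 then 1 else 0 := by
  rw [D.e1_W]
  split_ifs
  · omega
  · simp
  · rw [psiW H _ _ hL, if_pos (by omega)]
  · rw [psiW H _ _ hL, if_neg (by omega)]
lemma psiW_e2 (p L : ℕ) (hL : 1 ≤ L) : ψ (D.W p L * D.e2) = if L = 3 * k ∧ p % 3 = 2 then 1 else 0 := by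
  rw [D.W_e2]
  split_ifs
  · rw [psiW H _ _ hL, if_pos (by omega)]
  · rw [psiW H _ _ hL, if_neg (by omega)]
  · omega
  · simp
lemma psie2_W (p L : ℕ) (hL : 1 ≤ L) : ψ (D.e2 * D.W p L) = if L = 3 * k ∧ p % 3 = 2 then 1 else 0 := by
  rw [D.e2_W]
  split_ifs
  · rw [psiW H _ _ hL, if_pos (by omega)]
  · rw [psiW H _ _ hL, if_neg (by omega)]
  · omega
  · simp

lemma symm (x y : A) : ψ (x * y) = ψ (y * x) := by
  revert y
  refine D.ind (P := fun x => ∀ y, ψ (x * y) = ψ (y * x)) ?_ ?_ ?_ ?_ ?_ ?_ x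
  · intro x x' h h' y; rw [add_mul, mul_add, map_add, map_add, h, h']
  · intro r x h y; rw [smul_mul_assoc, mul_smul_comm, map_smul, map_smul, h]
  all_goals
    intros
    rename_i y
    refine D.ind (P := fun y => ψ (_ * y) = ψ (y * _)) ?_ ?_ ?_ ?_ ?_ ?_ y
  any_goals
    intro x x' h h'; rw [add_mul, mul_add, map_add, map_add, h, h']
  any_goals
    intro r x h; rw [smul_mul_assoc, mul_smul_comm, map_smul, map_smul, h]
  · rfl
  · rw [D.orth12, D.orth21]
  · intro t ht _; rw [D.e1_etp ht, D.etp_e1 ht]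
  · intro p L _ hL _; rw [psiW_e1 H _ _ hL, psie1_W H _ _ hL]
  · rw [D.orth12, D.orth21]
  · rfl
  · intro t ht _; rw [D.e2_etp ht, D.etp_e2 ht]
  · intro p L _ hL _; rw [psiW_e2 H _ _ hL, psie2_W H _ _ hL]
  · rename_i ht _; rw [D.e1_etp ht, D.etp_e1 ht]
  · rename_i ht _; rw [D.e2_etp ht, D.etp_e2 ht]
  · intro t ht _; rw [← pow_add, ← pow_add, add_comm]
  · rename_i ht _; intro p L _ hL _; rw [psiWE H _ _ _ hL ht, psiEW H _ _ _ hL ht]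
  · rename_i hL _; rw [psiW_e1 H _ _ hL, psie1_W H _ _ hL]
  · rename_i hL _; rw [psiW_e2 H _ _ hL, psie2_W H _ _ hL]
  · rename_i hL _; intro t ht _; rw [psiWE H _ _ _ hL ht, psiEW H _ _ _ hL ht]
  · rename_i p L _ hL _; intro q M _ hM _
    rw [psiWW H _ _ _ _ hL hM, psiWW H _ _ _ _ hM hL]
    split_ifs <;> first | rfl | omega

omit H in
lemma coef_zero {ι : Type} [Fintype ι] (f : ι → K) (v : ι → A) (w : A) (j : ι)
    (h : ∀ i, i ≠ j → f i = 0 ∨ ψ (v i * w) = 0) (hj : ψ (v j * w) ≠ 0)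
    (hr : ψ ((∑ i, f i • v i) * w) = 0) : f j = 0 := by
  rw [Finset.sum_mul, map_sum, Finset.sum_eq_single j] at hr
  · rw [smul_mul_assoc, map_smul, smul_eq_mul] at hr
    exact (mul_eq_zero.1 hr).resolve_right hj
  · intro i _ hi
    rw [smul_mul_assoc, map_smul, smul_eq_mul]
    rcases h i hi with h | h <;> simp [h]
  · simp

lemma nondeg (r : A) (hr : ∀ x, ψ (r * x) = 0) : r = 0 := by
  classical
  have hk := D.hk
  have hs := D.hs
  have hm : r ∈ Submodule.span K (Set.range D.v) := by rw [D.span_top]; trivial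
  obtain ⟨f, rfl⟩ := (Submodule.mem_span_range_iff_exists_fun K).1 hm
  have h3k : ∀ L : Fin (3 * k - 1), (L : ℕ) + 1 < 3 * k := fun L => by omega
  -- idempotents
  have e1 : f (.inl (.inl 0)) = 0 := by
    refine coef_zero (ψ := ψ) f D.v (D.W 0 (3 * k)) _ ?_ ?_ (hr _)
    · rintro ((i | i) | (t | pl)) hi
      · right
        have : i ≠ 0 := fun h => hi (by rw [h])
        simp only [v, if_neg this]
        rw [psie2_W H _ _ (by omega), if_neg (by omega)]
      · right; simp only [v]
        split_ifs
        · rw [psiWW H _ _ _ _ (by omega) (by omega), if_pos (by omega), if_neg (by omega)]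
        · rw [psiWW H _ _ _ _ (by omega) (by omega), if_neg (by omega), if_neg (by omega)]
      · right; simp only [v]; rw [psiEW H _ _ _ (by omega) (by omega)]
      · right; simp only [v]; rw [psiWW H _ _ _ _ (by omega) (by omega)]
        split_ifs <;> first | rfl | omega
    · simp only [v]; rw [if_pos trivial, psie1_W H _ _ (by omega), if_pos (by omega)]; simp
  have e2 : f (.inl (.inl 1)) = 0 := by
    refine coef_zero (ψ := ψ) f D.v (D.W 2 (3 * k)) _ ?_ ?_ (hr _)
    · rintro ((i | i) | (t | pl)) hi
      · right
        have : i = 0 := by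
          have : i ≠ 1 := fun h => hi (by rw [h])
          omega
        simp only [v, if_pos this]
        rw [psie1_W H _ _ (by omega), if_neg (by omega)]
      · right; simp only [v]
        split_ifs
        · rw [psiWW H _ _ _ _ (by omega) (by omega), if_neg (by omega), if_neg (by omega)]
        · rw [psiWW H _ _ _ _ (by omega) (by omega), if_pos (by omega), if_neg (by omega)]
      · right; simp only [v]; rw [psiEW H _ _ _ (by omega) (by omega)]
      · right; simp only [v]; rw [psiWW H _ _ _ _ (by omega) (by omega)]
        split_ifs <;> first | rfl | omega
    · simp only [v]; rw [if_neg (by simp), psie2_W H _ _ (by omega), if_pos (by omega)]; simp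
  have e12 : ∀ i, f (.inl (.inl i)) = 0 := by
    intro i; fin_cases i
    · exact e1
    · exact e2
  have et : ∀ t, f (.inr (.inl t)) = 0 := by
    intro t
    refine coef_zero (ψ := ψ) f D.v (D.et ^ (s - (t + 1))) _ ?_ ?_ (hr _)
    · rintro ((i | i) | (t' | pl)) hi
      · left; exact e12 i
      · right; simp only [v]
        split_ifs
        · rw [psiWE H _ _ _ (by omega) (by omega)]
        · rw [psiWE H _ _ _ (by omega) (by omega)]
      · right; simp only [v]; rw [← pow_add, psiE H _ (by omega), if_neg]
        intro h
        apply hi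
        have : t' = t := by ext; omega
        rw [this]
      · right; simp only [v]; rw [psiWE H _ _ _ (by omega) (by omega)]
    · simp only [v]; rw [← pow_add, psiE H _ (by omega), if_pos (by omega)]; simp
  have wgen : ∀ pl : Fin 3 × Fin (3 * k - 1), (pl.2 : ℕ) + 1 ≠ 3 * k - 1 ∨
      f (.inr (.inr (0, ⟨0, by omega⟩))) = 0 → f (.inr (.inr pl)) = 0 := by
    intro pl hpl
    refine coef_zero (ψ := ψ) f D.v (D.W (pl.1 + (pl.2 + 1)) (3 * k - (pl.2 + 1))) _ ?_ ?_ (hr _)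
    · rintro ((i | i) | (t' | pl')) hi
      · left; exact e12 i
      · right; simp only [v]
        split_ifs
        · rw [psiWW H _ _ _ _ (by omega) (by omega)]
          split_ifs <;> first | rfl | omega
        · rw [psiWW H _ _ _ _ (by omega) (by omega)]
          split_ifs <;> first | rfl | omega
      · left; exact et t'
      · by_cases h0 : pl' = (0, ⟨0, by omega⟩) ∧ (pl.2 : ℕ) + 1 = 3 * k - 1
        · left
          rcases hpl with h | h
          · omega
          · rw [h0.1, h]
        right; simp only [v]; rw [psiWW H _ _ _ _ (by omega) (by omega)]
        split_ifs with h1 h2 h3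
        · exfalso
          apply hi
          have : pl' = pl := by
            ext <;> omega
          rw [this]
        · rfl
        · exfalso
          apply h0
          refine ⟨?_, by omega⟩
          ext
          · simp; omega
          · simp; omega
        · rfl
    · simp only [v]; rw [D.W_mul (by omega), psiW H _ _ (by omega), if_pos (by omega)]; simp
  have w0 := wgen (0, ⟨0, by omega⟩) (by left; simp; omega)
  have w : ∀ pl, f (.inr (.inr pl)) = 0 := fun pl => wgen pl (Or.inr w0)
  have z1 : f (.inl (.inr 0)) = 0 := by
    refine coef_zero (ψ := ψ) f D.v D.e1 _ ?_ ?_ (hr _)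
    · rintro ((i | i) | (t | pl)) hi
      · left; exact e12 i
      · right
        have : i ≠ 0 := fun h => hi (by rw [h])
        simp only [v, if_neg this]
        rw [psiW_e1 H _ _ (by omega), if_neg (by omega)]
      · left; exact et t
      · left; exact w pl
    · simp only [v]; rw [if_pos trivial, psiW_e1 H _ _ (by omega), if_pos (by omega)]; simp
  have z2 : f (.inl (.inr 1)) = 0 := by
    refine coef_zero (ψ := ψ) f D.v D.e2 _ ?_ ?_ (hr _)
    · rintro ((i | i) | (t | pl)) hi
      · left; exact e12 i
      · left
        have : i = 0 := by
          have : i ≠ 1 := fun h => hi (by rw [h])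
          omega
        rw [this, z1]
      · left; exact et t
      · left; exact w pl
    · simp only [v]; rw [if_neg (by simp), psiW_e2 H _ _ (by omega), if_pos (by omega)]; simp
  apply Finset.sum_eq_zero
  rintro ((i | i) | (t | pl)) _
  · rw [e12, zero_smul]
  · have z12 : ∀ i, f (.inl (.inr i)) = 0 := by
      intro i; fin_cases i
      · exact z1
      · exact z2
    rw [z12, zero_smul]
  · rw [et, zero_smul]
  · rw [w, zero_smul]
omit H
/-- the commutator space -/
def cm (K A : Type) [Field K] [Ring A] [Algebra K A] : Submodule K A :=
  Submodule.span K {z : A | ∃ u v : A, z = u * v - v * u}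

lemma mem_cm (u v : A) : u * v - v * u ∈ cm K A := Submodule.subset_span ⟨u, v, rfl⟩

variable (D) in
lemma W_cm {p L : ℕ} (h3 : 3 ≤ L) (h : L % 3 ≠ 0) : D.W p L ∈ cm K A := by
  have h1 : D.W p 1 * D.W (p + 1) (L - 1) = D.W p L := by
    rw [W_add]; congr 1; omega
  have h2 : D.W (p + 1) (L - 1) * D.W p 1 = 0 :=
    D.W_mul0 (by omega) (by omega) (by omega) (by omega)
  have := mem_cm (K := K) (D.W p 1) (D.W (p + 1) (L - 1))
  rwa [h1, h2, sub_zero] at this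

variable (D) in
lemma W_rot1 {p n : ℕ} (hn : 1 ≤ n) : D.W p (3 * n) - D.W (p + 1) (3 * n) ∈ cm K A := by
  have h1 : D.W p 1 * D.W (p + 1) (3 * n - 1) = D.W p (3 * n) := by
    rw [W_add]; congr 1; omega
  have h2 : D.W (p + 1) (3 * n - 1) * D.W p 1 = D.W (p + 1) (3 * n) := by
    rw [D.W_mul (by omega)]; congr 1; omega
  have := mem_cm (K := K) (D.W p 1) (D.W (p + 1) (3 * n - 1))
  rwa [h1, h2] at this

variable (D) in
lemma W_rot {p n : ℕ} (hn : 1 ≤ n) : D.W p (3 * n) - D.W 0 (3 * n) ∈ cm K A := by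
  induction p with
  | zero => simp
  | succ p ih =>
    have := Submodule.sub_mem _ ih (D.W_rot1 (p := p) hn)
    simpa using this

/-- central elements -/
def Cen (z : A) : Prop := ∀ x : A, z * x = x * z

variable (D) in
lemma cen_of (z : A) (h1 : z * D.e1 = D.e1 * z) (hW : ∀ p < 3, z * D.W p 1 = D.W p 1 * z)
    (het : z * D.et = D.et * z) : Cen z := by
  intro x
  have hx : x ∈ Algebra.adjoin K ({D.e1, D.e2, D.al, D.be, D.ga, D.et} : Set A) := by
    rw [D.adj]; trivial
  induction hx using Algebra.adjoin_induction with
  | mem x hx =>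
    simp only [Set.mem_insert_iff, Set.mem_singleton_iff] at hx
    have h0 := hW 0 (by omega)
    have hh1 := hW 1 (by omega)
    have hh2 := hW 2 (by omega)
    rw [W_one] at h0 hh1 hh2
    rcases hx with rfl | rfl | rfl | rfl | rfl | rfl
    · exact h1
    · have : D.e2 = 1 - D.e1 := by rw [← D.sum_idem]; abel
      rw [this, mul_sub, sub_mul, h1]; simp
    · exact h0
    · exact hh1
    · exact hh2
    · exact het
  | algebraMap r => exact (Algebra.commutes r z).symm
  | add x y _ _ hx hy => rw [mul_add, add_mul, hx, hy]
  | mul x y _ _ hx hy => rw [← mul_assoc, hx, mul_assoc, hy, mul_assoc]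

variable (D) in
def Y (n : ℕ) : A := D.W 0 (3 * n) + D.W 1 (3 * n) + D.W 2 (3 * n)
variable (D) in
def N (j : ℕ) : A := D.et ^ j + if j = 1 then D.W 0 (3 * k - 2) else 0

variable (D) in
lemma Y_cen {n : ℕ} (hn : 1 ≤ n) : Cen (D.Y n) := by
  have hk := D.hk
  apply D.cen_of
  · simp only [Y, add_mul, mul_add, W_e1, e1_W]
    rw [if_neg (by omega), if_neg (by omega), if_pos (by omega)]
    simp
  · intro q hq
    simp only [Y, add_mul, mul_add]
    obtain rfl | rfl | rfl : q = 0 ∨ q = 1 ∨ q = 2 := by omega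
    · rw [D.W_mul (p := 0) (L := 3 * n) (by omega), D.W_mul0 (p := 1) (L := 3 * n) (by omega) (by omega) (by omega) (by omega),
        D.W_mul0 (p := 2) (L := 3 * n) (by omega) (by omega) (by omega) (by omega),
        D.W_mul0 (q := 0) (M := 3 * n) (by omega) (by omega) (by omega) (by omega),
        D.W_mul (q := 1) (M := 3 * n) (by omega),
        D.W_mul0 (q := 2) (M := 3 * n) (by omega) (by omega) (by omega) (by omega)]
      simp [add_comm]
    · rw [D.W_mul (p := 1) (L := 3 * n) (by omega), D.W_mul0 (p := 0) (L := 3 * n) (by omega) (by omega) (by omega) (by omega),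
        D.W_mul0 (p := 2) (L := 3 * n) (by omega) (by omega) (by omega) (by omega),
        D.W_mul0 (q := 0) (M := 3 * n) (by omega) (by omega) (by omega) (by omega),
        D.W_mul (q := 2) (M := 3 * n) (by omega),
        D.W_mul0 (q := 1) (M := 3 * n) (by omega) (by omega) (by omega) (by omega)]
      simp [add_comm]
    · rw [D.W_mul (p := 2) (L := 3 * n) (by omega), D.W_mul0 (p := 1) (L := 3 * n) (by omega) (by omega) (by omega) (by omega),
        D.W_mul0 (p := 0) (L := 3 * n) (by omega) (by omega) (by omega) (by omega),
        D.W_mul0 (q := 1) (M := 3 * n) (by omega) (by omega) (by omega) (by omega),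
        D.W_mul (q := 0) (M := 3 * n) (by omega),
        D.W_mul0 (q := 2) (M := 3 * n) (by omega) (by omega) (by omega) (by omega)]
      simp [add_comm]
  · simp only [Y, add_mul, mul_add]
    rw [D.W_et (by omega), D.W_et (by omega), D.W_et (by omega), D.et_W (by omega), D.et_W (by omega), D.et_W (by omega)]

variable (D) in
lemma N_cen {j : ℕ} (hj : 1 ≤ j) : Cen (D.N j) := by
  have hk := D.hk
  apply D.cen_of
  · simp only [N, add_mul, mul_add]
    rw [D.etp_e1 hj, D.e1_etp hj]
    split_ifs
    · rw [D.W_e1, D.e1_W, if_neg (by omega), if_neg (by omega)]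
    · simp
  · intro q hq
    by_cases h : j = 1
    · subst h
      simp only [N, add_mul, mul_add, if_true, pow_one]
      rw [D.et_W' _ _ le_rfl, D.W_et' _ _ le_rfl]
      obtain rfl | rfl | rfl : q = 0 ∨ q = 1 ∨ q = 2 := by omega
      · rw [D.W_mul0 (by omega) (by omega) (by omega) (by omega),
          D.W_mul0 (by omega) (by omega) (by omega) (by omega)]; simp
      · rw [D.W_mul (by omega),
          D.W_mul0 (by omega) (by omega) (by omega) (by omega)]
        rw [show 3 * k - 2 + 1 = 3 * k - 1 by omega]; simp
      · rw [D.W_mul0 (by omega) (by omega) (by omega) (by omega), D.W_mul (by omega)]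
        rw [show 1 + (3 * k - 2) = 3 * k - 1 by omega]; simp
    · simp only [N, if_neg h, add_zero]
      rw [D.etp_W le_rfl (by omega), D.W_etp le_rfl (by omega)]
  · simp only [N, add_mul, mul_add]
    rw [← pow_succ, ← pow_succ']
    split_ifs
    · rw [D.W_et (by omega), D.et_W (by omega)]
    · simp

variable (D) in
lemma z1_cen : Cen (D.W 0 (3 * k)) := by
  have hk := D.hk
  apply D.cen_of
  · rw [D.W_e1, D.e1_W, if_neg (by omega), if_neg (by omega)]
  · intro q hq
    obtain rfl | rfl | rfl : q = 0 ∨ q = 1 ∨ q = 2 := by omega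
    · rw [D.W_mul (by omega), D.W_big (by omega), D.W_mul0 (by omega) (by omega) (by omega) (by omega)]
    · rw [D.W_mul0 (by omega) (by omega) (by omega) (by omega), D.W_mul0 (by omega) (by omega) (by omega) (by omega)]
    · rw [D.W_mul0 (by omega) (by omega) (by omega) (by omega), D.W_mul (by omega), D.W_big (by omega)]
  · rw [D.W_et (by omega), D.et_W (by omega)]

variable (D) in
lemma z2_cen : Cen (D.W 2 (3 * k)) := by
  have hk := D.hk
  apply D.cen_of
  · rw [D.W_e1, D.e1_W, if_pos (by omega), if_pos (by omega)]
  · intro q hq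
    obtain rfl | rfl | rfl : q = 0 ∨ q = 1 ∨ q = 2 := by omega
    · rw [D.W_mul0 (by omega) (by omega) (by omega) (by omega), D.W_mul0 (by omega) (by omega) (by omega) (by omega)]
    · rw [D.W_mul0 (by omega) (by omega) (by omega) (by omega), D.W_mul (by omega), D.W_big (by omega)]
    · rw [D.W_mul (by omega), D.W_big (by omega), D.W_mul0 (by omega) (by omega) (by omega) (by omega)]
  · rw [D.W_et (by omega), D.et_W (by omega)]

include H in
lemma kill {z : A} (hz : Cen z) {x : A} (hx : x ∈ cm K A) : ψ (z * x) = 0 := by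
  induction hx using Submodule.span_induction with
  | mem x hx =>
    obtain ⟨u, w, rfl⟩ := hx
    rw [mul_sub, map_sub, ← mul_assoc, hz u, mul_assoc, symm H, mul_assoc, hz (w * u), ← hz (w * u), sub_self]
  | zero => simp
  | add x y _ _ hx hy => rw [mul_add, map_add, hx, hy, add_zero]
  | smul r x _ hx => rw [mul_smul_comm, map_smul, hx, smul_zero]

variable (D) in
/-- the square map modulo commutators -/
def RHS (ψ : A →ₗ[K] K) (x : A) : A :=
  ψ (D.W 0 (3 * k) * x) ^ 2 • D.e1 + ψ (D.W 2 (3 * k) * x) ^ 2 • D.e2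
  + ∑ m ∈ Finset.Icc 1 (k / 2), ψ (D.Y (k - m) * x) ^ 2 • D.W 0 (3 * (2 * m))
  + ∑ t ∈ Finset.Icc 1 (s / 2), ψ (D.et ^ (s - t) * x) ^ 2 • D.et ^ (2 * t)
  + (c * ψ (D.W 1 (3 * k - 1) * x) ^ 2) • D.W 0 (3 * k)

include H in
lemma psiYe1 {n : ℕ} (hn : 1 ≤ n) (hk : n < k) : ψ (D.Y n * D.e1) = 0 := by
  simp only [Y, add_mul, map_add]
  rw [psiW_e1 H _ _ (by omega), psiW_e1 H _ _ (by omega), psiW_e1 H _ _ (by omega),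
    if_neg (by omega), if_neg (by omega), if_neg (by omega)]; simp
include H in
lemma psiYe2 {n : ℕ} (hn : 1 ≤ n) (hk : n < k) : ψ (D.Y n * D.e2) = 0 := by
  simp only [Y, add_mul, map_add]
  rw [psiW_e2 H _ _ (by omega), psiW_e2 H _ _ (by omega), psiW_e2 H _ _ (by omega),
    if_neg (by omega), if_neg (by omega), if_neg (by omega)]; simp
include H in
lemma psiYE {n t : ℕ} (hn : 1 ≤ n) (ht : 1 ≤ t) : ψ (D.Y n * D.et ^ t) = 0 := by
  simp only [Y, add_mul, map_add]
  rw [psiWE H _ _ _ (by omega) ht, psiWE H _ _ _ (by omega) ht, psiWE H _ _ _ (by omega) ht]; simp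
include H in
lemma psiYW {n p L : ℕ} (hn : 1 ≤ n) (hL : 1 ≤ L) (hp : p < 3) :
    ψ (D.Y n * D.W p L) = if 3 * n + L = 3 * k then 1 else 0 := by
  simp only [Y, add_mul, map_add]
  rw [psiWW H _ _ _ _ (by omega) hL, psiWW H _ _ _ _ (by omega) hL, psiWW H _ _ _ _ (by omega) hL]
  rw [if_neg (c := 0 % 3 = 0 ∧ _) (by omega), if_neg (c := 1 % 3 = 0 ∧ _) (by omega), if_neg (c := 2 % 3 = 0 ∧ _) (by omega)]
  obtain rfl | rfl | rfl : p = 0 ∨ p = 1 ∨ p = 2 := by omega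
  · rw [if_pos (c := 0 % 3 = (0 + 3 * n) % 3) (by omega), if_neg (c := 0 % 3 = (1 + 3 * n) % 3) (by omega), if_neg (c := 0 % 3 = (2 + 3 * n) % 3) (by omega)]; simp
  · rw [if_neg (c := 1 % 3 = (0 + 3 * n) % 3) (by omega), if_pos (c := 1 % 3 = (1 + 3 * n) % 3) (by omega), if_neg (c := 1 % 3 = (2 + 3 * n) % 3) (by omega)]; simp
  · rw [if_neg (c := 2 % 3 = (0 + 3 * n) % 3) (by omega), if_neg (c := 2 % 3 = (1 + 3 * n) % 3) (by omega), if_pos (c := 2 % 3 = (2 + 3 * n) % 3) (by omega)]; simp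
include H in
lemma psiUW {p L : ℕ} (hL : 1 ≤ L) :
    ψ (D.W 1 (3 * k - 1) * D.W p L) = if p % 3 = 0 ∧ L = 1 then 1 else 0 := by
  have := D.hk
  rw [psiWW H _ _ _ _ (by omega) hL]
  split_ifs <;> first | rfl | omega

lemma char2_add [CharP K 2] (z : A) : z + z = 0 := by
  rw [← two_smul K z, CharTwo.two_eq_zero, zero_smul]

include H in
lemma square [CharP K 2] (x : A) : x * x - D.RHS ψ x ∈ cm K A := by
  have hk := D.hk
  have hs := D.hs
  refine D.ind (P := fun x => x * x - D.RHS ψ x ∈ cm K A) ?_ ?_ ?_ ?_ ?_ ?_ x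
  · intro x y hx hy
    have h1 : D.RHS ψ (x + y) = D.RHS ψ x + D.RHS ψ y := by
      simp only [RHS, mul_add, map_add, CharTwo.add_sq, add_smul, Finset.sum_add_distrib]
      abel
    have h2 : (x + y) * (x + y) - D.RHS ψ (x + y) =
        (x * x - D.RHS ψ x) + (y * y - D.RHS ψ y) + (x * y - y * x) := by
      rw [h1]
      have h3 := char2_add (K := K) (y * x)
      have h4 : y * x = - (y * x) := eq_neg_of_add_eq_zero_left h3
      rw [sub_eq_add_neg (x * y), ← h4, add_mul, mul_add, mul_add]
      abel
    rw [h2]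
    exact Submodule.add_mem _ (Submodule.add_mem _ hx hy) (mem_cm _ _)
  · intro r x hx
    have h1 : D.RHS ψ (r • x) = (r ^ 2) • D.RHS ψ x := by
      simp only [RHS, mul_smul_comm, map_smul, smul_eq_mul, mul_pow, smul_add, Finset.smul_sum, smul_smul]
      congr 2
      ring
    rw [h1, smul_mul_smul_comm, ← pow_two, ← smul_sub]
    exact Submodule.smul_mem _ _ hx
  · have : D.RHS ψ D.e1 = D.e1 := by
      simp only [RHS]
      rw [psiW_e1 H _ _ (by omega), psiW_e1 H _ _ (by omega), psiW_e1 H _ _ (by omega),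
        if_pos (by omega), if_neg (by omega), if_neg (by omega), Finset.sum_eq_zero, Finset.sum_eq_zero]
      · simp
      · intro t ht; rw [Finset.mem_Icc] at ht
        rw [D.etp_e1 (by omega)]; simp
      · intro t ht; rw [Finset.mem_Icc] at ht
        rw [psiYe1 H (by omega) (by omega)]; simp
    rw [this, D.idem1, sub_self]; exact Submodule.zero_mem _
  · have : D.RHS ψ D.e2 = D.e2 := by
      simp only [RHS]
      rw [psiW_e2 H _ _ (by omega), psiW_e2 H _ _ (by omega), psiW_e2 H _ _ (by omega),
        if_neg (by omega), if_pos (by omega), if_neg (by omega), Finset.sum_eq_zero, Finset.sum_eq_zero]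
      · simp
      · intro t ht; rw [Finset.mem_Icc] at ht
        rw [D.etp_e2 (by omega), psiE H _ (by omega), if_neg (by omega)]; simp
      · intro t ht; rw [Finset.mem_Icc] at ht
        rw [psiYe2 H (by omega) (by omega)]; simp
    rw [this, D.idem2, sub_self]; exact Submodule.zero_mem _
  · intro t ht hts
    have : D.RHS ψ (D.et ^ t) = D.et ^ (2 * t) := by
      simp only [RHS]
      rw [psiWE H _ _ _ (by omega) ht, psiWE H _ _ _ (by omega) ht, psiWE H _ _ _ (by omega) ht,
        Finset.sum_eq_zero]
      · have h1 : ∀ t' ∈ Finset.Icc 1 (s / 2), ψ (D.et ^ (s - t') * D.et ^ t) ^ 2 • D.et ^ (2 * t')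
          = if t = t' then D.et ^ (2 * t') else 0 := by
          intro t' ht'
          rw [Finset.mem_Icc] at ht'
          rw [← pow_add, psiE H _ (by omega)]
          by_cases h : t = t'
          · rw [if_pos h, if_pos (by omega)]; simp
          · rw [if_neg h, if_neg (by omega)]; simp
        rw [Finset.sum_congr rfl h1, Finset.sum_ite_eq]
        split_ifs with h
        · simp
        · rw [Finset.mem_Icc] at h
          rw [D.etp_big (t := 2 * t) (by omega)]; simp
      · intro m hm; rw [Finset.mem_Icc] at hm
        rw [psiYE H (by omega) ht]; simp
    rw [this, ← pow_add, two_mul, sub_self]; exact Submodule.zero_mem _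
  · intro p L hp hL hLk
    have hR : D.RHS ψ (D.W p L) = (∑ m ∈ Finset.Icc 1 (k / 2), if L = 3 * m then D.W 0 (3 * (2 * m)) else 0)
      + if p % 3 = 0 ∧ L = 1 then c • D.W 0 (3 * k) else 0 := by
      simp only [RHS]
      rw [psiWW H _ _ _ _ (by omega) hL, psiWW H _ _ _ _ (by omega) hL, psiUW H hL]
      simp only [show ¬ (3 * k + L = 3 * k) by omega, show ¬ (3 * k = 1) by omega, false_and, and_false, if_false, ite_self]
      rw [Finset.sum_eq_zero (s := Finset.Icc 1 (s / 2))]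
      · have h1 : ∀ m ∈ Finset.Icc 1 (k / 2), ψ (D.Y (k - m) * D.W p L) ^ 2 • D.W 0 (3 * (2 * m)) =
            if L = 3 * m then D.W 0 (3 * (2 * m)) else 0 := by
          intro m hm
          rw [Finset.mem_Icc] at hm
          rw [psiYW H (by omega) hL hp]
          by_cases h : L = 3 * m
          · rw [if_pos h, if_pos (by omega)]; simp
          · rw [if_neg h, if_neg (by omega)]; simp
        rw [Finset.sum_congr rfl h1]
        split_ifs <;> simp
      · intro t ht; rw [Finset.mem_Icc] at ht
        rw [psiEW H _ _ _ hL (by omega)]; simp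
    rw [hR]
    by_cases h3 : L % 3 = 0
    · obtain ⟨n, rfl⟩ : ∃ n, L = 3 * n := ⟨L / 3, by omega⟩
      rw [if_neg (by omega), D.W_mul (by omega)]
      have h2 : ∀ m ∈ Finset.Icc 1 (k / 2), (if 3 * n = 3 * m then D.W 0 (3 * (2 * m)) else 0) =
          if n = m then D.W 0 (3 * (2 * m)) else 0 := by
        intro m _
        by_cases h : n = m
        · rw [if_pos h, if_pos (by omega)]
        · rw [if_neg h, if_neg (by omega)]
      rw [Finset.sum_congr rfl h2, Finset.sum_ite_eq, show 3 * n + 3 * n = 3 * (2 * n) by ring]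
      split_ifs with h
      · rw [add_zero]; exact D.W_rot (by omega)
      · rw [Finset.mem_Icc] at h
        rw [D.W_big (by omega)]; simp
    · rw [Finset.sum_eq_zero, zero_add]
      · by_cases hp0 : p % 3 = 0 ∧ L = 1
        · obtain ⟨h0, rfl⟩ := hp0
          rw [if_pos ⟨h0, rfl⟩, D.W11 _ _ (by omega), if_pos ⟨h0, h0⟩, D.z1_eq, add_sub_cancel_right]
          exact Submodule.smul_mem _ _ (D.W_cm (by omega) (by omega))
        · rw [if_neg hp0, sub_zero]
          by_cases hL1 : L = 1
          · subst hL1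
            rw [D.W11 _ _ (by omega), if_neg (by omega), if_neg (by omega)]
            exact Submodule.zero_mem _
          · rw [D.W_mul0 (by omega) hL hL (by omega)]
            exact Submodule.zero_mem _
      · intro m _
        rw [if_neg (by omega)]
include H in
lemma apR (z x : A) : ψ (z * D.RHS ψ x) =
  ψ (D.W 0 (3 * k) * x) ^ 2 * ψ (z * D.e1) + ψ (D.W 2 (3 * k) * x) ^ 2 * ψ (z * D.e2)
  + ∑ m ∈ Finset.Icc 1 (k / 2), ψ (D.Y (k - m) * x) ^ 2 * ψ (z * D.W 0 (3 * (2 * m)))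
  + ∑ t ∈ Finset.Icc 1 (s / 2), ψ (D.et ^ (s - t) * x) ^ 2 * ψ (z * D.et ^ (2 * t))
  + (c * ψ (D.W 1 (3 * k - 1) * x) ^ 2) * ψ (z * D.W 0 (3 * k)) := by
  simp only [RHS, mul_add, map_add, Finset.mul_sum, map_sum, mul_smul_comm, map_smul, smul_eq_mul]

variable (D) in
def X : A := D.Y (k / 2) + if s % 2 = 0 then D.et ^ (s / 2) else 0

include H in
lemma psiX [CharP K 2] (x : A) : ψ (D.X * x) ^ 2 = ψ (D.Y (k / 2) * x) ^ 2 +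
    if s % 2 = 0 then ψ (D.et ^ (s / 2) * x) ^ 2 else 0 := by
  unfold X
  split_ifs
  · rw [add_mul, map_add, CharTwo.add_sq]
  · rw [add_zero, add_zero]

include H in
lemma tchar [CharP K 2] (hke : k % 2 = 0) (x : A) : x * x ∈ cm K A ↔
    ψ (D.W 0 (3 * k) * x) = 0 ∧ ψ (D.W 2 (3 * k) * x) = 0 ∧
    (∀ m, 1 ≤ m → 2 * m < k → ψ (D.Y (k - m) * x) = 0) ∧
    (∀ t, 1 ≤ t → 2 * t < s → ψ (D.et ^ (s - t) * x) = 0) ∧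
    c * ψ (D.W 1 (3 * k - 1) * x) ^ 2 + ψ (D.X * x) ^ 2 = 0 := by
  have hk := D.hk
  have hs := D.hs
  have hsq := square H x
  have hiff : x * x ∈ cm K A ↔ D.RHS ψ x ∈ cm K A := by
    constructor
    · intro h
      have := Submodule.sub_mem _ h hsq
      simpa using this
    · intro h
      have := Submodule.add_mem _ hsq h
      simpa using this
  rw [hiff]
  constructor
  · intro h
    have h1 : ψ (D.W 0 (3 * k) * x) = 0 := by
      have := kill H D.z1_cen h
      rw [apR H, psiW_e1 H _ _ (by omega), psiW_e2 H _ _ (by omega), if_pos (by omega), if_neg (by omega),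
        Finset.sum_eq_zero, Finset.sum_eq_zero, psiWW H _ _ _ _ (by omega) (by omega), if_pos (by omega),
        if_neg (by omega)] at this
      · simpa using this
      · intro t ht; rw [Finset.mem_Icc] at ht
        rw [psiWE H _ _ _ (by omega) (by omega), mul_zero]
      · intro t ht; rw [Finset.mem_Icc] at ht
        rw [psiWW H _ _ _ _ (by omega) (by omega), if_pos (by omega), if_neg (by omega), mul_zero]
    have h2 : ψ (D.W 2 (3 * k) * x) = 0 := by
      have := kill H D.z2_cen h
      rw [apR H, psiW_e1 H _ _ (by omega), psiW_e2 H _ _ (by omega), if_neg (by omega), if_pos (by omega),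
        Finset.sum_eq_zero, Finset.sum_eq_zero, psiWW H _ _ _ _ (by omega) (by omega), if_neg (by omega),
        if_neg (by omega)] at this
      · simpa using this
      · intro t ht; rw [Finset.mem_Icc] at ht
        rw [psiWE H _ _ _ (by omega) (by omega), mul_zero]
      · intro t ht; rw [Finset.mem_Icc] at ht
        rw [psiWW H _ _ _ _ (by omega) (by omega), if_neg (by omega), if_neg (by omega), mul_zero]
    refine ⟨h1, h2, ?_, ?_, ?_⟩
    · intro m hm hmk
      have := kill H (D.Y_cen (n := k - 2 * m) (by omega)) h
      rw [apR H, h1, h2, Finset.sum_eq_single m, Finset.sum_eq_zero,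
        psiYW H (by omega) (by omega) (by omega), psiYW H (by omega) (by omega) (by omega),
        if_pos (by omega), if_neg (by omega)] at this
      · simpa using this
      · intro t ht; rw [Finset.mem_Icc] at ht
        rw [psiYE H (by omega) (by omega), mul_zero]
      · intro m' hm' hne; rw [Finset.mem_Icc] at hm'
        rw [psiYW H (by omega) (by omega) (by omega), if_neg (by omega), mul_zero]
      · intro hn; exfalso; rw [Finset.mem_Icc] at hn; omega
    · intro t ht hts
      have := kill H (D.N_cen (j := s - 2 * t) (by omega)) h
      have hE : ∀ t', 1 ≤ t' → ψ (D.N (s - 2 * t) * D.et ^ (2 * t')) = if t' = t then 1 else 0 := by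
        intro t' ht'
        unfold N
        rw [add_mul, map_add, ← pow_add, psiE H _ (by omega)]
        have h0 : ψ ((if s - 2 * t = 1 then D.W 0 (3 * k - 2) else 0) * D.et ^ (2 * t')) = 0 := by
          split_ifs
          · exact psiWE H _ _ _ (by omega) (by omega)
          · simp
        rw [h0, add_zero]
        by_cases h : t' = t
        · rw [if_pos h, if_pos (by omega)]
        · rw [if_neg h, if_neg (by omega)]
      have hW : ∀ n, 1 ≤ n → ψ (D.N (s - 2 * t) * D.W 0 (3 * n)) = 0 := by
        intro n hn
        unfold N
        rw [add_mul, map_add, psiEW H _ _ _ (by omega) (by omega), zero_add]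
        split_ifs
        · rw [psiWW H _ _ _ _ (by omega) (by omega), if_neg (by omega), if_neg (by omega)]
        · simp
      rw [apR H, h1, h2, Finset.sum_eq_zero, Finset.sum_eq_single t, hE _ ht, hW _ (by omega)] at this
      · simpa using this
      · intro t' ht' hne; rw [Finset.mem_Icc] at ht'
        rw [hE _ ht'.1, if_neg hne, mul_zero]
      · intro hn; exfalso; rw [Finset.mem_Icc] at hn; omega
      · intro m hm; rw [Finset.mem_Icc] at hm
        rw [hW _ (by omega), mul_zero]
    · have := kill H (z := 1) (fun x => by simp) h
      rw [apR H, h1, h2, Finset.sum_eq_single (k / 2)] at this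
      · simp only [one_mul] at this
        rw [psiW H _ _ (by omega), psiW H _ _ (by omega), if_pos (by omega), if_pos rfl,
          show k - k / 2 = k / 2 by omega] at this
        have h3 : ∑ t ∈ Finset.Icc 1 (s / 2), ψ (D.et ^ (s - t) * x) ^ 2 * ψ (D.et ^ (2 * t)) =
            if s % 2 = 0 then ψ (D.et ^ (s / 2) * x) ^ 2 else 0 := by
          rw [Finset.sum_eq_single (s / 2)]
          · rw [psiE H _ (by omega)]
            by_cases h : s % 2 = 0
            · rw [if_pos h, if_pos (by omega), show s - s / 2 = s / 2 by omega, mul_one]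
            · rw [if_neg h, if_neg (by omega), mul_zero]
          · intro t ht hne; rw [Finset.mem_Icc] at ht
            rw [psiE H _ (by omega), if_neg (by omega), mul_zero]
          · intro hn; exfalso; rw [Finset.mem_Icc] at hn; omega
        rw [h3] at this
        rw [psiX H]
        linear_combination this
      · intro m' hm' hne; rw [Finset.mem_Icc] at hm'
        rw [one_mul, psiW H _ _ (by omega), if_neg (by omega), mul_zero]
      · intro hn; exfalso; rw [Finset.mem_Icc] at hn; omega
  · rintro ⟨h1, h2, h3, h4, h5⟩
    have hR : D.RHS ψ x = (if s % 2 = 0 then ψ (D.et ^ (s / 2) * x) ^ 2 else 0) •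
        (D.W 2 (3 * k) - D.W 0 (3 * k)) := by
      unfold RHS
      rw [h1, h2, Finset.sum_eq_single (k / 2), Finset.sum_eq_single (s / 2)]
      · rw [psiX H] at h5
        rw [show k - k / 2 = k / 2 by omega, show 2 * (k / 2) = k by omega]
        have h6 : ψ (D.et ^ (s - s / 2) * x) ^ 2 • D.et ^ (2 * (s / 2)) =
          (if s % 2 = 0 then ψ (D.et ^ (s / 2) * x) ^ 2 else 0) • D.W 2 (3 * k) := by
          by_cases h : s % 2 = 0
          · rw [if_pos h, show s - s / 2 = s / 2 by omega, show 2 * (s / 2) = s by omega, D.z2_eq]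
          · rw [if_neg h, h4 (s / 2) (by omega) (by omega)]; simp
        rw [h6]
        generalize (if s % 2 = 0 then ψ (D.et ^ (s / 2) * x) ^ 2 else 0) = g at *
        have h7 : c * ψ (D.W 1 (3 * k - 1) * x) ^ 2 = - ψ (D.Y (k / 2) * x) ^ 2 - g := by
          linear_combination h5
        rw [h7, smul_sub, sub_smul, neg_smul]
        simp only [ne_eq, OfNat.ofNat_ne_zero, not_false_eq_true, zero_pow, zero_smul, zero_add]
        abel
      · intro t ht hne; rw [Finset.mem_Icc] at ht
        rw [h4 t (by omega) (by omega)]; simp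
      · intro hn; exfalso; rw [Finset.mem_Icc] at hn; omega
      · intro t ht hne; rw [Finset.mem_Icc] at ht
        rw [h3 t (by omega) (by omega)]; simp
      · intro hn; exfalso; rw [Finset.mem_Icc] at hn; omega
    rw [hR]
    exact Submodule.smul_mem _ _ (D.W_rot (by omega))

include H in
lemma dim_perp {ι : Type} [Fintype ι] [DecidableEq ι] (z w : ι → A)
    (hzw : ∀ i j, ψ (z i * w j) = if i = j then 1 else 0) (T : Set A)
    (hT : ∀ x, x ∈ T ↔ ∀ i, ψ (z i * x) = 0) :
    Module.finrank K (⨅ m ∈ T, LinearMap.ker (ψ ∘ₗ LinearMap.mulRight K m) : Submodule K A) =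
      Fintype.card ι := by
  have hP : (⨅ m ∈ T, LinearMap.ker (ψ ∘ₗ LinearMap.mulRight K m) : Submodule K A) =
      Submodule.span K (Set.range z) := by
    apply le_antisymm
    · intro r hr
      simp only [Submodule.mem_iInf, LinearMap.mem_ker, LinearMap.comp_apply, LinearMap.mulRight_apply] at hr
      have h1 := mem_span_of_iInf_ker_le_ker (L := fun i => ψ ∘ₗ LinearMap.mulLeft K (z i))
        (K := ψ ∘ₗ LinearMap.mulLeft K r) (by
          intro x hx
          simp only [Submodule.mem_iInf, LinearMap.mem_ker, LinearMap.comp_apply, LinearMap.mulLeft_apply] at hx ⊢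
          exact hr x ((hT x).2 hx))
      obtain ⟨f, hf⟩ := (Submodule.mem_span_range_iff_exists_fun K).1 h1
      have h2 : (∑ i, f i • z i) - r = 0 := by
        apply nondeg H
        intro x
        have := LinearMap.congr_fun hf x
        simp only [LinearMap.sum_apply, LinearMap.smul_apply, LinearMap.comp_apply, LinearMap.mulLeft_apply] at this
        rw [sub_mul, map_sub, ← this, Finset.sum_mul, map_sum]
        simp
      rw [sub_eq_zero] at h2
      rw [← h2]
      exact Submodule.sum_mem _ fun i _ => Submodule.smul_mem _ _ (Submodule.subset_span ⟨i, rfl⟩)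
    · rw [Submodule.span_le]
      rintro _ ⟨i, rfl⟩
      simp only [SetLike.mem_coe, Submodule.mem_iInf, LinearMap.mem_ker, LinearMap.comp_apply, LinearMap.mulRight_apply]
      intro m hm
      exact (hT m).1 hm i
  rw [hP]
  apply finrank_span_eq_card
  rw [Fintype.linearIndependent_iff]
  intro g hg j
  refine coef_zero (ψ := ψ) g z (w j) j ?_ ?_ (by rw [hg]; simp)
  · intro i hi; right; rw [hzw, if_neg hi]
  · rw [hzw, if_pos rfl]; simp

abbrev Bs (k s : ℕ) : Type := Fin 2 ⊕ (Fin (k / 2 - 1) ⊕ Fin ((s - 1) / 2))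

variable (D) in
def zb : Bs k s → A
  | .inl i => if i = 0 then D.W 0 (3 * k) else D.W 2 (3 * k)
  | .inr (.inl m) => D.Y (k - (m + 1))
  | .inr (.inr t) => D.et ^ (s - (t + 1))
variable (D) in
def wb : Bs k s → A
  | .inl i => if i = 0 then D.e1 else D.e2
  | .inr (.inl m) => D.W 0 (3 * (m + 1))
  | .inr (.inr t) => D.et ^ ((t : ℕ) + 1)

include H in
lemma zwb (i j : Bs k s) : ψ (D.zb i * D.wb j) = if i = j then 1 else 0 := by
  have hk := D.hk
  have hs := D.hs
  rcases i with i | i | i <;> rcases j with j | j | j <;>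
    simp only [zb, wb, reduceCtorEq, if_false, Sum.inl.injEq, Sum.inr.injEq]
  · obtain rfl | rfl : i = 0 ∨ i = 1 := by omega
    all_goals obtain rfl | rfl : j = 0 ∨ j = 1 := by omega
    all_goals simp only [if_true, one_ne_zero, zero_ne_one, if_false, Fin.isValue]
    · rw [psiW_e1 H _ _ (by omega), if_pos (by omega)]
    · rw [psiW_e2 H _ _ (by omega), if_neg (by omega)]
    · rw [psiW_e1 H _ _ (by omega), if_neg (by omega)]
    · rw [psiW_e2 H _ _ (by omega), if_pos (by omega)]
  · split_ifs
    · rw [psiWW H _ _ _ _ (by omega) (by omega)]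
      split_ifs <;> first | rfl | omega
    · rw [psiWW H _ _ _ _ (by omega) (by omega)]
      split_ifs <;> first | rfl | omega
  · split_ifs
    · rw [psiWE H _ _ _ (by omega) (by omega)]
    · rw [psiWE H _ _ _ (by omega) (by omega)]
  · split_ifs
    · rw [psiYe1 H (by omega) (by omega)]
    · rw [psiYe2 H (by omega) (by omega)]
  · rw [psiYW H (by omega) (by omega) (by omega)]
    by_cases h : i = j
    · subst h; rw [if_pos rfl, if_pos (by omega)]
    · rw [if_neg h, if_neg]
      intro h'; apply h; ext; omega
  · rw [psiYE H (by omega) (by omega)]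
  · split_ifs
    · rw [D.etp_e1 (by omega), map_zero]
    · rw [D.etp_e2 (by omega), psiE H _ (by omega), if_neg (by omega)]
  · rw [psiEW H _ _ _ (by omega) (by omega)]
  · rw [← pow_add, psiE H _ (by omega)]
    by_cases h : i = j
    · subst h; rw [if_pos rfl, if_pos (by omega)]
    · rw [if_neg h, if_neg]
      intro h'; apply h; ext; omega

include H in
lemma Xwb (j : Bs k s) : ψ (D.X * D.wb j) = 0 := by
  have hk := D.hk
  have hs := D.hs
  unfold X
  rw [add_mul, map_add]
  rcases j with j | j | j <;> simp only [wb]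
  · by_cases hj : j = 0
    · rw [if_pos hj, psiYe1 H (by omega) (by omega), zero_add]
      split_ifs
      · rw [D.etp_e1 (by omega), map_zero]
      · simp
    · rw [if_neg hj, psiYe2 H (by omega) (by omega), zero_add]
      split_ifs
      · rw [D.etp_e2 (by omega), psiE H _ (by omega), if_neg (by omega)]
      · simp
  · rw [psiYW H (by omega) (by omega) (by omega), if_neg (by omega), zero_add]
    split_ifs
    · rw [psiEW H _ _ _ (by omega) (by omega)]
    · simp
  · rw [psiYE H (by omega) (by omega), zero_add]
    split_ifs
    · rw [← pow_add, psiE H _ (by omega), if_neg (by omega)]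
    · simp

include H in
lemma Uwb (j : Bs k s) : ψ (D.W 1 (3 * k - 1) * D.wb j) = 0 := by
  have hk := D.hk
  have hs := D.hs
  rcases j with j | j | j <;> simp only [wb]
  · by_cases hj : j = 0
    · rw [if_pos hj, psiW_e1 H _ _ (by omega), if_neg (by omega)]
    · rw [if_neg hj, psiW_e2 H _ _ (by omega), if_neg (by omega)]
  · rw [psiUW H (by omega), if_neg (by omega)]
  · rw [psiWE H _ _ _ (by omega) (by omega)]

include H in
lemma zbW (i : Bs k s) (L : ℕ) (hL : 1 ≤ L) (h : ∀ m, 1 ≤ m → 2 * m < k → L ≠ 3 * m) :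
    ψ (D.zb i * D.W 0 L) = 0 := by
  have hk := D.hk
  have hs := D.hs
  rcases i with i | i | i <;> simp only [zb]
  · split_ifs
    · rw [psiWW H _ _ _ _ (by omega) (by omega)]
      split_ifs <;> first | rfl | omega
    · rw [psiWW H _ _ _ _ (by omega) (by omega)]
      split_ifs <;> first | rfl | omega
  · rw [psiYW H (by omega) (by omega) (by omega), if_neg]
    have := h (i + 1) (by omega) (by omega)
    omega
  · rw [psiEW H _ _ _ (by omega) (by omega)]

include H in
lemma XW (hke : k % 2 = 0) (L : ℕ) (hL : 1 ≤ L) :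
    ψ (D.X * D.W 0 L) = if L = 3 * (k / 2) then 1 else 0 := by
  have hk := D.hk
  have hs := D.hs
  unfold X
  rw [add_mul, map_add, psiYW H (by omega) (by omega) (by omega)]
  have : ψ ((if s % 2 = 0 then D.et ^ (s / 2) else 0) * D.W 0 L) = 0 := by
    split_ifs
    · rw [psiEW H _ _ _ (by omega) (by omega)]
    · simp
  rw [this, add_zero]
  by_cases h : L = 3 * (k / 2)
  · rw [if_pos h, if_pos (by omega)]
  · rw [if_neg h, if_neg (by omega)]

omit H in
lemma zb_all (hke : k % 2 = 0) (x : A) : (∀ i, ψ (D.zb i * x) = 0) ↔ 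
    (ψ (D.W 0 (3 * k) * x) = 0 ∧ ψ (D.W 2 (3 * k) * x) = 0 ∧
    (∀ m, 1 ≤ m → 2 * m < k → ψ (D.Y (k - m) * x) = 0) ∧
    (∀ t, 1 ≤ t → 2 * t < s → ψ (D.et ^ (s - t) * x) = 0)) := by
  have hk := D.hk
  have hs := D.hs
  constructor
  · intro h
    refine ⟨by simpa [zb] using h (.inl 0), by simpa [zb] using h (.inl 1), ?_, ?_⟩
    · intro m hm hmk
      have := h (.inr (.inl ⟨m - 1, by omega⟩))
      simp only [zb] at this
      rwa [show m - 1 + 1 = m by omega] at this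
    · intro m hm hmk
      have := h (.inr (.inr ⟨m - 1, by omega⟩))
      simp only [zb] at this
      rwa [show m - 1 + 1 = m by omega] at this
  · rintro ⟨h1, h2, h3, h4⟩ (i | i | i) <;> simp only [zb]
    · split_ifs
      · exact h1
      · exact h2
    · exact h3 _ (by omega) (by omega)
    · exact h4 _ (by omega) (by omega)

include H in
theorem dim_sq [CharP K 2] (hke : k % 2 = 0) (hc : IsSquare c) :
    Module.finrank K (⨅ m ∈ {z : A | z ^ 2 ∈ cm K A}, LinearMap.ker (ψ ∘ₗ LinearMap.mulRight K m) :
      Submodule K A) = Fintype.card (Bs k s) + 1 := by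
  obtain ⟨d, hd⟩ := hc
  have hk := D.hk
  rw [dim_perp H (ι := Bs k s ⊕ Unit) (Sum.elim D.zb fun _ => D.X + d • D.W 1 (3 * k - 1))
    (Sum.elim D.wb fun _ => D.W 0 (3 * (k / 2)))]
  · rw [Fintype.card_sum, Fintype.card_unit]
  · rintro (i | i) (j | j) <;>
      simp only [Sum.elim_inl, Sum.elim_inr, reduceCtorEq, if_false, Sum.inl.injEq, if_true]
    · exact zwb H i j
    · exact zbW H _ _ (by omega) (by intros; omega)
    · rw [add_mul, map_add, Xwb H, smul_mul_assoc, map_smul, Uwb H]; simp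
    · rw [add_mul, map_add, XW H hke _ (by omega), if_pos rfl, smul_mul_assoc, map_smul, psiUW H (by omega), if_neg (by omega)]
      simp
  · intro x
    rw [Set.mem_ofPred_eq, pow_two, tchar H hke]
    have h5 : c * ψ (D.W 1 (3 * k - 1) * x) ^ 2 + ψ (D.X * x) ^ 2 =
        ψ ((D.X + d • D.W 1 (3 * k - 1)) * x) ^ 2 := by
      rw [add_mul, map_add, CharTwo.add_sq, smul_mul_assoc, map_smul, smul_eq_mul]
      linear_combination (ψ (D.W 1 (3 * k - 1) * x)) ^ 2 * hd
    rw [h5]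
    have := zb_all (D := D) (ψ := ψ) hke x
    constructor
    · rintro ⟨h1, h2, h3, h4, h5⟩
      rintro (i | i)
      · exact this.2 ⟨h1, h2, h3, h4⟩ i
      · simpa using h5
    · intro h
      obtain ⟨h1, h2, h3, h4⟩ := this.1 (fun i => h (.inl i))
      refine ⟨h1, h2, h3, h4, ?_⟩
      have := h (.inr ())
      simpa using this

include H in
theorem dim_nsq [CharP K 2] (hke : k % 2 = 0) (hc : ¬ IsSquare c) :
    Module.finrank K (⨅ m ∈ {z : A | z ^ 2 ∈ cm K A}, LinearMap.ker (ψ ∘ₗ LinearMap.mulRight K m) :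
      Submodule K A) = Fintype.card (Bs k s) + 1 + 1 := by
  have hk := D.hk
  rw [dim_perp H (ι := (Bs k s ⊕ Unit) ⊕ Unit)
    (Sum.elim (Sum.elim D.zb fun _ => D.X) fun _ => D.W 1 (3 * k - 1))
    (Sum.elim (Sum.elim D.wb fun _ => D.W 0 (3 * (k / 2))) fun _ => D.W 0 1)]
  · rw [Fintype.card_sum, Fintype.card_sum, Fintype.card_unit]
  · rintro ((i | i) | i) ((j | j) | j) <;>
      simp only [Sum.elim_inl, Sum.elim_inr, reduceCtorEq, if_false, Sum.inl.injEq, if_true]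
    · exact zwb H i j
    · exact zbW H _ _ (by omega) (by intros; omega)
    · exact zbW H _ _ (by omega) (by intros; omega)
    · exact Xwb H j
    · rw [XW H hke _ (by omega), if_pos rfl]
    · rw [XW H hke _ (by omega), if_neg (by omega)]
    · exact Uwb H j
    · rw [psiUW H (by omega), if_neg (by omega)]
    · rw [psiUW H (by omega), if_pos (by omega)]
  · intro x
    rw [Set.mem_ofPred_eq, pow_two, tchar H hke]
    have h5 : c * ψ (D.W 1 (3 * k - 1) * x) ^ 2 + ψ (D.X * x) ^ 2 = 0 ↔
        ψ (D.X * x) = 0 ∧ ψ (D.W 1 (3 * k - 1) * x) = 0 := by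
      constructor
      · intro h
        by_cases h0 : ψ (D.W 1 (3 * k - 1) * x) = 0
        · rw [h0] at h
          refine ⟨by simpa using h, h0⟩
        · exfalso
          apply hc
          refine ⟨ψ (D.X * x) / ψ (D.W 1 (3 * k - 1) * x), ?_⟩
          have h6 : c * ψ (D.W 1 (3 * k - 1) * x) ^ 2 = ψ (D.X * x) ^ 2 := by
            rw [eq_neg_of_add_eq_zero_left h, CharTwo.neg_eq]
          field_simp
          exact h6
      · rintro ⟨h1, h2⟩
        rw [h1, h2]; simp
    rw [h5]
    have := zb_all (D := D) (ψ := ψ) hke x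
    constructor
    · rintro ⟨h1, h2, h3, h4, h5, h6⟩
      rintro ((i | i) | i)
      · exact this.2 ⟨h1, h2, h3, h4⟩ i
      · exact h5
      · exact h6
    · intro h
      obtain ⟨h1, h2, h3, h4⟩ := this.1 (fun i => h (.inl (.inl i)))
      exact ⟨h1, h2, h3, h4, h (.inl (.inr ())), h (.inr ())⟩
end Dat
end QW

namespace QW
open QT

lemma swp {A : Type} [Ring A] (x y : A) (n : ℕ) : (x * y) ^ n * x = x * (y * x) ^ n := by
  induction n with
  | zero => simp
  | succ n ih => rw [pow_succ', mul_assoc, ih, pow_succ']; simp only [mul_assoc]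

noncomputable def dat (K : Type) [Field K] (k s : ℕ) (a c : K) (hk : 2 ≤ k) (hs : 3 ≤ s) :
    Dat K (Aa K k s a c) k s a c where
  e1 := E1 K k s a c
  e2 := E2 K k s a c
  al := Al K k s a c
  be := Be K k s a c
  ga := Ga K k s a c
  et := Et K k s a c
  hk := hk
  hs := hs
  idem1 := by simpa only [E1, E2, Al, Be, Ga, Et, map_mul] using RingQuot.mkAlgHom_rel K (Rel.idem1 (K := K) (k := k) (s := s) (a := a) (c := c))
  idem2 := by simpa only [E1, E2, Al, Be, Ga, Et, map_mul] using RingQuot.mkAlgHom_rel K (Rel.idem2 (K := K) (k := k) (s := s) (a := a) (c := c))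
  orth12 := by simpa only [E1, E2, Al, Be, Ga, Et, map_mul, map_zero] using RingQuot.mkAlgHom_rel K (Rel.orth12 (K := K) (k := k) (s := s) (a := a) (c := c))
  orth21 := by simpa only [E1, E2, Al, Be, Ga, Et, map_mul, map_zero] using RingQuot.mkAlgHom_rel K (Rel.orth21 (K := K) (k := k) (s := s) (a := a) (c := c))
  sum_idem := by simpa only [E1, E2, Al, Be, Ga, Et, map_add, map_one] using RingQuot.mkAlgHom_rel K (Rel.sum_idem (K := K) (k := k) (s := s) (a := a) (c := c))
  al_left := by simpa only [E1, E2, Al, Be, Ga, Et, map_mul] using RingQuot.mkAlgHom_rel K (Rel.al_left (K := K) (k := k) (s := s) (a := a) (c := c))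
  al_right := by simpa only [E1, E2, Al, Be, Ga, Et, map_mul] using RingQuot.mkAlgHom_rel K (Rel.al_right (K := K) (k := k) (s := s) (a := a) (c := c))
  be_left := by simpa only [E1, E2, Al, Be, Ga, Et, map_mul] using RingQuot.mkAlgHom_rel K (Rel.be_left (K := K) (k := k) (s := s) (a := a) (c := c))
  be_right := by simpa only [E1, E2, Al, Be, Ga, Et, map_mul] using RingQuot.mkAlgHom_rel K (Rel.be_right (K := K) (k := k) (s := s) (a := a) (c := c))
  ga_left := by simpa only [E1, E2, Al, Be, Ga, Et, map_mul] using RingQuot.mkAlgHom_rel K (Rel.ga_left (K := K) (k := k) (s := s) (a := a) (c := c))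
  ga_right := by simpa only [E1, E2, Al, Be, Ga, Et, map_mul] using RingQuot.mkAlgHom_rel K (Rel.ga_right (K := K) (k := k) (s := s) (a := a) (c := c))
  et_left := by simpa only [E1, E2, Al, Be, Ga, Et, map_mul] using RingQuot.mkAlgHom_rel K (Rel.et_left (K := K) (k := k) (s := s) (a := a) (c := c))
  et_right := by simpa only [E1, E2, Al, Be, Ga, Et, map_mul] using RingQuot.mkAlgHom_rel K (Rel.et_right (K := K) (k := k) (s := s) (a := a) (c := c))
  rbe := by simpa only [E1, E2, Al, Be, Ga, Et, map_mul, map_pow] using RingQuot.mkAlgHom_rel K (Rel.rel_beta_eta (K := K) (k := k) (s := s) (a := a) (c := c))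
  reg := by simpa only [E1, E2, Al, Be, Ga, Et, map_mul, map_pow] using RingQuot.mkAlgHom_rel K (Rel.rel_eta_gamma (K := K) (k := k) (s := s) (a := a) (c := c))
  raa := by simpa only [E1, E2, Al, Be, Ga, Et, map_mul, map_pow, map_add, map_smul] using RingQuot.mkAlgHom_rel K (Rel.rel_alpha_sq (K := K) (k := k) (s := s) (a := a) (c := c))
  rgb := by simpa only [E1, E2, Al, Be, Ga, Et, map_mul, map_pow] using RingQuot.mkAlgHom_rel K (Rel.rel_gamma_beta (K := K) (k := k) (s := s) (a := a) (c := c))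
  raab := by simpa only [E1, E2, Al, Be, Ga, Et, map_mul, map_zero] using RingQuot.mkAlgHom_rel K (Rel.rel_alpha_sq_beta (K := K) (k := k) (s := s) (a := a) (c := c))
  rgaa := by simpa only [E1, E2, Al, Be, Ga, Et, map_mul, map_zero] using RingQuot.mkAlgHom_rel K (Rel.rel_gamma_alpha_sq (K := K) (k := k) (s := s) (a := a) (c := c))
  adj := by
    rw [eq_top_iff]
    rintro x -
    obtain ⟨y, rfl⟩ := RingQuot.mkAlgHom_surjective K (Rel K k s a c) x
    induction y using FreeAlgebra.induction with
    | grade0 r => rw [AlgHom.commutes]; exact Subalgebra.algebraMap_mem _ r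
    | grade1 g =>
      apply Algebra.subset_adjoin
      cases g
      · exact Or.inl rfl
      · exact Or.inr (Or.inl rfl)
      · exact Or.inr (Or.inr (Or.inl rfl))
      · exact Or.inr (Or.inr (Or.inr (Or.inl rfl)))
      · exact Or.inr (Or.inr (Or.inr (Or.inr (Or.inl rfl))))
      · exact Or.inr (Or.inr (Or.inr (Or.inr (Or.inr rfl))))
    | mul x y hx hy => rw [map_mul]; exact Subalgebra.mul_mem _ hx hy
    | add x y hx hy => rw [map_add]; exact Subalgebra.add_mem _ hx hy

lemma W_bVec (K : Type) [Field K] (k s : ℕ) (a c : K) (hk : 2 ≤ k) (hs : 3 ≤ s) (p L : ℕ)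
    (hL : 1 ≤ L) (hLk : L < 3 * k) :
    ∃ i, (dat K k s a c hk hs).W p L = bVec K k s a c i := by
  obtain ⟨n, r, hr, rfl⟩ : ∃ n r, r < 3 ∧ L = 3 * n + r := ⟨L / 3, L % 3, by omega, by omega⟩
  have hp : (dat K k s a c hk hs).W p (3 * n + r) = (dat K k s a c hk hs).W (p % 3) (3 * n + r) :=
    Dat.W_congr _ _ (by omega)
  rw [hp]
  obtain rfl | rfl | rfl : r = 0 ∨ r = 1 ∨ r = 2 := by omega
  · rcases Dat.mod3 p with h | h | h <;> rw [h, add_zero, Dat.W_three _ _ _ (by omega)]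
    · exact ⟨.inl (.inr (.inr ⟨n, by omega⟩)), rfl⟩
    · refine ⟨.inl (.inr (.inl ⟨n - 1, by omega⟩)), ?_⟩
      obtain ⟨m, rfl⟩ : ∃ m, n = m + 1 := ⟨n - 1, by omega⟩
      rfl
    · refine ⟨.inr (.inl (.inr ⟨n - 1, by omega⟩)), ?_⟩
      obtain ⟨m, rfl⟩ : ∃ m, n = m + 1 := ⟨n - 1, by omega⟩
      rfl
  · rcases Dat.mod3 p with h | h | h <;> rw [h, Dat.W_pow, Dat.W_one]
    · refine ⟨.inl (.inl (.inl ⟨n, by omega⟩)), ?_⟩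
      rw [mul_assoc, swp]
      rfl
    · exact ⟨.inr (.inr (.inl (.inl ⟨n, by omega⟩))), rfl⟩
    · exact ⟨.inr (.inr (.inr (.inl ⟨n, by omega⟩))), rfl⟩
  · rcases Dat.mod3 p with h | h | h <;> rw [h, Dat.W_pow, Dat.W_two]
    · refine ⟨.inr (.inr (.inl (.inr ⟨n, by omega⟩))), ?_⟩
      rw [← mul_assoc, mul_assoc _ _ (Dat.ar _ (0 + 2)), swp]
      rfl
    · exact ⟨.inl (.inl (.inr ⟨n, by omega⟩)), rfl⟩
    · exact ⟨.inr (.inr (.inr (.inr ⟨n, by omega⟩))), rfl⟩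

lemma psi_dat (K : Type) [Field K] (k s : ℕ) (a c : K) (hk : 2 ≤ k) (hs : 3 ≤ s)
    (ψ : Aa K k s a c →ₗ[K] K) (h : IsPsi K k s a c ψ) : (dat K k s a c hk hs).Psi ψ := by
  obtain ⟨h1, h2, h3⟩ := h
  set D := dat K k s a c hk hs with hD
  have hz1 : (Al K k s a c * Be K k s a c * Ga K k s a c) ^ k = D.W 0 (3 * k) := by
    rw [Dat.W_three _ _ _ (by omega)]; rfl
  have hz2 : Et K k s a c ^ s = D.W 2 (3 * k) := D.z2_eq
  rw [hz1] at h2 h3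
  rw [hz2] at h1 h3
  have hWt : ∀ p, ψ (D.W p (3 * k)) = 1 := by
    intro p
    rcases Dat.mod3 p with h | h | h
    · rw [D.W_congr (q := 0) _ (by omega), h2]
    · rw [D.W_congr (q := 1) _ (by omega), ← D.z1_eq, h2]
    · rw [D.W_congr (q := 2) _ (by omega), h1]
  have hne : ∀ p, D.W p (3 * k) ≠ 0 := by
    intro p h; have := hWt p; rw [h] at this; simp at this
  have hzz : ∀ q p L, 1 ≤ L → D.W q (3 * k) * D.W p L = 0 := by
    intro q p L hL
    by_cases h : p % 3 = (q + 3 * k) % 3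
    · rw [D.W_mul h, D.W_big (by omega)]
    · rw [D.W_mul0 h (by omega) hL (by omega)]
  refine ⟨?_, hWt, ?_⟩
  · intro p L hL hLk
    obtain ⟨i, hi⟩ := W_bVec K k s a c hk hs p L hL hLk
    rw [← hD] at hi
    have hd : ∀ q, D.W p L ≠ D.W q (3 * k) := by
      intro q h
      apply hne p
      rw [show 3 * k = L + (3 * k - L) by omega, ← D.W_add, h, hzz _ _ _ (by omega)]
    rw [hi]
    exact h3 i (by rw [← hi]; exact hd 2) (by rw [← hi]; exact hd 0)
  · intro t ht hts
    have hd : ∀ q, D.et ^ t ≠ D.W q (3 * k) := by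
      intro q h
      apply hne 2
      have hst : D.et ^ s = D.et ^ (t + ((s - t - 1) + 1)) := by congr 1; omega
      rw [← D.z2_eq, hst, pow_add, h, pow_succ', ← mul_assoc, D.W_et (by omega), zero_mul]
    exact h3 (.inr (.inl (.inl ⟨t, by omega⟩))) (hd 2) (hd 0)

end QW

open QT in
/-- char K = 2, k ≥ 2 even, s ≥ 3, a, c ≠ 0.
If c is a square in K then dim T₁(A^{k,s}(a,c))^⊥ = dim T₁(A^{k,s}(a,0))^⊥;
if c is not a square in K then dim T₁(A^{k,s}(a,c))^⊥ = dim T₁(A^{k,s}(a,0))^⊥ + 1. -/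
theorem statement12 (K : Type) [Field K] [CharP K 2] (k s : ℕ)
    (hk : 2 ≤ k) (hkeven : Even k) (hs : 3 ≤ s) (a c : K) (ha : a ≠ 0) (hc : c ≠ 0)
    (ψc : Aa K k s a c →ₗ[K] K) (hψc : IsPsi K k s a c ψc)
    (ψ0 : Aa K k s a 0 →ₗ[K] K) (hψ0 : IsPsi K k s a 0 ψ0) :
    (IsSquare c →
      Module.finrank K (perp K k s a c ψc) = Module.finrank K (perp K k s a 0 ψ0)) ∧
    (¬ IsSquare c →
      Module.finrank K (perp K k s a c ψc) = Module.finrank K (perp K k s a 0 ψ0) + 1) := by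
  have hke : k % 2 = 0 := Nat.even_iff.1 hkeven
  have H := QW.psi_dat K k s a c hk hs ψc hψc
  have H0 := QW.psi_dat K k s a 0 hk hs ψ0 hψ0
  have h0 : Module.finrank K (perp K k s a 0 ψ0) = _ := QW.Dat.dim_sq H0 hke (IsSquare.zero)
  rw [h0]
  exact ⟨fun h => QW.Dat.dim_sq H hke h, fun h => QW.Dat.dim_nsq H hke h⟩
end

section
/- Let K have characteristic 2, let k ≥ 2, and suppose c = d² for some nonzero d ∈ K. Then Z(A^{k,s}(a,c))/T₁(A^{k,s}(a,c))^⊥ ≅ K[U,Y]/(U^{⌈(k+1)/2⌉}, Y^{⌈(s+1)/2⌉}, UY) as K-algebras. -/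
set_option synthInstance.maxHeartbeats 1000000

namespace QT

noncomputable instance centerCommRing (K : Type) [Field K] (k s : ℕ) (a c : K) :
    CommRing (Subalgebra.center K (Aa K k s a c)) := inferInstance

noncomputable instance centerAlgebra (K : Type) [Field K] (k s : ℕ) (a c : K) :
    Algebra K (Subalgebra.center K (Aa K k s a c)) := inferInstance

end QT

namespace QTP

structure Sys (K : Type) [Field K] {A : Type} [Ring A] [Algebra K A] (k s : ℕ) (a c : K)
    (e f α β γ η : A) : Prop where
  hk : 2 ≤ k
  hs : 3 ≤ s
  ee : e * e = e
  ff : f * f = f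
  ef : e * f = 0
  fe : f * e = 0
  sum : e + f = 1
  eα : e * α = α
  αe : α * e = α
  eβ : e * β = β
  βf : β * f = β
  fγ : f * γ = γ
  γe : γ * e = γ
  fη : f * η = η
  ηf : η * f = η
  βη : β * η = (α * β * γ) ^ (k - 1) * (α * β)
  ηγ : η * γ = (γ * α * β) ^ (k - 1) * (γ * α)
  αα : α * α = a • ((β * γ * α) ^ (k - 1) * (β * γ)) + c • (β * γ * α) ^ k
  γβ : γ * β = η ^ (s - 1)
  ααβ : α * α * β = 0
  γαα : γ * (α * α) = 0
  top : Algebra.adjoin K ({e, f, α, β, γ, η} : Set A) = ⊤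

section
variable {K : Type} [Field K] {A : Type} [Ring A] [Algebra K A] {k s : ℕ} {a c : K}
    {e f α β γ η : A}

namespace Sys

theorem zef {X Y e f : A} (ef : e * f = 0) (hX : X * e = X) (hY : f * Y = Y) : X * Y = 0 := by
  rw [← hX, ← hY, mul_assoc, ← mul_assoc e f, ef, zero_mul, mul_zero]

variable (S : Sys K k s a c e f α β γ η)
include S

theorem αη : α * η = 0 := zef S.ef S.αe S.fη
theorem ηα : η * α = 0 := zef S.fe S.ηf S.eα
theorem γη : γ * η = 0 := zef S.ef S.γe S.fη
theorem ηβ : η * β = 0 := zef S.fe S.ηf S.eβ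
theorem γγ : γ * γ = 0 := zef S.ef S.γe S.fγ
theorem ββ : β * β = 0 := zef S.fe S.βf S.eβ
theorem αγ : α * γ = 0 := zef S.ef S.αe S.fγ
theorem βα : β * α = 0 := zef S.fe S.βf S.eα
theorem aab : α * (α * β) = 0 := by rw [← mul_assoc, S.ααβ]
theorem aab' (Z : A) : α * (α * (β * Z)) = 0 := by
  rw [← mul_assoc α β, ← mul_assoc α (α * β), S.aab, zero_mul]
theorem gaa' (Z : A) : γ * (α * (α * Z)) = 0 := by
  rw [← mul_assoc α α, ← mul_assoc, S.γαα, zero_mul]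

omit S in
theorem sα (n : ℕ) : α * (β * γ * α) ^ n = (α * β * γ) ^ n * α := by
  have := mul_pow_mul α (β * γ) n
  rw [← mul_assoc] at this
  exact this.symm
omit S in
theorem sβ (n : ℕ) : β * (γ * α * β) ^ n = (β * γ * α) ^ n * β := by
  have := mul_pow_mul β (γ * α) n
  rw [← mul_assoc] at this
  exact this.symm
omit S in
theorem sγ (n : ℕ) : γ * (α * β * γ) ^ n = (γ * α * β) ^ n * γ := by
  have := mul_pow_mul γ (α * β) n
  rw [← mul_assoc] at this
  exact this.symm

theorem αx (n : ℕ) : α * (α * β * γ) ^ (n + 1) = 0 := by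
  rw [pow_succ', ← mul_assoc]; simp only [mul_assoc, S.aab', zero_mul]
  
theorem xα (n : ℕ) : (β * γ * α) ^ (n + 1) * α = 0 := by
  rw [pow_succ]; simp only [mul_assoc, S.γαα, mul_zero]

theorem αxαβ (n : ℕ) : α * ((α * β * γ) ^ n * (α * β)) = 0 := by
  cases n with
  | zero => simp [S.aab]
  | succ n => rw [← mul_assoc, S.αx, zero_mul]

theorem αβη : α * (β * η) = 0 := by rw [S.βη, S.αxαβ]

theorem ηγα : η * (γ * α) = 0 := by
  rw [← mul_assoc, S.ηγ]; simp only [mul_assoc, S.γαα, mul_zero]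

theorem βηη : β * (η * η) = 0 := by
  rw [← mul_assoc, S.βη]; simp only [mul_assoc, S.αβη, mul_zero]

theorem ηg (n : ℕ) : η * (γ * α * β) ^ (n + 1) = 0 := by
  rw [pow_succ', ← mul_assoc, ← mul_assoc, S.ηγα, zero_mul, zero_mul]

theorem gη (n : ℕ) : (γ * α * β) ^ (n + 1) * η = 0 := by
  rw [pow_succ]; simp only [mul_assoc, S.αβη, mul_zero]

theorem ηηγ : η * (η * γ) = 0 := by
  obtain ⟨n, rfl⟩ : ∃ n, k = n + 2 := ⟨k - 2, by have := S.hk; omega⟩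
  rw [S.ηγ, ← mul_assoc]
  show η * _ ^ (n + 1) * _ = 0
  rw [S.ηg, zero_mul]

theorem γβγ : γ * (β * γ) = 0 := by
  obtain ⟨n, rfl⟩ : ∃ n, s = n + 3 := ⟨s - 3, by have := S.hs; omega⟩
  rw [← mul_assoc, S.γβ]
  show η ^ (n + 2) * _ = 0
  simp only [pow_succ, mul_assoc, S.ηηγ, mul_zero]

theorem βγβ : β * (γ * β) = 0 := by
  obtain ⟨n, rfl⟩ : ∃ n, s = n + 3 := ⟨s - 3, by have := S.hs; omega⟩
  rw [S.γβ]
  show β * η ^ (n + 2) = 0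
  rw [pow_succ', pow_succ', ← mul_assoc η, ← mul_assoc, S.βηη, zero_mul]

theorem γβγ' (Z : A) : γ * (β * (γ * Z)) = 0 := by
  rw [← mul_assoc β, ← mul_assoc, S.γβγ, zero_mul]

theorem xk : (α * β * γ) ^ k = (β * γ * α) ^ k := by
  obtain ⟨n, rfl⟩ : ∃ n, k = n + 1 := ⟨k - 1, by have := S.hk; omega⟩
  have h1 := S.βη
  have h2 := S.ηγ
  simp only [Nat.add_sub_cancel] at h1 h2
  have h3 : β * η * γ = β * (η * γ) := mul_assoc _ _ _
  rw [h1, h2, ← mul_assoc β, sβ] at h3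
  rw [pow_succ, pow_succ]
  simpa only [mul_assoc] using h3

theorem gk : (γ * α * β) ^ k = η ^ s := by
  obtain ⟨n, rfl⟩ : ∃ n, k = n + 1 := ⟨k - 1, by have := S.hk; omega⟩
  obtain ⟨m, rfl⟩ : ∃ m, s = m + 1 := ⟨s - 1, by have := S.hs; omega⟩
  have h1 := S.βη
  have h2 := S.γβ
  simp only [Nat.add_sub_cancel] at h1 h2
  have h3 : γ * β * η = γ * (β * η) := mul_assoc _ _ _
  rw [h1, h2, ← mul_assoc γ, sγ] at h3
  rw [pow_succ, pow_succ, h3]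
  simp only [mul_assoc]

theorem xx (n : ℕ) : (α * β * γ) ^ (n + 1) * (β * γ * α) = 0 := by
  rw [pow_succ]; simp only [mul_assoc, S.γβγ', mul_zero]
theorem xβ (n : ℕ) : (α * β * γ) ^ (n + 1) * β = 0 := by
  rw [pow_succ]; simp only [mul_assoc, S.βγβ, mul_zero]
theorem γx (n : ℕ) : γ * (β * γ * α) ^ (n + 1) = 0 := by
  rw [pow_succ']; simp only [mul_assoc, S.γβγ', mul_zero]
theorem xx' (n : ℕ) : (β * γ * α) ^ (n + 1) * (α * β * γ) = 0 := by
  rw [pow_succ]; simp only [mul_assoc, S.gaa', mul_zero]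

theorem kpos : ∃ n, k = n + 2 := ⟨k - 2, by have := S.hk; omega⟩
theorem spos : ∃ n, s = n + 3 := ⟨s - 3, by have := S.hs; omega⟩

theorem x_top (n : ℕ) (h : k < n) : (α * β * γ) ^ n = 0 := by
  obtain ⟨j, rfl⟩ := S.kpos
  obtain ⟨m, rfl⟩ := Nat.exists_eq_add_of_lt h
  rw [pow_succ', pow_add, S.xk, ← mul_assoc, pow_succ' _ (j+1), ← mul_assoc,
    ← pow_one (α * β * γ), S.xx 0, zero_mul, zero_mul]

theorem x'_top (n : ℕ) (h : k < n) : (β * γ * α) ^ n = 0 := by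
  obtain ⟨j, rfl⟩ := S.kpos
  obtain ⟨m, rfl⟩ := Nat.exists_eq_add_of_lt h
  rw [add_assoc, pow_add, ← S.xk, pow_succ' _ m, ← mul_assoc, S.xx (j+1), zero_mul]

theorem η_top (n : ℕ) (h : s < n) : η ^ n = 0 := by
  obtain ⟨m, rfl⟩ := Nat.exists_eq_add_of_lt h
  have : s + m + 1 = m + 1 + 1 + (s - 1) := by have := S.hs; omega
  rw [this, pow_add, ← S.γβ, pow_succ, pow_succ]
  simp only [mul_assoc]
  rw [← mul_assoc η γ, ← mul_assoc η (η * γ), S.ηηγ, zero_mul, mul_zero]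

theorem g_top (n : ℕ) (h : k < n) : (γ * α * β) ^ n = 0 := by
  obtain ⟨j, rfl⟩ := S.kpos
  obtain ⟨t, rfl⟩ := S.spos
  obtain ⟨m, rfl⟩ := Nat.exists_eq_add_of_lt h
  rw [add_assoc, pow_add, S.gk, pow_succ, mul_assoc, S.ηg, mul_zero]

theorem f1_top (n : ℕ) (h : k ≤ n) : α * (β * γ * α) ^ n = 0 := by
  obtain ⟨j, rfl⟩ := S.kpos
  obtain ⟨m, rfl⟩ := Nat.exists_eq_add_of_le h
  rw [pow_add, ← S.xk, ← mul_assoc, S.αx, zero_mul]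

theorem f2_top (n : ℕ) (h : k ≤ n) : (β * γ * α) ^ n * (β * γ) = 0 := by
  obtain ⟨j, rfl⟩ := S.kpos
  obtain ⟨m, rfl⟩ := Nat.exists_eq_add_of_le h
  cases m with
  | zero => rw [Nat.add_zero, ← S.xk, ← mul_assoc, S.xβ, zero_mul]
  | succ m => rw [S.x'_top _ (by omega), zero_mul]

theorem h1_top (n : ℕ) (h : k ≤ n) : (β * γ * α) ^ n * β = 0 := by
  obtain ⟨j, rfl⟩ := S.kpos
  obtain ⟨m, rfl⟩ := Nat.exists_eq_add_of_le h
  cases m with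
  | zero => rw [Nat.add_zero, ← S.xk, S.xβ]
  | succ m => rw [S.x'_top _ (by omega), zero_mul]

theorem ex (n : ℕ) : e * (α * β * γ) ^ (n + 1) = (α * β * γ) ^ (n + 1) := by
  rw [pow_succ']; simp only [← mul_assoc, S.eα]
theorem xe (n : ℕ) : (α * β * γ) ^ (n + 1) * e = (α * β * γ) ^ (n + 1) := by
  rw [pow_succ]; simp only [mul_assoc, S.γe]
theorem ex' (n : ℕ) : e * (β * γ * α) ^ (n + 1) = (β * γ * α) ^ (n + 1) := by
  rw [pow_succ']; simp only [← mul_assoc, S.eβ]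
theorem x'e (n : ℕ) : (β * γ * α) ^ (n + 1) * e = (β * γ * α) ^ (n + 1) := by
  rw [pow_succ]; simp only [mul_assoc, S.αe]
theorem fg (n : ℕ) : f * (γ * α * β) ^ (n + 1) = (γ * α * β) ^ (n + 1) := by
  rw [pow_succ']; simp only [← mul_assoc, S.fγ]
theorem gf (n : ℕ) : (γ * α * β) ^ (n + 1) * f = (γ * α * β) ^ (n + 1) := by
  rw [pow_succ]; simp only [mul_assoc, S.βf]
theorem fηn (n : ℕ) : f * η ^ (n + 1) = η ^ (n + 1) := by
  rw [pow_succ', ← mul_assoc, S.fη]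
theorem ηnf (n : ℕ) : η ^ (n + 1) * f = η ^ (n + 1) := by
  rw [pow_succ, mul_assoc, S.ηf]
theorem ef1 (n : ℕ) : e * (α * (β * γ * α) ^ n) = α * (β * γ * α) ^ n := by
  rw [← mul_assoc, S.eα]
theorem f1e (n : ℕ) : (α * (β * γ * α) ^ n) * e = α * (β * γ * α) ^ n := by
  rw [sα, mul_assoc, S.αe]
theorem f2e (n : ℕ) : ((β * γ * α) ^ n * (β * γ)) * e = (β * γ * α) ^ n * (β * γ) := by
  simp only [mul_assoc, S.γe]
theorem eh1 (n : ℕ) : e * ((β * γ * α) ^ n * β) = (β * γ * α) ^ n * β := by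
  rw [← sβ, ← mul_assoc, S.eβ]
theorem ef2 (n : ℕ) : e * ((β * γ * α) ^ n * (β * γ)) = (β * γ * α) ^ n * (β * γ) := by
  rw [← mul_assoc _ β, ← mul_assoc, S.eh1]
theorem h1f (n : ℕ) : ((β * γ * α) ^ n * β) * f = (β * γ * α) ^ n * β := by
  rw [mul_assoc, S.βf]
theorem eh2 (n : ℕ) : e * (α * (β * γ * α) ^ n * β) = α * (β * γ * α) ^ n * β := by
  rw [← mul_assoc, S.ef1]
theorem h2f (n : ℕ) : (α * (β * γ * α) ^ n * β) * f = α * (β * γ * α) ^ n * β := by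
  rw [mul_assoc, S.βf]
theorem fl1 (n : ℕ) : f * ((γ * α * β) ^ n * γ) = (γ * α * β) ^ n * γ := by
  rw [← sγ, ← mul_assoc, S.fγ]
theorem fl2 (n : ℕ) : f * ((γ * α * β) ^ n * (γ * α)) = (γ * α * β) ^ n * (γ * α) := by
  rw [← mul_assoc _ γ, ← mul_assoc, S.fl1]
theorem l1e (n : ℕ) : ((γ * α * β) ^ n * γ) * e = (γ * α * β) ^ n * γ := by
  rw [mul_assoc, S.γe]
theorem l2e (n : ℕ) : ((γ * α * β) ^ n * (γ * α)) * e = (γ * α * β) ^ n * (γ * α) := by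
  simp only [mul_assoc, S.αe]

end Sys
end

section
variable {K : Type} [Field K] {A : Type} [Ring A] [Algebra K A] {k s : ℕ} {a c : K}
    {e f α β γ η : A}

inductive Mono (e f α β γ η : A) : A → Prop
  | e : Mono e f α β γ η e
  | f : Mono e f α β γ η f
  | f1 (n : ℕ) : Mono e f α β γ η (α * (β * γ * α) ^ n)
  | f2 (n : ℕ) : Mono e f α β γ η ((β * γ * α) ^ n * (β * γ))
  | f3 (n : ℕ) : Mono e f α β γ η ((β * γ * α) ^ (n + 1))
  | f4 (n : ℕ) : Mono e f α β γ η ((α * β * γ) ^ (n + 1))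
  | et (n : ℕ) : Mono e f α β γ η (η ^ (n + 1))
  | g (n : ℕ) : Mono e f α β γ η ((γ * α * β) ^ (n + 1))
  | h1 (n : ℕ) : Mono e f α β γ η ((β * γ * α) ^ n * β)
  | h2 (n : ℕ) : Mono e f α β γ η (α * (β * γ * α) ^ n * β)
  | l1 (n : ℕ) : Mono e f α β γ η ((γ * α * β) ^ n * γ)
  | l2 (n : ℕ) : Mono e f α β γ η ((γ * α * β) ^ n * (γ * α))

namespace Sys
variable (S : Sys K k s a c e f α β γ η)
include S

theorem gen_induction (B : Subalgebra K A) (he : e ∈ B) (hf : f ∈ B) (hα : α ∈ B) (hβ : β ∈ B)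
    (hγ : γ ∈ B) (hη : η ∈ B) (x : A) : x ∈ B := by
  have : Algebra.adjoin K ({e, f, α, β, γ, η} : Set A) ≤ B := by
    apply Algebra.adjoin_le
    rintro x (rfl | rfl | rfl | rfl | rfl | rfl) <;> assumption
  rw [S.top] at this
  exact this trivial

theorem central (z : A) (hα : α * z = z * α) (hβ : β * z = z * β) (he : e * z = z * e)
    (hγ : γ * z = z * γ) (hη : η * z = z * η) (x : A) : x * z = z * x := by
  have hf : f * z = z * f := by
    have : f = 1 - e := by rw [← S.sum]; abel
    rw [this, sub_mul, mul_sub, he]; simp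
  have := S.gen_induction (Subalgebra.centralizer K {z})
    (by simp [Subalgebra.mem_centralizer_iff, he]) (by simp [Subalgebra.mem_centralizer_iff, hf])
    (by simp [Subalgebra.mem_centralizer_iff, hα]) (by simp [Subalgebra.mem_centralizer_iff, hβ])
    (by simp [Subalgebra.mem_centralizer_iff, hγ]) (by simp [Subalgebra.mem_centralizer_iff, hη]) x
  simpa [Subalgebra.mem_centralizer_iff, eq_comm] using this

omit S in
def W (K : Type) [Field K] {A : Type} [Ring A] [Algebra K A] (e f α β γ η : A) : Submodule K A :=
  Submodule.span K {X | Mono e f α β γ η X}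

omit S in
theorem inW {X : A} (h : Mono e f α β γ η X) : X ∈ W K e f α β γ η := Submodule.subset_span h

theorem tyL {X : A} (h : Mono e f α β γ η X) : (e * X = X ∧ f * X = 0) ∨ (f * X = X ∧ e * X = 0) := by
  have key : e * X = X ∨ f * X = X := by
    cases h with
    | e => exact .inl S.ee
    | f => exact .inr S.ff
    | f1 n => exact .inl (S.ef1 n)
    | f2 n => exact .inl (S.ef2 n)
    | f3 n => exact .inl (S.ex' n)
    | f4 n => exact .inl (S.ex n)
    | et n => exact .inr (S.fηn n)
    | g n => exact .inr (S.fg n)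
    | h1 n => exact .inl (S.eh1 n)
    | h2 n => exact .inl (S.eh2 n)
    | l1 n => exact .inr (S.fl1 n)
    | l2 n => exact .inr (S.fl2 n)
  rcases key with h | h
  · exact .inl ⟨h, zef S.fe S.ff h⟩
  · exact .inr ⟨h, zef S.ef S.ee h⟩

theorem tyR {X : A} (h : Mono e f α β γ η X) : (X * e = X ∧ X * f = 0) ∨ (X * f = X ∧ X * e = 0) := by
  have key : X * e = X ∨ X * f = X := by
    cases h with
    | e => exact .inl S.ee
    | f => exact .inr S.ff
    | f1 n => exact .inl (S.f1e n)
    | f2 n => exact .inl (S.f2e n)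
    | f3 n => exact .inl (S.x'e n)
    | f4 n => exact .inl (S.xe n)
    | et n => exact .inr (S.ηnf n)
    | g n => exact .inr (S.gf n)
    | h1 n => exact .inr (S.h1f n)
    | h2 n => exact .inr (S.h2f n)
    | l1 n => exact .inl (S.l1e n)
    | l2 n => exact .inl (S.l2e n)
  rcases key with h | h
  · exact .inl ⟨h, zef S.ef h S.ff⟩
  · exact .inr ⟨h, zef S.fe h S.ee⟩

theorem f3' (n : ℕ) : (β * γ * α) ^ n * e ∈ W K e f α β γ η := by
  cases n with
  | zero => simpa using inW .e
  | succ n => rw [S.x'e]; exact inW (.f3 n)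

theorem W_α {X : A} (h : Mono e f α β γ η X) : α * X ∈ W K e f α β γ η := by
  have h0 : (0 : A) ∈ W K e f α β γ η := zero_mem _
  cases h with
  | e => rw [S.αe]; simpa using inW (K := K) (Mono.f1 (e := e) (f := f) (α := α) (β := β) (γ := γ) (η := η) 0)
  | f => rwa [zef S.ef S.αe S.ff]
  | f1 n =>
    cases n with
    | zero =>
      rw [pow_zero, mul_one, S.αα]
      obtain ⟨j, rfl⟩ := S.kpos
      exact add_mem (Submodule.smul_mem _ _ (inW (.f2 _))) (Submodule.smul_mem _ _ (inW (.f3 _)))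
    | succ n => rwa [pow_succ', ← mul_assoc, show α * α * (β * γ * α * (β * γ * α)^n) = 0 by
                  simp only [mul_assoc, S.aab']]
  | f2 n => rw [← mul_assoc, sα, mul_assoc, ← mul_assoc α β γ, ← pow_succ]; exact inW (.f4 n)
  | f3 n => exact inW (.f1 _)
  | f4 n => rwa [S.αx]
  | et n => rwa [zef S.ef S.αe (S.fηn n)]
  | g n => rwa [zef S.ef S.αe (S.fg n)]
  | h1 n => rw [← mul_assoc]; exact inW (.h2 n)
  | h2 n =>
    have : α * (α * (β * γ * α) ^ n * β) = 0 := by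
      cases n with
      | zero => simp [S.aab]
      | succ n => rw [pow_succ']; simp only [mul_assoc, S.aab']
    rwa [this]
  | l1 n => rwa [zef S.ef S.αe (S.fl1 n)]
  | l2 n => rwa [zef S.ef S.αe (S.fl2 n)]

theorem W_β {X : A} (h : Mono e f α β γ η X) : β * X ∈ W K e f α β γ η := by
  have h0 : (0 : A) ∈ W K e f α β γ η := zero_mem _
  cases h with
  | e => rwa [zef S.fe S.βf S.ee]
  | f => rw [S.βf]; simpa using inW (K := K) (Mono.h1 (e := e) (f := f) (α := α) (β := β) (γ := γ) (η := η) 0)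
  | f1 n => rwa [zef S.fe S.βf (S.ef1 n)]
  | f2 n => rwa [zef S.fe S.βf (S.ef2 n)]
  | f3 n => rwa [zef S.fe S.βf (S.ex' n)]
  | f4 n => rwa [zef S.fe S.βf (S.ex n)]
  | et n =>
    cases n with
    | zero =>
      rw [zero_add, pow_one, S.βη, ← mul_assoc, ← sα]; exact inW (.h2 _)
    | succ n => rwa [pow_succ', pow_succ', ← mul_assoc η, ← mul_assoc, S.βηη, zero_mul]
  | g n => rw [sβ]; exact inW (.h1 _)
  | h1 n => rwa [zef S.fe S.βf (S.eh1 n)]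
  | h2 n => rwa [zef S.fe S.βf (S.eh2 n)]
  | l1 n => rw [← mul_assoc, sβ, mul_assoc]; exact inW (.f2 _)
  | l2 n => rw [← mul_assoc, sβ, mul_assoc, ← mul_assoc β, ← pow_succ]; exact inW (.f3 _)

theorem γf2 (n : ℕ) : γ * ((β * γ * α) ^ n * (β * γ)) = 0 := by
  cases n with
  | zero => simp [S.γβγ]
  | succ n => rw [← mul_assoc, S.γx, zero_mul]

theorem W_γ {X : A} (h : Mono e f α β γ η X) : γ * X ∈ W K e f α β γ η := by
  have h0 : (0 : A) ∈ W K e f α β γ η := zero_mem _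
  cases h with
  | e => rw [S.γe]; simpa using inW (K := K) (Mono.l1 (e := e) (f := f) (α := α) (β := β) (γ := γ) (η := η) 0)
  | f => rwa [zef S.ef S.γe S.ff]
  | f1 n => rw [sα, ← mul_assoc, sγ, mul_assoc]; exact inW (.l2 _)
  | f2 n => rwa [S.γf2]
  | f3 n => rwa [S.γx]
  | f4 n => rw [sγ]; exact inW (.l1 _)
  | et n => rwa [zef S.ef S.γe (S.fηn n)]
  | g n => rwa [zef S.ef S.γe (S.fg n)]
  | h1 n =>
    cases n with
    | zero =>
      rw [pow_zero, one_mul, S.γβ]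
      obtain ⟨t, rfl⟩ := S.spos
      exact inW (.et _)
    | succ n => rwa [← mul_assoc, S.γx, zero_mul]
  | h2 n => rw [sα, ← mul_assoc, ← mul_assoc, sγ, mul_assoc _ γ, mul_assoc, ← pow_succ]; exact inW (.g n)
  | l1 n => rwa [zef S.ef S.γe (S.fl1 n)]
  | l2 n => rwa [zef S.ef S.γe (S.fl2 n)]

theorem W_η {X : A} (h : Mono e f α β γ η X) : η * X ∈ W K e f α β γ η := by
  have h0 : (0 : A) ∈ W K e f α β γ η := zero_mem _
  cases h with
  | e => rwa [zef S.fe S.ηf S.ee]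
  | f => rw [S.ηf]; simpa using inW (K := K) (Mono.et (e := e) (f := f) (α := α) (β := β) (γ := γ) (η := η) 0)
  | f1 n => rwa [zef S.fe S.ηf (S.ef1 n)]
  | f2 n => rwa [zef S.fe S.ηf (S.ef2 n)]
  | f3 n => rwa [zef S.fe S.ηf (S.ex' n)]
  | f4 n => rwa [zef S.fe S.ηf (S.ex n)]
  | et n => rw [← pow_succ']; exact inW (.et _)
  | g n => rwa [S.ηg]
  | h1 n => rwa [zef S.fe S.ηf (S.eh1 n)]
  | h2 n => rwa [zef S.fe S.ηf (S.eh2 n)]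
  | l1 n =>
    cases n with
    | zero => rw [pow_zero, one_mul, S.ηγ]; exact inW (.l2 _)
    | succ n => rwa [← mul_assoc, S.ηg, zero_mul]
  | l2 n =>
    cases n with
    | zero => rwa [pow_zero, one_mul, S.ηγα]
    | succ n => rwa [← mul_assoc, S.ηg, zero_mul]

theorem W_top (x : A) : x ∈ W K e f α β γ η := by
  let B : Subalgebra K A :=
    { carrier := {p | ∀ w ∈ W K e f α β γ η, p * w ∈ W K e f α β γ η}
      mul_mem' := fun {p q} hp hq w hw => by rw [mul_assoc]; exact hp _ (hq _ hw)
      add_mem' := fun {p q} hp hq w hw => by rw [add_mul]; exact add_mem (hp _ hw) (hq _ hw)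
      algebraMap_mem' := fun r w hw => by
        rw [← Algebra.smul_def]; exact Submodule.smul_mem _ _ hw }
  have hB : ∀ p : A, (∀ X, Mono e f α β γ η X → p * X ∈ W K e f α β γ η) → p ∈ B := by
    intro p hp w hw
    induction hw using Submodule.span_induction with
    | mem x h => exact hp x h
    | zero => rw [mul_zero]; exact zero_mem _
    | add x y _ _ hx hy => rw [mul_add]; exact add_mem hx hy
    | smul r x _ hx => rw [mul_smul_comm]; exact Submodule.smul_mem _ _ hx
  have hx : x ∈ B := by
    apply S.gen_induction B
    · apply hB; intro X hX
      rcases S.tyL hX with ⟨h, h'⟩ | ⟨h, h'⟩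
      · rw [h]; exact inW hX
      · rw [h']; exact zero_mem _
    · apply hB; intro X hX
      rcases S.tyL hX with ⟨h, h'⟩ | ⟨h, h'⟩
      · rw [h']; exact zero_mem _
      · rw [h]; exact inW hX
    · exact hB _ fun X hX => S.W_α hX
    · exact hB _ fun X hX => S.W_β hX
    · exact hB _ fun X hX => S.W_γ hX
    · exact hB _ fun X hX => S.W_η hX
  have := hx 1 (by rw [← S.sum]; exact add_mem (inW .e) (inW .f))
  simpa using this

end Sys
end

structure Tr {K : Type} [Field K] {A : Type} [Ring A] [Algebra K A] (k s : ℕ)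
    (α β γ η : A) (ψ : A →ₗ[K] K) : Prop where
  f1 : ∀ n, ψ (α * (β * γ * α) ^ n) = 0
  f2 : ∀ n, ψ ((β * γ * α) ^ n * (β * γ)) = 0
  f3 : ∀ n, ψ ((β * γ * α) ^ (n + 1)) = if n + 1 = k then 1 else 0
  f4 : ∀ n, ψ ((α * β * γ) ^ (n + 1)) = if n + 1 = k then 1 else 0
  et : ∀ n, ψ (η ^ (n + 1)) = if n + 1 = s then 1 else 0
  g : ∀ n, ψ ((γ * α * β) ^ (n + 1)) = if n + 1 = k then 1 else 0
  h1 : ∀ n, ψ ((β * γ * α) ^ n * β) = 0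
  h2 : ∀ n, ψ (α * (β * γ * α) ^ n * β) = 0
  l1 : ∀ n, ψ ((γ * α * β) ^ n * γ) = 0
  l2 : ∀ n, ψ ((γ * α * β) ^ n * (γ * α)) = 0

section
variable {K : Type} [Field K] {A : Type} [Ring A] [Algebra K A] {k s : ℕ} {a c : K}
    {e f α β γ η : A} {ψ : A →ₗ[K] K}

namespace Sys
variable (S : Sys K k s a c e f α β γ η) (T : Tr k s α β γ η ψ)
include S

theorem lin_ext (p q : A →ₗ[K] K) (h : ∀ X, Mono e f α β γ η X → p X = q X) (x : A) : p x = q x := by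
  have hw := S.W_top x
  induction hw using Submodule.span_induction with
  | mem x hx => exact h x hx
  | zero => simp
  | add x y _ _ hx hy => simp [hx, hy]
  | smul r x _ hx => simp [hx]

include T

theorem ψef (x : A) (h : e * x = x) (h' : x * f = x) : ψ x = 0 := by
  have := S.lin_ext (ψ ∘ₗ LinearMap.mulLeft K e ∘ₗ LinearMap.mulRight K f) 0 (by
    intro X hX
    simp only [LinearMap.comp_apply, LinearMap.mulLeft_apply, LinearMap.mulRight_apply,
      LinearMap.zero_apply]
    rcases S.tyR hX with ⟨h1, h2⟩ | ⟨h1, h2⟩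
    · rw [h2]; simp
    · rw [h1]
      rcases S.tyL hX with ⟨h3, h4⟩ | ⟨h3, h4⟩
      · rw [h3]
        have z : X * e = X → X = 0 := fun h => by rw [← h, h2]
        have z' : f * X = X → X = 0 := fun h => by rw [← h, h4]
        cases hX with
        | e => rw [z S.ee, map_zero]
        | f => rw [z' S.ff, map_zero]
        | f1 n => exact T.f1 n
        | f2 n => exact T.f2 n
        | f3 n => rw [z (S.x'e n), map_zero]
        | f4 n => rw [z (S.xe n), map_zero]
        | et n => rw [z' (S.fηn n), map_zero]
        | g n => rw [z' (S.fg n), map_zero]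
        | h1 n => exact T.h1 n
        | h2 n => exact T.h2 n
        | l1 n => exact T.l1 n
        | l2 n => exact T.l2 n
      · rw [h4, map_zero]) x
  simpa [h, h'] using this

theorem ψfe (x : A) (h : f * x = x) (h' : x * e = x) : ψ x = 0 := by
  have := S.lin_ext (ψ ∘ₗ LinearMap.mulLeft K f ∘ₗ LinearMap.mulRight K e) 0 (by
    intro X hX
    simp only [LinearMap.comp_apply, LinearMap.mulLeft_apply, LinearMap.mulRight_apply,
      LinearMap.zero_apply]
    rcases S.tyR hX with ⟨h1, h2⟩ | ⟨h1, h2⟩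
    · rw [h1]
      rcases S.tyL hX with ⟨h3, h4⟩ | ⟨h3, h4⟩
      · rw [h4, map_zero]
      · rw [h3]
        have z : X * f = X → X = 0 := fun h => by rw [← h, h2]
        have z' : e * X = X → X = 0 := fun h => by rw [← h, h4]
        cases hX with
        | e => rw [z' S.ee, map_zero]
        | f => rw [z S.ff, map_zero]
        | f1 n => exact T.f1 n
        | f2 n => exact T.f2 n
        | f3 n => rw [z' (S.ex' n), map_zero]
        | f4 n => rw [z' (S.ex n), map_zero]
        | et n => rw [z (S.ηnf n), map_zero]
        | g n => rw [z (S.gf n), map_zero]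
        | h1 n => exact T.h1 n
        | h2 n => exact T.h2 n
        | l1 n => exact T.l1 n
        | l2 n => exact T.l2 n
    · rw [h2]; simp) x
  simpa [h, h'] using this

theorem tr_e {X : A} (hX : Mono e f α β γ η X) : ψ (e * X) = ψ (X * e) := by
  rcases S.tyR hX with ⟨h1, h2⟩ | ⟨h1, h2⟩ <;> rcases S.tyL hX with ⟨h3, h4⟩ | ⟨h3, h4⟩
  · rw [h1, h3]
  · rw [h1, h4, S.ψfe T X h3 h1, map_zero]
  · rw [h2, h3, S.ψef T X h3 h1, map_zero]
  · rw [h2, h4]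

theorem diag_βγ {X : A} (h : (e * X = X ∧ X * e = X) ∨ (f * X = X ∧ X * f = X)) :
    ψ (β * X) = ψ (X * β) ∧ ψ (γ * X) = ψ (X * γ) := by
  rcases h with ⟨h1, h2⟩ | ⟨h1, h2⟩
  · constructor
    · rw [zef S.fe S.βf h1, map_zero]
      symm; apply S.ψef T
      · rw [← mul_assoc, h1]
      · rw [mul_assoc, S.βf]
    · rw [zef S.ef h2 S.fγ, map_zero]
      apply S.ψfe T
      · rw [← mul_assoc, S.fγ]
      · rw [mul_assoc, h2]
  · constructor
    · rw [zef S.fe h2 S.eβ, map_zero]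
      apply S.ψef T
      · rw [← mul_assoc, S.eβ]
      · rw [mul_assoc, h2]
    · rw [zef S.ef S.γe h1, map_zero]
      symm; apply S.ψfe T
      · rw [← mul_assoc, h1]
      · rw [mul_assoc, S.γe]

theorem off_αη {X : A} (h : (e * X = X ∧ X * f = X) ∨ (f * X = X ∧ X * e = X)) :
    ψ (α * X) = ψ (X * α) ∧ ψ (η * X) = ψ (X * η) := by
  rcases h with ⟨h1, h2⟩ | ⟨h1, h2⟩
  · constructor
    · rw [zef S.fe h2 S.eα, map_zero]
      apply S.ψef T
      · rw [← mul_assoc, S.eα]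
      · rw [mul_assoc, h2]
    · rw [zef S.fe S.ηf h1, map_zero]
      symm; apply S.ψef T
      · rw [← mul_assoc, h1]
      · rw [mul_assoc, S.ηf]
  · constructor
    · rw [zef S.ef S.αe h1, map_zero]
      symm; apply S.ψfe T
      · rw [← mul_assoc, h1]
      · rw [mul_assoc, S.αe]
    · rw [zef S.ef h2 S.fη, map_zero]
      apply S.ψfe T
      · rw [← mul_assoc, S.fη]
      · rw [mul_assoc, h2]

omit T in
theorem f1α (n : ℕ) : α * (β * γ * α) ^ (n + 1) * α = 0 := by rw [mul_assoc, S.xα, mul_zero]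
omit T in
theorem αf1 (n : ℕ) : α * (α * (β * γ * α) ^ (n + 1)) = 0 := by rw [sα, ← mul_assoc, S.αx, zero_mul]

theorem tr_α {X : A} (hX : Mono e f α β γ η X) : ψ (α * X) = ψ (X * α) := by
  cases hX with
  | e => rw [S.eα, S.αe]
  | f => rw [zef S.ef S.αe S.ff, zef S.fe S.ff S.eα]
  | f1 n =>
    cases n with
    | zero => simp
    | succ n => rw [S.f1α, S.αf1]
  | f2 n => rw [← mul_assoc, sα, mul_assoc, ← mul_assoc α β γ, ← pow_succ,
              mul_assoc (_ ^ _), ← pow_succ, T.f3, T.f4]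
  | f3 n => rw [S.xα, T.f1, map_zero]
  | f4 n => rw [S.αx, ← sα, T.f1, map_zero]
  | et n => rw [zef S.ef S.αe (S.fηn n), zef S.fe (S.ηnf n) S.eα]
  | g n => rw [zef S.ef S.αe (S.fg n), zef S.fe (S.gf n) S.eα]
  | h1 n => exact (S.off_αη T (.inl ⟨S.eh1 n, S.h1f n⟩)).1
  | h2 n => exact (S.off_αη T (.inl ⟨S.eh2 n, S.h2f n⟩)).1
  | l1 n => exact (S.off_αη T (.inr ⟨S.fl1 n, S.l1e n⟩)).1
  | l2 n => exact (S.off_αη T (.inr ⟨S.fl2 n, S.l2e n⟩)).1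

theorem tr_η {X : A} (hX : Mono e f α β γ η X) : ψ (η * X) = ψ (X * η) := by
  cases hX with
  | e => rw [zef S.fe S.ηf S.ee, zef S.ef S.ee S.fη]
  | f => rw [S.ηf, S.fη]
  | f1 n => rw [zef S.fe S.ηf (S.ef1 n), zef S.ef (S.f1e n) S.fη]
  | f2 n => rw [zef S.fe S.ηf (S.ef2 n), zef S.ef (S.f2e n) S.fη]
  | f3 n => rw [zef S.fe S.ηf (S.ex' n), zef S.ef (S.x'e n) S.fη]
  | f4 n => rw [zef S.fe S.ηf (S.ex n), zef S.ef (S.xe n) S.fη]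
  | et n => rw [← pow_succ, ← pow_succ']
  | g n => rw [S.ηg, S.gη]
  | h1 n => exact (S.off_αη T (.inl ⟨S.eh1 n, S.h1f n⟩)).2
  | h2 n => exact (S.off_αη T (.inl ⟨S.eh2 n, S.h2f n⟩)).2
  | l1 n => exact (S.off_αη T (.inr ⟨S.fl1 n, S.l1e n⟩)).2
  | l2 n => exact (S.off_αη T (.inr ⟨S.fl2 n, S.l2e n⟩)).2

theorem ψγβ : ψ (γ * β) = 0 := by
  rw [S.γβ]
  obtain ⟨t, rfl⟩ := S.spos
  show ψ (η ^ (t + 1 + 1)) = 0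
  rw [T.et, if_neg (by omega)]

omit T in
theorem l1β (n : ℕ) : (γ * α * β) ^ (n + 1) * γ * β = 0 := by
  rw [pow_succ]; simp only [mul_assoc, S.βγβ, mul_zero]

theorem tr_β {X : A} (hX : Mono e f α β γ η X) : ψ (β * X) = ψ (X * β) := by
  cases hX with
  | e => exact (S.diag_βγ T (.inl ⟨S.ee, S.ee⟩)).1
  | f => exact (S.diag_βγ T (.inr ⟨S.ff, S.ff⟩)).1
  | f1 n => exact (S.diag_βγ T (.inl ⟨S.ef1 n, S.f1e n⟩)).1
  | f2 n => exact (S.diag_βγ T (.inl ⟨S.ef2 n, S.f2e n⟩)).1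
  | f3 n => exact (S.diag_βγ T (.inl ⟨S.ex' n, S.x'e n⟩)).1
  | f4 n => exact (S.diag_βγ T (.inl ⟨S.ex n, S.xe n⟩)).1
  | et n => exact (S.diag_βγ T (.inr ⟨S.fηn n, S.ηnf n⟩)).1
  | g n => exact (S.diag_βγ T (.inr ⟨S.fg n, S.gf n⟩)).1
  | h1 n => rw [zef S.fe S.βf (S.eh1 n), zef S.fe (S.h1f n) S.eβ]
  | h2 n => rw [zef S.fe S.βf (S.eh2 n), zef S.fe (S.h2f n) S.eβ]
  | l1 n =>
    rw [← mul_assoc, sβ, mul_assoc, T.f2]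
    cases n with
    | zero => rw [pow_zero, one_mul, S.ψγβ T]
    | succ n => rw [S.l1β, map_zero]
  | l2 n => rw [← mul_assoc, sβ, mul_assoc, ← mul_assoc β, ← pow_succ,
            mul_assoc (_ ^ _), ← pow_succ, T.f3, T.g]

theorem tr_γ {X : A} (hX : Mono e f α β γ η X) : ψ (γ * X) = ψ (X * γ) := by
  cases hX with
  | e => exact (S.diag_βγ T (.inl ⟨S.ee, S.ee⟩)).2
  | f => exact (S.diag_βγ T (.inr ⟨S.ff, S.ff⟩)).2
  | f1 n => exact (S.diag_βγ T (.inl ⟨S.ef1 n, S.f1e n⟩)).2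
  | f2 n => exact (S.diag_βγ T (.inl ⟨S.ef2 n, S.f2e n⟩)).2
  | f3 n => exact (S.diag_βγ T (.inl ⟨S.ex' n, S.x'e n⟩)).2
  | f4 n => exact (S.diag_βγ T (.inl ⟨S.ex n, S.xe n⟩)).2
  | et n => exact (S.diag_βγ T (.inr ⟨S.fηn n, S.ηnf n⟩)).2
  | g n => exact (S.diag_βγ T (.inr ⟨S.fg n, S.gf n⟩)).2
  | l1 n => rw [zef S.ef S.γe (S.fl1 n), zef S.ef (S.l1e n) S.fγ]
  | l2 n => rw [zef S.ef S.γe (S.fl2 n), zef S.ef (S.l2e n) S.fγ]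
  | h1 n =>
    rw [mul_assoc _ β, T.f2]
    cases n with
    | zero => rw [pow_zero, one_mul, S.ψγβ T]
    | succ n => rw [← mul_assoc, S.γx, zero_mul, map_zero]
  | h2 n =>
    rw [sα, ← mul_assoc, ← mul_assoc, sγ, mul_assoc _ γ, mul_assoc, ← pow_succ, T.g,
      mul_assoc _ α, mul_assoc, ← pow_succ, T.f4]

theorem trace (x y : A) : ψ (x * y) = ψ (y * x) := by
  let B : Subalgebra K A :=
    { carrier := {p | ∀ w, ψ (p * w) = ψ (w * p)}
      mul_mem' := fun {p q} hp hq w => by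
        rw [mul_assoc, hp, mul_assoc, hq, mul_assoc]
      add_mem' := fun {p q} hp hq w => by rw [add_mul, mul_add, map_add, map_add, hp, hq]
      algebraMap_mem' := fun r w => by rw [Algebra.commutes] }
  have hB : ∀ p : A, (∀ X, Mono e f α β γ η X → ψ (p * X) = ψ (X * p)) → p ∈ B := fun p hp w =>
    S.lin_ext (ψ ∘ₗ LinearMap.mulLeft K p) (ψ ∘ₗ LinearMap.mulRight K p) hp w
  have he : e ∈ B := hB _ fun X hX => S.tr_e T hX
  have hx : x ∈ B := by
    apply S.gen_induction B
    · exact he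
    · have : f = 1 - e := by rw [← S.sum]; abel
      rw [this]; exact sub_mem (one_mem _) he
    · exact hB _ fun X hX => S.tr_α T hX
    · exact hB _ fun X hX => S.tr_β T hX
    · exact hB _ fun X hX => S.tr_γ T hX
    · exact hB _ fun X hX => S.tr_η T hX
  exact hx y

end Sys
end

def cm (K : Type) [Field K] (A : Type) [Ring A] [Algebra K A] : Submodule K A :=
  Submodule.span K {z : A | ∃ u v : A, z = u * v - v * u}

section
variable {K : Type} [Field K] {A : Type} [Ring A] [Algebra K A] {k s : ℕ} {a c : K}
    {e f α β γ η : A} {ψ : A →ₗ[K] K}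

theorem cm_mem (u v : A) : u * v - v * u ∈ cm K A := Submodule.subset_span ⟨u, v, rfl⟩

theorem dbl [CharP K 2] (x : A) : x + x = 0 := by
  rw [← two_smul K, CharTwo.two_eq_zero, zero_smul]

def uu (α β γ : A) : A := α * β * γ + β * γ * α + γ * α * β
def yy (k : ℕ) (α β γ η : A) : A := η + (α * β * γ) ^ (k - 1) * α

def rr (k s : ℕ) (e f α β γ η : A) (p q l : K) (μ ν : ℕ → K) : A :=
  p • e + q • f + l • α + ∑ i ∈ Finset.range (k - 1), μ i • (α * β * γ) ^ (i + 1) +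
    ∑ t ∈ Finset.range s, ν t • η ^ (t + 1)

def DD (K : Type) [Field K] {A : Type} [Ring A] [Algebra K A] (k s : ℕ) (e f α β γ η : A) :
    Submodule K A where
  carrier := {m | ∃ (p q l : K) (μ ν : ℕ → K), m - rr k s e f α β γ η p q l μ ν ∈ cm K A}
  zero_mem' := ⟨0, 0, 0, 0, 0, by simp [rr]⟩
  add_mem' := by
    rintro m m' ⟨p, q, l, μ, ν, h⟩ ⟨p', q', l', μ', ν', h'⟩
    refine ⟨p + p', q + q', l + l', μ + μ', ν + ν', ?_⟩
    convert add_mem h h' using 1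
    simp only [rr, add_smul, Pi.add_apply, Finset.sum_add_distrib]
    abel
  smul_mem' := by
    rintro r m ⟨p, q, l, μ, ν, h⟩
    refine ⟨r * p, r * q, r * l, r • μ, r • ν, ?_⟩
    convert Submodule.smul_mem _ r h using 1
    simp only [rr, Pi.smul_apply, smul_sub, smul_add, Finset.smul_sum, mul_smul, smul_eq_mul]

namespace Sys
variable (S : Sys K k s a c e f α β γ η) (T : Tr k s α β γ η ψ)

theorem DD_cm {m : A} (h : m ∈ cm K A) : m ∈ DD K k s e f α β γ η :=
  ⟨0, 0, 0, 0, 0, by simpa [rr] using h⟩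
theorem DD_e : e ∈ DD K k s e f α β γ η := ⟨1, 0, 0, 0, 0, by simp [rr]⟩
theorem DD_f : f ∈ DD K k s e f α β γ η := ⟨0, 1, 0, 0, 0, by simp [rr]⟩
theorem DD_α : α ∈ DD K k s e f α β γ η := ⟨0, 0, 1, 0, 0, by simp [rr]⟩

theorem DD_congr {m m' : A} (h : m - m' ∈ cm K A) (h' : m' ∈ DD K k s e f α β γ η) :
    m ∈ DD K k s e f α β γ η := by
  have := add_mem (DD_cm h) h'
  rwa [sub_add_cancel] at this

include S

theorem DD_η (n : ℕ) : η ^ (n + 1) ∈ DD K k s e f α β γ η := by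
  by_cases h : n < s
  · refine ⟨0, 0, 0, 0, Pi.single n 1, ?_⟩
    have : rr k s e f α β γ η (0:K) 0 0 0 (Pi.single n 1) = η ^ (n + 1) := by
      rw [rr, Finset.sum_eq_single_of_mem (s := Finset.range s) n (Finset.mem_range.2 h)]
      · simp
      · intro b _ hb; simp [hb]
    rw [this, sub_self]; exact zero_mem _
  · rw [S.η_top _ (by omega)]; exact zero_mem _

theorem xg (n : ℕ) : (α * β * γ) ^ (n + 1) - (γ * α * β) ^ (n + 1) ∈ cm K A := by
  convert cm_mem ((α * β * γ) ^ n * (α * β)) γ using 2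
  · rw [pow_succ]; simp only [mul_assoc]
  · rw [← mul_assoc, sγ, pow_succ]; simp only [mul_assoc]

theorem DD_x (n : ℕ) : (α * β * γ) ^ (n + 1) ∈ DD K k s e f α β γ η := by
  rcases lt_trichotomy (n + 1) k with h | h | h
  · refine ⟨0, 0, 0, Pi.single n 1, 0, ?_⟩
    have : rr k s e f α β γ η (0:K) 0 0 (Pi.single n 1) 0 = (α * β * γ) ^ (n + 1) := by
      rw [rr, Finset.sum_eq_single_of_mem (s := Finset.range (k - 1)) n
        (Finset.mem_range.2 (by omega))]
      · simp
      · intro b _ hb; simp [hb]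
    rw [this, sub_self]; exact zero_mem _
  · apply DD_congr (S.xg n)
    rw [h, S.gk]
    obtain ⟨t, rfl⟩ := S.spos
    exact S.DD_η _
  · rw [S.x_top _ h]; exact zero_mem _

theorem f2cm (n : ℕ) : (β * γ * α) ^ (n + 1) * (β * γ) ∈ cm K A := by
  have := cm_mem (K := K) β ((γ * α * β) ^ (n + 1) * γ)
  rwa [S.l1β, sub_zero, ← mul_assoc, sβ, mul_assoc] at this

theorem DD_top (x : A) : x ∈ DD K k s e f α β γ η := by
  have hw := S.W_top x
  revert hw
  suffices h : W K e f α β γ η ≤ DD K k s e f α β γ η from fun hw => h hw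
  apply Submodule.span_le.2
  intro X hX
  rcases S.tyL hX with ⟨h3, h4⟩ | ⟨h3, h4⟩ <;> rcases S.tyR hX with ⟨h1, h2⟩ | ⟨h1, h2⟩
  rotate_left
  · apply DD_cm
    have := cm_mem (K := K) e X
    rwa [h3, h2, sub_zero] at this
  · apply DD_cm
    have := cm_mem (K := K) f X
    rwa [h3, h2, sub_zero] at this
  all_goals
  cases hX with
  | e => exact DD_e
  | f => exact DD_f
  | f1 n =>
    cases n with
    | zero => simpa using DD_α
    | succ n =>
      apply DD_cm
      have := cm_mem (K := K) ((α * β * γ) ^ (n + 1)) α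
      rwa [S.αx, sub_zero, ← sα] at this
  | f2 n =>
    cases n with
    | zero =>
      rw [pow_zero, one_mul]
      apply DD_congr (cm_mem β γ)
      rw [S.γβ]
      obtain ⟨t, rfl⟩ := S.spos
      exact S.DD_η _
    | succ n => exact DD_cm (S.f2cm n)
  | f3 n =>
    refine DD_congr (m' := (α * β * γ) ^ (n + 1)) ?_ (S.DD_x n)
    convert cm_mem ((β * γ * α) ^ n * (β * γ)) α using 2
    · rw [pow_succ]; simp only [mul_assoc]
    · rw [← mul_assoc, sα, pow_succ]; simp only [mul_assoc]
  | f4 n => exact S.DD_x n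
  | et n => exact S.DD_η n
  | g n =>
    refine DD_congr (m' := (α * β * γ) ^ (n + 1)) ?_ (S.DD_x n)
    rw [← neg_sub]; exact neg_mem (S.xg n)
  | h1 n =>
    apply DD_cm
    first
    | have := cm_mem (K := K) e ((β * γ * α) ^ n * β)
      rwa [S.eh1, zef S.fe (S.h1f n) S.ee, sub_zero] at this
  | h2 n =>
    apply DD_cm
    have := cm_mem (K := K) e (α * (β * γ * α) ^ n * β)
    rwa [S.eh2, zef S.fe (S.h2f n) S.ee, sub_zero] at this
  | l1 n =>
    apply DD_cm
    have := cm_mem (K := K) f ((γ * α * β) ^ n * γ)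
    rwa [S.fl1, zef S.ef (S.l1e n) S.ff, sub_zero] at this
  | l2 n =>
    apply DD_cm
    have := cm_mem (K := K) f ((γ * α * β) ^ n * (γ * α))
    rwa [S.fl2, zef S.ef (S.l2e n) S.ff, sub_zero] at this

theorem w_ab (n : ℕ) : e * ((α * β * γ) ^ n * α) = (α * β * γ) ^ n * α := by
  rw [← sα, S.ef1]
theorem w_ba (n : ℕ) : ((α * β * γ) ^ n * α) * e = (α * β * γ) ^ n * α := by
  rw [mul_assoc, S.αe]

theorem u_central (z : A) : z * uu α β γ = uu α β γ * z := by
  have a1 := S.αx 0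
  have a2 := S.xα 0
  have a3 := S.xβ 0
  have a4 := S.γx 0
  have a5 := S.ηg 0
  have a6 := S.gη 0
  have b1 := S.ex 0
  have b2 := S.xe 0
  have b3 := S.ex' 0
  have b4 := S.x'e 0
  have b5 := S.fg 0
  have b6 := S.gf 0
  have c1 := sα (α := α) (β := β) (γ := γ) 1
  have c2 := sβ (α := α) (β := β) (γ := γ) 1
  have c3 := sγ (α := α) (β := β) (γ := γ) 1
  simp only [zero_add, pow_one] at a1 a2 a3 a4 a5 a6 b1 b2 b3 b4 b5 b6 c1 c2 c3
  apply S.central (uu α β γ) <;> simp only [uu, mul_add, add_mul]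
  · rw [a1, a2, zef S.ef S.αe b5, zef S.fe b6 S.eα, c1]; simp
  · rw [a3, zef S.fe S.βf b1, zef S.fe S.βf b3, zef S.fe b6 S.eβ, c2]; simp
  · rw [b1, b2, b3, b4, zef S.ef S.ee b5, zef S.fe b6 S.ee]
  · rw [a4, zef S.ef b2 S.fγ, zef S.ef b4 S.fγ, zef S.ef S.γe b5, c3]; simp
  · rw [a5, a6, zef S.fe S.ηf b1, zef S.fe S.ηf b3, zef S.ef b2 S.fη, zef S.ef b4 S.fη]

theorem y_α : yy k α β γ η * α = 0 := by
  obtain ⟨j, rfl⟩ := S.kpos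
  rw [yy, add_mul, S.ηα, zero_add, ← sα]
  exact S.f1α j

theorem y_central (z : A) : z * yy k α β γ η = yy k α β γ η * z := by
  apply S.central
  · rw [S.y_α, yy, mul_add, S.αη, zero_add]
    obtain ⟨j, rfl⟩ := S.kpos
    rw [← sα]; exact S.αf1 j
  · rw [yy, mul_add, add_mul, zef S.fe S.βf (S.w_ab _), S.ηβ, S.βη]; simp [mul_assoc]
  · rw [yy, mul_add, add_mul, zef S.ef S.ee S.fη, zef S.fe S.ηf S.ee, S.w_ab, S.w_ba]
  · rw [yy, mul_add, add_mul, S.γη, zef S.ef (S.w_ba _) S.fγ, S.ηγ, ← mul_assoc, sγ, mul_assoc]; simp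
  · rw [yy, mul_add, add_mul, zef S.fe S.ηf (S.w_ab _), zef S.ef (S.w_ba _) S.fη]

theorem y_x (n : ℕ) : yy k α β γ η * (α * β * γ) ^ (n + 1) = 0 := by
  rw [yy, add_mul, zef S.fe S.ηf (S.ex n), mul_assoc, S.αx]; simp
theorem y_η (n : ℕ) : yy k α β γ η * η ^ (n + 1) = η ^ (n + 2) := by
  rw [yy, add_mul, zef S.ef (S.w_ba _) (S.fηn n), ← pow_succ']; simp
theorem u_x (n : ℕ) : uu α β γ * (α * β * γ) ^ (n + 1) = (α * β * γ) ^ (n + 2) := by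
  rw [uu, add_mul, add_mul, ← pow_succ']
  have : β * γ * α * (α * β * γ) ^ (n + 1) = 0 := by
    rw [mul_assoc, S.αx, mul_zero]
  have h2 : γ * α * β * (α * β * γ) ^ (n + 1) = 0 := zef S.fe (by rw [mul_assoc, S.βf]) (S.ex n)
  rw [this, h2]; simp
theorem u_η (n : ℕ) : uu α β γ * η ^ (n + 1) = 0 := by
  rw [uu, add_mul, add_mul, zef S.ef (by rw [mul_assoc, S.γe]) (S.fηn n),
    zef S.ef (by rw [mul_assoc, S.αe]) (S.fηn n)]
  have := S.gη 0
  rw [zero_add, pow_one] at this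
  rw [pow_succ', ← mul_assoc, this]; simp
theorem u_α (n : ℕ) : uu α β γ * ((α * β * γ) ^ n * α) = (α * β * γ) ^ (n + 1) * α := by
  cases n with
  | zero =>
    have := S.xα 0
    have h := S.gf 0
    rw [zero_add, pow_one] at this h
    rw [pow_zero, one_mul, uu, add_mul, add_mul, this, zef S.fe h S.eα]; simp
  | succ n => rw [← mul_assoc, S.u_x]

theorem un_x (i n : ℕ) : uu α β γ ^ i * (α * β * γ) ^ (n + 1) = (α * β * γ) ^ (i + n + 1) := by
  induction i with
  | zero => simp
  | succ i ih => rw [pow_succ', mul_assoc, ih, S.u_x]; congr 1; omega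
theorem yn_η (i n : ℕ) : yy k α β γ η ^ i * η ^ (n + 1) = η ^ (i + n + 1) := by
  induction i with
  | zero => simp
  | succ i ih => rw [pow_succ', mul_assoc, ih, S.y_η]; congr 1; omega
theorem un_α (i : ℕ) : uu α β γ ^ i * α = α * (β * γ * α) ^ i := by
  rw [sα]
  induction i with
  | zero => simp
  | succ i ih => rw [pow_succ', mul_assoc, ih, S.u_α]

include T

theorem P_x (i j n : ℕ) : ψ (uu α β γ ^ i * yy k α β γ η ^ j * (α * β * γ) ^ (n + 1)) =
    if j = 0 ∧ i + n + 1 = k then 1 else 0 := by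
  cases j with
  | zero => rw [pow_zero, mul_one, S.un_x, T.f4]; simp
  | succ j => rw [mul_assoc, pow_succ, mul_assoc _ (yy k α β γ η), S.y_x]; simp

theorem P_η (i j n : ℕ) : ψ (uu α β γ ^ i * yy k α β γ η ^ j * η ^ (n + 1)) =
    if i = 0 ∧ j + n + 1 = s then 1 else 0 := by
  rw [mul_assoc, S.yn_η]
  cases i with
  | zero => rw [pow_zero, one_mul, T.et]; simp
  | succ i => rw [pow_succ, mul_assoc, S.u_η]; simp

theorem P_α (i j : ℕ) : ψ (uu α β γ ^ i * yy k α β γ η ^ j * α) = 0 := by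
  cases j with
  | zero => rw [pow_zero, mul_one, S.un_α, T.f1]
  | succ j => rw [mul_assoc, pow_succ, mul_assoc _ (yy k α β γ η), S.y_α]; simp

theorem P_αα (i j : ℕ) : ψ (uu α β γ ^ i * yy k α β γ η ^ j * (α * α)) =
    if i = 0 ∧ j = 0 then c else 0 := by
  cases j with
  | zero =>
    rw [pow_zero, mul_one, ← mul_assoc, S.un_α]
    cases i with
    | zero =>
      rw [pow_zero, mul_one, S.αα, map_add, map_smul, map_smul, T.f2]
      obtain ⟨j, rfl⟩ := S.kpos
      have := T.f3 (j + 1)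
      simp only [if_true] at this
      rw [this]; simp
    | succ i => rw [S.f1α]; simp
  | succ j =>
    rw [mul_assoc, pow_succ, mul_assoc _ (yy k α β γ η), ← mul_assoc _ α, S.y_α]; simp

end Sys
end

section
variable {K : Type} [Field K] {A : Type} [Ring A] [Algebra K A] {k s : ℕ} {a c : K}
    {e f α β γ η : A} {ψ : A →ₗ[K] K}

def MM (k : ℕ) (d : K) (α β γ : A) (i : ℕ) : A :=
  if 2 * i = k then d • (α * β * γ) ^ (k - i) + α else (α * β * γ) ^ (k - i)
def NN (s : ℕ) (d : K) (α η : A) (j : ℕ) : A :=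
  if 2 * j = s then d • η ^ (s - j) + α else η ^ (s - j)
def dd (k : ℕ) (d : K) (i : ℕ) : K := if 2 * i = k then d else 1

namespace Sys
variable (S : Sys K k s a c e f α β γ η) (T : Tr k s α β γ η ψ)
include S T

theorem trz {z : A} (hz : ∀ w, w * z = z * w) (x y : A) : ψ (z * (x * y)) = ψ (z * (y * x)) := by
  rw [← mul_assoc, S.trace T, ← mul_assoc, hz, mul_assoc]

theorem cm_z {z : A} (hz : ∀ w, w * z = z * w) {x : A} (hx : x ∈ cm K A) : ψ (z * x) = 0 := by
  induction hx using Submodule.span_induction with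
  | mem x h =>
    obtain ⟨u, v, rfl⟩ := h
    rw [mul_sub, map_sub, S.trz T hz, sub_self]
  | zero => simp
  | add x y _ _ hx hy => simp [mul_add, hx, hy]
  | smul r x _ hx => simp [hx]

theorem Q_add [CharP K 2] {z : A} (hz : ∀ w, w * z = z * w) (x y : A) :
    ψ (z * (x + y) ^ 2) = ψ (z * x ^ 2) + ψ (z * y ^ 2) := by
  have : (x + y) ^ 2 = x ^ 2 + (x * y + y * x) + y ^ 2 := by noncomm_ring
  rw [this, mul_add, mul_add, mul_add, map_add, map_add, map_add, S.trz T hz y x,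
    CharTwo.add_self_eq_zero, add_zero]

omit S T in
theorem Q_smul (z : A) (r : K) (x : A) :
    ψ (z * (r • x) ^ 2) = r ^ 2 * ψ (z * x ^ 2) := by
  rw [smul_pow, mul_smul_comm, map_smul, smul_eq_mul]

theorem Q_cm [CharP K 2] {z : A} (hz : ∀ w, w * z = z * w) {x : A} (hx : x ∈ cm K A) :
    ψ (z * x ^ 2) = 0 := by
  induction hx using Submodule.span_induction with
  | mem x h =>
    obtain ⟨u, v, rfl⟩ := h
    have : (u * v - v * u) ^ 2 = u * (v * u * v) + v * u * v * u - (u * (v * v * u) + v * u * u * v) := by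
      noncomm_ring
    rw [this, mul_sub, mul_add, mul_add, map_sub, map_add, map_add, S.trz T hz u (v * u * v),
      S.trz T hz u (v * v * u), CharTwo.add_self_eq_zero, S.trz T hz (v * u * u) v]
    simp only [mul_assoc]
    rw [CharTwo.add_self_eq_zero, sub_zero]
  | zero => simp
  | add x y _ _ hx hy => rw [S.Q_add T hz, hx, hy, add_zero]
  | smul r x _ hx => rw [Q_smul, hx, mul_zero]

theorem Q_sum [CharP K 2] {z : A} (hz : ∀ w, w * z = z * w) (F : Finset ℕ) (g : ℕ → A) :
    ψ (z * (∑ i ∈ F, g i) ^ 2) = ∑ i ∈ F, ψ (z * (g i) ^ 2) := by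
  induction F using Finset.induction_on with
  | empty => simp
  | insert i F hi ih => rw [Finset.sum_insert hi, Finset.sum_insert hi, S.Q_add T hz, ih]

theorem Q_rr [CharP K 2] {z : A} (hz : ∀ w, w * z = z * w) (p q l : K) (μ ν : ℕ → K) :
    ψ (z * (rr k s e f α β γ η p q l μ ν) ^ 2) =
      p ^ 2 * ψ (z * e) + q ^ 2 * ψ (z * f) + l ^ 2 * ψ (z * (α * α)) +
      ∑ i ∈ Finset.range (k - 1), μ i ^ 2 * ψ (z * (α * β * γ) ^ (2 * i + 1 + 1)) +
      ∑ t ∈ Finset.range s, ν t ^ 2 * ψ (z * η ^ (2 * t + 1 + 1)) := by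
  simp only [rr, S.Q_add T hz, S.Q_sum T hz, Q_smul, ← pow_mul]
  have h1 : ∀ i, (i + 1) * 2 = 2 * i + 1 + 1 := fun i => by ring
  simp only [h1, pow_two e, pow_two f, pow_two α, S.ee, S.ff]

theorem uy_c (i j : ℕ) (w : A) : w * (uu α β γ ^ i * yy k α β γ η ^ j) =
    (uu α β γ ^ i * yy k α β γ η ^ j) * w := by
  have h1 : Commute w (uu α β γ) := S.u_central w
  have h2 : Commute w (yy k α β γ η) := S.y_central w
  exact ((h1.pow_right i).mul_right (h2.pow_right j))

theorem xk_c (w : A) : w * (α * β * γ) ^ k = (α * β * γ) ^ k * w := by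
  obtain ⟨j, rfl⟩ := S.kpos
  apply S.central
  · rw [S.αx, S.xk, S.xα]
  · rw [S.xβ, zef S.fe S.βf (S.ex _)]
  · rw [S.ex, S.xe]
  · rw [zef S.ef (S.xe _) S.fγ, S.xk, S.γx]
  · rw [zef S.ef (S.xe _) S.fη, zef S.fe S.ηf (S.ex _)]

theorem ηs_c (w : A) : w * η ^ s = η ^ s * w := by
  obtain ⟨t, rfl⟩ := S.spos
  apply S.central
  · rw [zef S.ef S.αe (S.fηn _), zef S.fe (S.ηnf _) S.eα]
  · rw [pow_succ', pow_succ', ← mul_assoc η, ← mul_assoc, S.βηη, zero_mul]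
    rw [mul_assoc, mul_assoc, zef S.fe (S.ηnf _) S.eβ]; simp
  · rw [zef S.ef S.ee (S.fηn _), zef S.fe (S.ηnf _) S.ee]
  · rw [zef S.ef S.γe (S.fηn _), pow_succ, mul_assoc, pow_succ, mul_assoc, S.ηηγ, mul_zero]
  · rw [← pow_succ, ← pow_succ']

theorem T1_coef [CharP K 2] {d : K} (hc : c = d ^ 2) (p q l : K) (μ ν : ℕ → K)
    (h : ∀ z : A, (∀ w, w * z = z * w) → ψ (z * (rr k s e f α β γ η p q l μ ν) ^ 2) = 0) :
    p = 0 ∧ q = 0 ∧ (∀ i, 2 * (i + 1) < k → μ i = 0) ∧ (∀ t, 2 * (t + 1) < s → ν t = 0) ∧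
    d * l + (∑ i ∈ Finset.range (k - 1), if 2 * (i + 1) = k then μ i else 0) +
      (∑ t ∈ Finset.range s, if 2 * (t + 1) = s then ν t else 0) = 0 := by
  have hp : p = 0 := by
    have := h _ (S.xk_c T)
    rw [S.Q_rr T (S.xk_c T)] at this
    obtain ⟨j, rfl⟩ := S.kpos
    rw [S.xe, zef S.ef (S.xe _) S.ff, ← mul_assoc _ α α, ← sα, S.f1_top _ le_rfl, T.f4] at this
    rw [Finset.sum_eq_zero, Finset.sum_eq_zero] at this
    · simpa using this
    · intro t _
      rw [zef S.ef (S.xe _) (S.fηn _)]; simp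
    · intro i _
      rw [← pow_add, S.x_top _ (by omega)]; simp
  have hq : q = 0 := by
    have := h _ (S.ηs_c T)
    rw [S.Q_rr T (S.ηs_c T)] at this
    obtain ⟨j, rfl⟩ := S.spos
    rw [S.ηnf, zef S.fe (S.ηnf _) S.ee, ← mul_assoc _ α α, zef S.fe (S.ηnf _) S.eα, T.et] at this
    rw [Finset.sum_eq_zero, Finset.sum_eq_zero] at this
    · simpa using this
    · intro t _
      rw [← pow_add, S.η_top _ (by omega)]; simp
    · intro i _
      rw [zef S.fe (S.ηnf _) (S.ex _)]; simp
  subst hp hq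
  have H : ∀ i j : ℕ, l ^ 2 * (if i = 0 ∧ j = 0 then c else 0) +
      (∑ n ∈ Finset.range (k - 1), μ n ^ 2 * if j = 0 ∧ i + (2 * n + 1) + 1 = k then 1 else 0) +
      (∑ t ∈ Finset.range s, ν t ^ 2 * if i = 0 ∧ j + (2 * t + 1) + 1 = s then 1 else 0) = 0 := by
    intro i j
    have := h _ (S.uy_c T i j)
    rw [S.Q_rr T (S.uy_c T i j)] at this
    simp only [S.P_x T, S.P_η T, S.P_αα T] at this
    simpa using this
  refine ⟨rfl, rfl, ?_, ?_, ?_⟩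
  · intro i hi
    have := H (k - 2 * (i + 1)) 0
    rw [if_neg (by omega), Finset.sum_eq_single_of_mem i (Finset.mem_range.2 (by omega)),
      if_pos (by omega), Finset.sum_eq_zero] at this
    · simpa using this
    · intro t _; rw [if_neg (by omega), mul_zero]
    · intro n _ hn; rw [if_neg (by omega), mul_zero]
  · intro i hi
    have := H 0 (s - 2 * (i + 1))
    rw [if_neg (by omega), Finset.sum_eq_zero (s := Finset.range (k - 1)),
      Finset.sum_eq_single_of_mem i (Finset.mem_range.2 (by omega)), if_pos (by omega)] at this
    · simpa using this
    · intro n _ hn; rw [if_neg (by omega), mul_zero]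
    · intro t _; rw [if_neg (by omega), mul_zero]
  · have := H 0 0
    rw [← pow_eq_zero_iff two_ne_zero, CharTwo.add_sq, CharTwo.add_sq, CharTwo.sum_sq, CharTwo.sum_sq]
    refine Eq.trans ?_ this
    rw [hc]
    congr 1
    · congr 1
      · simp; ring
      · apply Finset.sum_congr rfl
        intro n _
        have : (2 * (n + 1) = k) ↔ (0 = 0 ∧ 0 + (2 * n + 1) + 1 = k) := by
          constructor
          · intro h; exact ⟨rfl, by omega⟩
          · rintro ⟨_, h⟩; omega
        simp only [this]; split_ifs <;> simp
    · apply Finset.sum_congr rfl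
      intro n _
      have : (2 * (n + 1) = s) ↔ (0 = 0 ∧ 0 + (2 * n + 1) + 1 = s) := by
        constructor
        · intro h; exact ⟨rfl, by omega⟩
        · rintro ⟨_, h⟩; omega
      simp only [this]; split_ifs <;> simp

theorem T1_perp [CharP K 2] {d : K} (hd : d ≠ 0) (hc : c = d ^ 2) {m : A} (hm : m ^ 2 ∈ cm K A)
    {z : A} (hz : ∀ w, w * z = z * w)
    (hM : ∀ i, 1 ≤ i → 2 * i ≤ k → ψ (z * MM k d α β γ i) = 0)
    (hN : ∀ j, 2 * j ≤ s → ψ (z * NN s d α η j) = 0) : ψ (z * m) = 0 := by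
  obtain ⟨p, q, l, μ, ν, h⟩ := S.DD_top m
  obtain ⟨rfl, rfl, hμ, hν, hsum⟩ := S.T1_coef T hc p q l μ ν (by
    intro z hz
    have h1 := S.Q_add T hz (m - rr k s e f α β γ η p q l μ ν) (rr k s e f α β γ η p q l μ ν)
    rw [sub_add_cancel, S.cm_z T hz hm, S.Q_cm T hz h, zero_add] at h1
    exact h1.symm)
  have h2 : ψ (z * m) = ψ (z * rr k s e f α β γ η 0 0 l μ ν) := by
    have := S.cm_z T hz h
    rw [mul_sub, map_sub] at this
    exact sub_eq_zero.1 this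
  have hM' : ∀ i, i < k - 1 → d * (μ i * ψ (z * (α * β * γ) ^ (i + 1))) =
      (if 2 * (i + 1) = k then μ i else 0) * ψ (z * α) := by
    intro i hi
    rcases lt_trichotomy (2 * (i + 1)) k with h | h | h
    · rw [hμ i h]; simp
    · have := hM (i + 1) (by omega) (by omega)
      rw [MM, if_pos h, mul_add, map_add, mul_smul_comm, map_smul, CharTwo.add_eq_zero,
        show k - (i + 1) = i + 1 by omega, smul_eq_mul] at this
      rw [if_pos h, ← this]; ring
    · have := hM (k - (i + 1)) (by omega) (by omega)
      rw [MM, if_neg (by omega), show k - (k - (i + 1)) = i + 1 by omega] at this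
      rw [this, if_neg (by omega)]; simp
  have hN' : ∀ i, i < s → d * (ν i * ψ (z * η ^ (i + 1))) =
      (if 2 * (i + 1) = s then ν i else 0) * ψ (z * α) := by
    intro i hi
    rcases lt_trichotomy (2 * (i + 1)) s with h | h | h
    · rw [hν i h]; simp
    · have := hN (i + 1) (by omega)
      rw [NN, if_pos h, mul_add, map_add, mul_smul_comm, map_smul, CharTwo.add_eq_zero,
        show s - (i + 1) = i + 1 by omega, smul_eq_mul] at this
      rw [if_pos h, ← this]; ring
    · have := hN (s - (i + 1)) (by omega)
      rw [NN, if_neg (by omega), show s - (s - (i + 1)) = i + 1 by omega] at this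
      rw [this, if_neg (by omega)]; simp
  rw [h2]
  apply mul_left_cancel₀ hd
  rw [mul_zero, rr]
  simp only [zero_smul, zero_add, mul_add, map_add, Finset.mul_sum, map_sum, mul_smul_comm,
    map_smul, smul_eq_mul]
  rw [Finset.sum_congr rfl (fun i hi => hM' i (Finset.mem_range.1 hi)),
    Finset.sum_congr rfl (fun i hi => hN' i (Finset.mem_range.1 hi)),
    ← Finset.sum_mul, ← Finset.sum_mul, ← mul_assoc, ← add_mul, ← add_mul, hsum, zero_mul]

omit T in
theorem αα_eq : ∃ v ∈ cm K A, α * α = v + c • (α * β * γ) ^ k := by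
  obtain ⟨j, rfl⟩ := S.kpos
  refine ⟨_, Submodule.smul_mem _ a (S.f2cm j), ?_⟩
  rw [S.αα, S.xk]; rfl

omit T in
theorem MM_T1 [CharP K 2] {d : K} (hc : c = d ^ 2) (i : ℕ) (h1 : 1 ≤ i) (h2 : 2 * i ≤ k) :
    (MM k d α β γ i) ^ 2 ∈ cm K A := by
  rw [MM]
  split_ifs with h
  · obtain ⟨v, hv, hα⟩ := S.αα_eq
    have hx : (α * β * γ) ^ (k - i) * (α * β * γ) ^ (k - i) = (α * β * γ) ^ k := by
      rw [← pow_add]; congr 1; omega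
    have e1 : (d • (α * β * γ) ^ (k - i) + α) ^ 2 =
        v + (d • (α * β * γ) ^ (k - i) * α - α * (d • (α * β * γ) ^ (k - i))) +
        ((c • (α * β * γ) ^ k + c • (α * β * γ) ^ k) +
          (α * (d • (α * β * γ) ^ (k - i)) + α * (d • (α * β * γ) ^ (k - i)))) := by
      rw [pow_two, add_mul, mul_add, mul_add, hα, smul_mul_smul_comm, hx, hc, pow_two]
      abel
    rw [e1, dbl (K := K), dbl (K := K), add_zero, add_zero]
    exact add_mem hv (cm_mem _ _)
  · rw [← pow_mul, S.x_top _ (by omega)]; exact zero_mem _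

omit T in
theorem NN_T1 [CharP K 2] {d : K} (hc : c = d ^ 2) (i : ℕ) (h2 : 2 * i ≤ s) :
    (NN s d α η i) ^ 2 ∈ cm K A := by
  have hs := S.hs
  rw [NN]
  split_ifs with h
  · obtain ⟨v, hv, hα⟩ := S.αα_eq
    have hx : η ^ (s - i) * η ^ (s - i) = η ^ s := by
      rw [← pow_add]; congr 1; omega
    obtain ⟨n, hn⟩ : ∃ n, s - i = n + 1 := ⟨s - i - 1, by omega⟩
    have z1 : η ^ (s - i) * α = 0 := by rw [hn]; exact zef S.fe (S.ηnf _) S.eα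
    have z2 : α * η ^ (s - i) = 0 := by rw [hn]; exact zef S.ef S.αe (S.fηn _)
    have hxg : (α * β * γ) ^ k - η ^ s ∈ cm K A := by
      rw [← S.gk]
      obtain ⟨j, rfl⟩ := S.kpos
      exact S.xg (j + 1)
    have e1 : (d • η ^ (s - i) + α) ^ 2 =
        v + c • ((α * β * γ) ^ k - η ^ s) + (c • η ^ s + c • η ^ s) := by
      rw [pow_two, add_mul, mul_add, mul_add, hα, smul_mul_smul_comm, hx, hc, pow_two,
        smul_mul_assoc, mul_smul_comm, z1, z2, smul_zero, smul_sub]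
      abel
    rw [e1, dbl (K := K), add_zero]
    exact add_mem hv (Submodule.smul_mem _ _ hxg)
  · rw [← pow_mul, S.η_top _ (by omega)]; exact zero_mem _

theorem P_M (d : K) (i j i₀ : ℕ) (h1 : 1 ≤ i₀) (h2 : 2 * i₀ ≤ k) :
    ψ (uu α β γ ^ i * yy k α β γ η ^ j * MM k d α β γ i₀) =
    if i = i₀ ∧ j = 0 then dd k d i₀ else 0 := by
  obtain ⟨n, hn⟩ : ∃ n, k - i₀ = n + 1 := ⟨k - i₀ - 1, by omega⟩
  have e1 : (j = 0 ∧ i + n + 1 = k) ↔ (i = i₀ ∧ j = 0) := by omega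
  rw [MM, dd]
  by_cases h : 2 * i₀ = k
  · simp only [if_pos h, hn, mul_add, map_add, mul_smul_comm, map_smul, S.P_x T, S.P_α T, e1]
    split_ifs <;> simp
  · simp only [if_neg h, hn, S.P_x T, e1]

theorem P_N (d : K) (i j j₀ : ℕ) (h2 : 2 * j₀ ≤ s) :
    ψ (uu α β γ ^ i * yy k α β γ η ^ j * NN s d α η j₀) =
    if i = 0 ∧ j = j₀ then dd s d j₀ else 0 := by
  have := S.hs
  obtain ⟨n, hn⟩ : ∃ n, s - j₀ = n + 1 := ⟨s - j₀ - 1, by omega⟩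
  have e1 : (i = 0 ∧ j + n + 1 = s) ↔ (i = 0 ∧ j = j₀) := by omega
  rw [NN, dd]
  by_cases h : 2 * j₀ = s
  · simp only [if_pos h, hn, mul_add, map_add, mul_smul_comm, map_smul, S.P_η T, S.P_α T, e1]
    split_ifs <;> simp
  · simp only [if_neg h, hn, S.P_η T, e1]

end Sys
end

section
variable {K : Type} [Field K] {A : Type} [Ring A] [Algebra K A] {k s : ℕ} {a c : K}
    {e f α β γ η : A} {ψ : A →ₗ[K] K}
open MvPolynomial

theorem mem_J (p q : ℕ) (hp : 1 ≤ p) (hq : 1 ≤ q) (x : MvPolynomial (Fin 2) K) :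
    x ∈ Ideal.span {(X 0 : MvPolynomial (Fin 2) K) ^ p, (X 1) ^ q, X 0 * X 1} ↔
    (∀ i, i < p → coeff (Finsupp.single 0 i) x = 0) ∧
    (∀ j, j < q → coeff (Finsupp.single 1 j) x = 0) := by
  have e1 : ({(X 0 : MvPolynomial (Fin 2) K) ^ p, (X 1) ^ q, X 0 * X 1} : Set _) =
      (fun s => monomial s (1 : K)) ''
        {Finsupp.single 0 p, Finsupp.single 1 q, Finsupp.single 0 1 + Finsupp.single 1 1} := by
    rw [Set.image_insert_eq, Set.image_insert_eq, Set.image_singleton]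
    simp only [X_pow_eq_monomial]
    simp only [X, monomial_mul, mul_one]
  rw [e1, mem_ideal_span_monomial_image]
  have le2 : ∀ u v : Fin 2 →₀ ℕ, u ≤ v ↔ u 0 ≤ v 0 ∧ u 1 ≤ v 1 := fun u v => by
    rw [Finsupp.le_def]; exact Fin.forall_fin_two
  have eq2 : ∀ u v : Fin 2 →₀ ℕ, u = v ↔ u 0 = v 0 ∧ u 1 = v 1 := fun u v => by
    rw [Finsupp.ext_iff]; exact Fin.forall_fin_two
  have d01 : (0 : Fin 2) ≠ 1 := by decide
  constructor
  · intro h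
    constructor
    · intro i hi
      by_contra hne
      obtain ⟨t, ht, hle⟩ := h _ (mem_support_iff.2 hne)
      rw [le2] at hle
      simp only [Set.mem_insert_iff, Set.mem_singleton_iff] at ht
      rcases ht with rfl | rfl | rfl <;> simp at hle <;> omega
    · intro i hi
      by_contra hne
      obtain ⟨t, ht, hle⟩ := h _ (mem_support_iff.2 hne)
      rw [le2] at hle
      simp only [Set.mem_insert_iff, Set.mem_singleton_iff] at ht
      rcases ht with rfl | rfl | rfl <;> simp at hle <;> omega
  · rintro ⟨h0, h1⟩ m hm
    rw [mem_support_iff] at hm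
    by_cases c0 : m 1 = 0
    · refine ⟨_, Or.inl rfl, ?_⟩
      rw [le2]
      have : m = Finsupp.single 0 (m 0) := by rw [eq2]; simp [c0]
      have hp : p ≤ m 0 := by
        by_contra hlt
        rw [this] at hm
        exact hm (h0 _ (by omega))
      simpa using hp
    · by_cases c1 : m 0 = 0
      · refine ⟨_, Or.inr (Or.inl rfl), ?_⟩
        rw [le2]
        have : m = Finsupp.single 1 (m 1) := by rw [eq2]; simp [c1]
        have hp : q ≤ m 1 := by
          by_contra hlt
          rw [this] at hm
          exact hm (h1 _ (by omega))
        simpa using hp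
      · refine ⟨_, Or.inr (Or.inr rfl), ?_⟩
        rw [le2]; simp; omega

namespace Sys

theorem cen_mul {z : A} (hz : ∀ w, w * z = z * w) {x : A} (hx : x ∈ cm K A) : z * x ∈ cm K A := by
  induction hx using Submodule.span_induction with
  | mem x h =>
    obtain ⟨u, v, rfl⟩ := h
    have : z * (u * v - v * u) = (z * u) * v - v * (z * u) := by
      rw [mul_sub, ← mul_assoc, ← mul_assoc, ← mul_assoc v z u, hz v]
    rw [this]; exact cm_mem _ _
  | zero => simp
  | add x y _ _ hx hy => rw [mul_add]; exact add_mem hx hy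
  | smul r x _ hx => rw [mul_smul_comm]; exact Submodule.smul_mem _ _ hx

variable (S : Sys K k s a c e f α β γ η) (T : Tr k s α β γ η ψ)
include S T

theorem main [CharP K 2] {d : K} (hd : d ≠ 0) (hc : c = d ^ 2) :
    ∃ I : Ideal (Subalgebra.center K A),
      (∀ z : Subalgebra.center K A, z ∈ I ↔ ∀ m : A, m ^ 2 ∈ cm K A → ψ ((z : A) * m) = 0) ∧
      Nonempty ((Subalgebra.center K A ⧸ I) ≃ₐ[K]
        (MvPolynomial (Fin 2) K ⧸
          (Ideal.span {(X 0 : MvPolynomial (Fin 2) K) ^ ((k + 2) / 2),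
            (X 1) ^ ((s + 2) / 2), X 0 * X 1}))) := by
  have hcen : ∀ (z : Subalgebra.center K A) (w : A), w * (z : A) = (z : A) * w := fun z w =>
    Subalgebra.mem_center_iff.1 z.2 w
  let I : Ideal (Subalgebra.center K A) :=
    { carrier := {z | ∀ m : A, m ^ 2 ∈ cm K A → ψ ((z : A) * m) = 0}
      zero_mem' := by intro m _; simp
      add_mem' := by
        intro z w hz hw m hm
        have := hz m hm
        have := hw m hm
        simp [add_mul, *]
      smul_mem' := by
        intro r z hz m hm
        have h2 : ((r : A) * m) ^ 2 ∈ cm K A := by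
          have : Commute (r : A) m := (hcen r m).symm
          rw [this.mul_pow, pow_two (r : A), mul_assoc]
          exact cen_mul (hcen r) (cen_mul (hcen r) hm)
        have := hz _ h2
        rw [← mul_assoc, hcen r (z : A)] at this
        exact this }
  have hI : ∀ z : Subalgebra.center K A, z ∈ I ↔
      (∀ i, 1 ≤ i → 2 * i ≤ k → ψ ((z : A) * MM k d α β γ i) = 0) ∧
      (∀ j, 2 * j ≤ s → ψ ((z : A) * NN s d α η j) = 0) := by
    intro z
    constructor
    · intro h
      exact ⟨fun i h1 h2 => h _ (S.MM_T1 hc i h1 h2), fun j h2 => h _ (S.NN_T1 hc j h2)⟩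
    · rintro ⟨h1, h2⟩ m hm
      exact S.T1_perp T hd hc hm (hcen z) h1 h2
  have hdd : ∀ n i, dd n d i ≠ 0 := by
    intro n i; rw [dd]; split_ifs
    · exact hd
    · exact one_ne_zero
  let U : Subalgebra.center K A := ⟨uu α β γ, Subalgebra.mem_center_iff.2 S.u_central⟩
  let Y : Subalgebra.center K A := ⟨yy k α β γ η, Subalgebra.mem_center_iff.2 S.y_central⟩
  let φ : MvPolynomial (Fin 2) K →ₐ[K] Subalgebra.center K A := aeval ![U, Y]
  have hφ : ∀ m r, ((φ (monomial m r) : Subalgebra.center K A) : A) =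
      r • (uu α β γ ^ (m 0) * yy k α β γ η ^ (m 1)) := by
    intro m r
    simp only [φ]
    rw [aeval_monomial, Finsupp.prod_fintype _ _ (by simp), Fin.prod_univ_two]
    simp [U, Y, Algebra.smul_def]
  have eq2 : ∀ u v : Fin 2 →₀ ℕ, u = v ↔ u 0 = v 0 ∧ u 1 = v 1 := fun u v => by
    rw [Finsupp.ext_iff]; exact Fin.forall_fin_two
  have hPM : ∀ p i, 1 ≤ i → 2 * i ≤ k → ψ ((φ p : A) * MM k d α β γ i) =
      coeff (Finsupp.single 0 i) p * dd k d i := by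
    intro p i h1 h2
    induction p using MvPolynomial.induction_on' with
    | monomial m r =>
      rw [hφ, smul_mul_assoc, map_smul, S.P_M T d _ _ i h1 h2, coeff_monomial]
      have : m = Finsupp.single 0 i ↔ (m 0 = i ∧ m 1 = 0) := by rw [eq2]; simp
      simp only [this]; split_ifs <;> simp
    | add p q hp hq =>
      rw [map_add, Subalgebra.coe_add, add_mul, map_add, hp, hq, coeff_add, add_mul]
  have hPN : ∀ p j, 2 * j ≤ s → ψ ((φ p : A) * NN s d α η j) =
      coeff (Finsupp.single 1 j) p * dd s d j := by
    intro p i h2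
    induction p using MvPolynomial.induction_on' with
    | monomial m r =>
      rw [hφ, smul_mul_assoc, map_smul, S.P_N T d _ _ i h2, coeff_monomial]
      have : m = Finsupp.single 1 i ↔ (m 0 = 0 ∧ m 1 = i) := by rw [eq2]; simp
      simp only [this]; split_ifs <;> simp
    | add p q hp hq =>
      rw [map_add, Subalgebra.coe_add, add_mul, map_add, hp, hq, coeff_add, add_mul]
  let F := (Ideal.Quotient.mkₐ K I).comp φ
  have hsurj : Function.Surjective F := by
    intro w
    obtain ⟨z, rfl⟩ := Ideal.Quotient.mk_surjective w
    let g0 : MvPolynomial (Fin 2) K := ∑ i ∈ Finset.Icc 1 (k / 2),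
      monomial (Finsupp.single 0 i) (ψ ((z : A) * MM k d α β γ i) / dd k d i)
    let g1 : MvPolynomial (Fin 2) K := ∑ j ∈ Finset.range (s / 2 + 1),
      monomial (Finsupp.single 1 j) (ψ ((z : A) * NN s d α η j) / dd s d j)
    refine ⟨g0 + g1, ?_⟩
    change Ideal.Quotient.mk I (φ (g0 + g1)) = Ideal.Quotient.mk I z
    rw [Ideal.Quotient.eq, hI]
    constructor
    · intro i h1 h2
      rw [Subalgebra.coe_sub, sub_mul, map_sub, hPM _ i h1 h2, coeff_add, coeff_sum, coeff_sum,
        Finset.sum_eq_single_of_mem i (Finset.mem_Icc.2 ⟨h1, by omega⟩), coeff_monomial,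
        if_pos rfl, Finset.sum_eq_zero, add_zero, div_mul_cancel₀ _ (hdd _ _), sub_self]
      · intro j _
        rw [coeff_monomial, if_neg]
        rw [eq2]; simp; omega
      · intro j _ hj
        rw [coeff_monomial, if_neg]
        rw [eq2]; simp; omega
    · intro i h2
      rw [Subalgebra.coe_sub, sub_mul, map_sub, hPN _ i h2, coeff_add, coeff_sum, coeff_sum,
        Finset.sum_eq_zero (s := Finset.Icc 1 (k / 2)),
        Finset.sum_eq_single_of_mem i (Finset.mem_range.2 (by omega)), coeff_monomial,
        if_pos rfl, zero_add, div_mul_cancel₀ _ (hdd _ _), sub_self]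
      · intro j _ hj
        rw [coeff_monomial, if_neg]
        rw [eq2]; simp; omega
      · intro j hj
        rw [Finset.mem_Icc] at hj
        rw [coeff_monomial, if_neg]
        rw [eq2]; simp; omega
  have hker : RingHom.ker F = Ideal.span {(X 0 : MvPolynomial (Fin 2) K) ^ ((k + 2) / 2),
            (X 1) ^ ((s + 2) / 2), X 0 * X 1} := by
    ext p
    rw [mem_J _ _ (by omega) (by omega), RingHom.mem_ker]
    change Ideal.Quotient.mk I (φ p) = 0 ↔ _
    rw [Ideal.Quotient.eq_zero_iff_mem, hI]
    constructor
    · rintro ⟨h1, h2⟩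
      have h2' : ∀ j, j < (s + 2) / 2 → coeff (Finsupp.single 1 j) p = 0 := by
        intro j hj
        have := h2 j (by omega)
        rw [hPN p j (by omega)] at this
        exact (mul_eq_zero.1 this).resolve_right (hdd _ _)
      refine ⟨?_, h2'⟩
      intro i hi
      rcases Nat.eq_zero_or_pos i with rfl | hpos
      · have := h2' 0 (by omega)
        simpa using this
      · have := h1 i hpos (by omega)
        rw [hPM p i hpos (by omega)] at this
        exact (mul_eq_zero.1 this).resolve_right (hdd _ _)
    · rintro ⟨h1, h2⟩
      constructor
      · intro i hi h
        rw [hPM p i hi h, h1 i (by omega), zero_mul]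
      · intro i h
        rw [hPN p i h, h2 i (by omega), zero_mul]
  refine ⟨I, fun z => Iff.rfl, ⟨?_⟩⟩
  exact ((Ideal.quotientEquivAlgOfEq K hker.symm).trans
    (Ideal.quotientKerAlgEquivOfSurjective hsurj)).symm

end Sys
end

section
variable {K : Type} [Field K] {A : Type} [Ring A] [Algebra K A] {k s : ℕ} {a c : K}
    {e f α β γ η : A} {ψ : A →ₗ[K] K}

namespace Sys

theorem l1_top (S : Sys K k s a c e f α β γ η) (n : ℕ) (h : k ≤ n) : (γ * α * β) ^ n * γ = 0 := by
  rw [← sγ]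
  obtain ⟨j, rfl⟩ := S.kpos
  obtain ⟨m, rfl⟩ := Nat.exists_eq_add_of_le h
  rw [pow_add, S.xk, ← mul_assoc, S.γx, zero_mul]

theorem mkTr (S : Sys K k s a c e f α β γ η) (hη : ψ (η ^ s) = 1) (hx : ψ ((α * β * γ) ^ k) = 1)
    (f1 : ∀ n, n < k → α * (β * γ * α) ^ n ≠ η ^ s → α * (β * γ * α) ^ n ≠ (α * β * γ) ^ k →
      ψ (α * (β * γ * α) ^ n) = 0)
    (f2 : ∀ n, n < k → (β * γ * α) ^ n * (β * γ) ≠ η ^ s →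
      (β * γ * α) ^ n * (β * γ) ≠ (α * β * γ) ^ k → ψ ((β * γ * α) ^ n * (β * γ)) = 0)
    (f3 : ∀ n, n < k - 1 → (β * γ * α) ^ (n + 1) ≠ η ^ s →
      (β * γ * α) ^ (n + 1) ≠ (α * β * γ) ^ k → ψ ((β * γ * α) ^ (n + 1)) = 0)
    (f4 : ∀ n, n < k + 1 → (α * β * γ) ^ n ≠ η ^ s →
      (α * β * γ) ^ n ≠ (α * β * γ) ^ k → ψ ((α * β * γ) ^ n) = 0)
    (et : ∀ n, n < s + 1 → η ^ n ≠ η ^ s → η ^ n ≠ (α * β * γ) ^ k → ψ (η ^ n) = 0)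
    (g : ∀ n, n < k - 1 → (γ * α * β) ^ (n + 1) ≠ η ^ s →
      (γ * α * β) ^ (n + 1) ≠ (α * β * γ) ^ k → ψ ((γ * α * β) ^ (n + 1)) = 0)
    (h1 : ∀ n, n < k → (β * γ * α) ^ n * β ≠ η ^ s →
      (β * γ * α) ^ n * β ≠ (α * β * γ) ^ k → ψ ((β * γ * α) ^ n * β) = 0)
    (h2 : ∀ n, n < k → α * (β * γ * α) ^ n * β ≠ η ^ s →
      α * (β * γ * α) ^ n * β ≠ (α * β * γ) ^ k → ψ (α * (β * γ * α) ^ n * β) = 0)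
    (l1 : ∀ n, n < k → (γ * α * β) ^ n * γ ≠ η ^ s →
      (γ * α * β) ^ n * γ ≠ (α * β * γ) ^ k → ψ ((γ * α * β) ^ n * γ) = 0)
    (l2 : ∀ n, n < k → (γ * α * β) ^ n * (γ * α) ≠ η ^ s →
      (γ * α * β) ^ n * (γ * α) ≠ (α * β * γ) ^ k → ψ ((γ * α * β) ^ n * (γ * α)) = 0) :
    Tr k s α β γ η ψ := by
  have nη : η ^ s ≠ 0 := by intro h; rw [h, map_zero] at hη; exact zero_ne_one hη
  have nx : (α * β * γ) ^ k ≠ 0 := by intro h; rw [h, map_zero] at hx; exact zero_ne_one hx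
  have hk := S.hk
  have hs := S.hs
  have fηs : f * η ^ s = η ^ s := by obtain ⟨t, rfl⟩ := S.spos; exact S.fηn _
  have ηsf : η ^ s * f = η ^ s := by obtain ⟨t, rfl⟩ := S.spos; exact S.ηnf _
  have exk : e * (α * β * γ) ^ k = (α * β * γ) ^ k := by obtain ⟨t, rfl⟩ := S.kpos; exact S.ex _
  have xke : (α * β * γ) ^ k * e = (α * β * γ) ^ k := by obtain ⟨t, rfl⟩ := S.kpos; exact S.xe _
  have qη : ∀ b : A, e * b = b → b ≠ η ^ s := by
    rintro b hb rfl
    apply nη; rw [← hb, ← fηs, ← mul_assoc, S.ef, zero_mul]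
  have qη' : ∀ b : A, b * e = b → b ≠ η ^ s := by
    rintro b hb rfl
    apply nη; rw [← hb, ← ηsf, mul_assoc, S.fe, mul_zero]
  have qx : ∀ b : A, f * b = b → b ≠ (α * β * γ) ^ k := by
    rintro b hb rfl
    apply nx; rw [← hb, ← exk, ← mul_assoc, S.fe, zero_mul]
  have qx' : ∀ b : A, b * f = b → b ≠ (α * β * γ) ^ k := by
    rintro b hb rfl
    apply nx; rw [← hb, ← xke, mul_assoc, S.ef, mul_zero]
  have xkβ : (α * β * γ) ^ k * β = 0 := by obtain ⟨t, rfl⟩ := S.kpos; exact S.xβ _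
  have xkα : (α * β * γ) ^ k * α = 0 := by rw [S.xk]; obtain ⟨t, rfl⟩ := S.kpos; exact S.xα _
  constructor
  · intro n
    by_cases h : n < k
    · refine f1 n h (qη _ (S.ef1 n)) ?_
      intro h'
      apply nx
      have e1 : α * (β * γ * α) ^ n * (β * γ * (α * β * γ) ^ (k - n - 1)) = (α * β * γ) ^ k := by
        rw [sα, ← mul_assoc, ← mul_assoc, mul_assoc _ α β, mul_assoc _ (α * β) γ, ← pow_succ,
          ← pow_add]
        congr 1; omega
      rw [h', mul_assoc β, ← mul_assoc _ β, xkβ, zero_mul] at e1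
      exact e1.symm
    · rw [S.f1_top n (by omega), map_zero]
  · intro n
    by_cases h : n < k
    · refine f2 n h (qη _ (S.ef2 n)) ?_
      intro h'
      apply nx
      have e1 : (β * γ * α) ^ n * (β * γ) * (α * (β * γ * α) ^ (k - n - 1)) = (α * β * γ) ^ k := by
        rw [← mul_assoc, mul_assoc _ (β * γ) α, ← pow_succ, ← pow_add, S.xk]
        congr 1; omega
      rw [h', ← mul_assoc, xkα, zero_mul] at e1
      exact e1.symm
    · rw [S.f2_top n (by omega), map_zero]
  · intro n
    rcases lt_trichotomy (n + 1) k with h | h | h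
    · rw [if_neg (by omega)]
      refine f3 n (by omega) (qη _ (S.ex' n)) ?_
      intro h'
      apply nx
      have e1 : (β * γ * α) ^ (n + 1) * (β * γ * α) ^ (k - (n + 1)) = (α * β * γ) ^ k := by
        rw [← pow_add, S.xk]
        congr 1; omega
      obtain ⟨m, hm⟩ : ∃ m, k - (n + 1) = m + 1 := ⟨k - (n + 1) - 1, by omega⟩
      rw [h', hm, pow_succ', ← mul_assoc, mul_assoc β, ← mul_assoc _ β, xkβ, zero_mul, zero_mul] at e1
      exact e1.symm
    · rw [if_pos h, h, ← S.xk, hx]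
    · rw [if_neg (by omega), S.x'_top _ h, map_zero]
  · intro n
    rcases lt_trichotomy (n + 1) k with h | h | h
    · rw [if_neg (by omega)]
      refine f4 (n + 1) (by omega) (qη _ (S.ex n)) ?_
      intro h'
      apply nx
      have e1 : (α * β * γ) ^ (n + 1) * (α * β * γ) ^ (k - (n + 1)) = (α * β * γ) ^ k := by
        rw [← pow_add]
        congr 1; omega
      rw [h', ← pow_add, S.x_top _ (by omega)] at e1
      exact e1.symm
    · rw [if_pos h, h, hx]
    · rw [if_neg (by omega), S.x_top _ h, map_zero]
  · intro n
    rcases lt_trichotomy (n + 1) s with h | h | h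
    · rw [if_neg (by omega)]
      refine et (n + 1) (by omega) ?_ (qx _ (S.fηn n))
      intro h'
      apply nη
      have e1 : η ^ (n + 1) * η ^ (s - (n + 1)) = η ^ s := by
        rw [← pow_add]
        congr 1; omega
      rw [h', ← pow_add, S.η_top _ (by omega)] at e1
      exact e1.symm
    · rw [if_pos h, h, hη]
    · rw [if_neg (by omega), S.η_top _ h, map_zero]
  · intro n
    rcases lt_trichotomy (n + 1) k with h | h | h
    · rw [if_neg (by omega)]
      refine g n (by omega) ?_ (qx _ (S.fg n))
      intro h'
      apply nη
      have e1 : (γ * α * β) ^ (n + 1) * (γ * α * β) ^ (k - (n + 1)) = η ^ s := by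
        rw [← pow_add, ← S.gk]
        congr 1; omega
      rw [h', ← S.gk, ← pow_add, S.g_top _ (by omega)] at e1
      rw [← S.gk]
      exact e1.symm
    · rw [if_pos h, h, S.gk, hη]
    · rw [if_neg (by omega), S.g_top _ h, map_zero]
  · intro n
    by_cases h : n < k
    · exact h1 n h (qη _ (S.eh1 n)) (qx' _ (S.h1f n))
    · rw [S.h1_top n (by omega), map_zero]
  · intro n
    by_cases h : n < k
    · exact h2 n h (qη _ (S.eh2 n)) (qx' _ (S.h2f n))
    · rw [S.f1_top n (by omega), zero_mul, map_zero]
  · intro n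
    by_cases h : n < k
    · exact l1 n h (qη' _ (S.l1e n)) (qx _ (S.fl1 n))
    · rw [S.l1_top n (by omega), map_zero]
  · intro n
    by_cases h : n < k
    · exact l2 n h (qη' _ (S.l2e n)) (qx _ (S.fl2 n))
    · rw [← mul_assoc, S.l1_top n (by omega), zero_mul, map_zero]

end Sys
end

section
open QT
variable (K : Type) [Field K] (k s : ℕ) (a c : K)

theorem mkR {x y : FreeAlgebra K Gen} (h : Rel K k s a c x y) :
    RingQuot.mkAlgHom K (Rel K k s a c) x = RingQuot.mkAlgHom K (Rel K k s a c) y :=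
  RingQuot.mkAlgHom_rel K h

theorem sysA (hk : 2 ≤ k) (hs : 3 ≤ s) : Sys K k s a c (E1 K k s a c) (E2 K k s a c)
    (Al K k s a c) (Be K k s a c) (Ga K k s a c) (Et K k s a c) where
  hk := hk
  hs := hs
  ee := by simpa [E1, E2, Al, Be, Ga, Et] using mkR K k s a c Rel.idem1
  ff := by simpa [E1, E2, Al, Be, Ga, Et] using mkR K k s a c Rel.idem2
  ef := by simpa [E1, E2, Al, Be, Ga, Et] using mkR K k s a c Rel.orth12
  fe := by simpa [E1, E2, Al, Be, Ga, Et] using mkR K k s a c Rel.orth21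
  sum := by simpa [E1, E2, Al, Be, Ga, Et] using mkR K k s a c Rel.sum_idem
  eα := by simpa [E1, E2, Al, Be, Ga, Et] using mkR K k s a c Rel.al_left
  αe := by simpa [E1, E2, Al, Be, Ga, Et] using mkR K k s a c Rel.al_right
  eβ := by simpa [E1, E2, Al, Be, Ga, Et] using mkR K k s a c Rel.be_left
  βf := by simpa [E1, E2, Al, Be, Ga, Et] using mkR K k s a c Rel.be_right
  fγ := by simpa [E1, E2, Al, Be, Ga, Et] using mkR K k s a c Rel.ga_left
  γe := by simpa [E1, E2, Al, Be, Ga, Et] using mkR K k s a c Rel.ga_right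
  fη := by simpa [E1, E2, Al, Be, Ga, Et] using mkR K k s a c Rel.et_left
  ηf := by simpa [E1, E2, Al, Be, Ga, Et] using mkR K k s a c Rel.et_right
  βη := by simpa [E1, E2, Al, Be, Ga, Et] using mkR K k s a c Rel.rel_beta_eta
  ηγ := by simpa [E1, E2, Al, Be, Ga, Et] using mkR K k s a c Rel.rel_eta_gamma
  αα := by simpa [E1, E2, Al, Be, Ga, Et] using mkR K k s a c Rel.rel_alpha_sq
  γβ := by simpa [E1, E2, Al, Be, Ga, Et] using mkR K k s a c Rel.rel_gamma_beta
  ααβ := by simpa [E1, E2, Al, Be, Ga, Et] using mkR K k s a c Rel.rel_alpha_sq_beta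
  γαα := by simpa [E1, E2, Al, Be, Ga, Et] using mkR K k s a c Rel.rel_gamma_alpha_sq
  top := by
    have h1 : (Algebra.adjoin K (Set.range (FreeAlgebra.ι K (X := Gen)))).map
        (RingQuot.mkAlgHom K (Rel K k s a c)) = ⊤ := by
      rw [FreeAlgebra.adjoin_range_ι, Algebra.map_top, AlgHom.range_eq_top]
      exact RingQuot.mkAlgHom_surjective K _
    rw [AlgHom.map_adjoin] at h1
    rw [eq_top_iff, ← h1]
    apply Algebra.adjoin_mono
    rintro _ ⟨_, ⟨g, rfl⟩, rfl⟩
    cases g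
    · left; rfl
    · right; left; rfl
    · right; right; left; rfl
    · right; right; right; left; rfl
    · right; right; right; right; left; rfl
    · right; right; right; right; right; rfl

theorem trA (hk : 2 ≤ k) (hs : 3 ≤ s) (ψ : Aa K k s a c →ₗ[K] K) (hψ : IsPsi K k s a c ψ) :
    Tr k s (Al K k s a c) (Be K k s a c) (Ga K k s a c) (Et K k s a c) ψ := by
  obtain ⟨h1, h2, h⟩ := hψ
  refine (sysA K k s a c hk hs).mkTr h1 h2 ?_ ?_ ?_ ?_ ?_ ?_ ?_ ?_ ?_ ?_
  · exact fun n hn => h (.inl (.inl (.inl ⟨n, hn⟩)))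
  · exact fun n hn => h (.inl (.inl (.inr ⟨n, hn⟩)))
  · exact fun n hn => h (.inl (.inr (.inl ⟨n, hn⟩)))
  · exact fun n hn => h (.inl (.inr (.inr ⟨n, hn⟩)))
  · exact fun n hn => h (.inr (.inl (.inl ⟨n, hn⟩)))
  · exact fun n hn => h (.inr (.inl (.inr ⟨n, hn⟩)))
  · exact fun n hn => h (.inr (.inr (.inl (.inl ⟨n, hn⟩))))
  · exact fun n hn => h (.inr (.inr (.inl (.inr ⟨n, hn⟩))))
  · exact fun n hn => h (.inr (.inr (.inr (.inl ⟨n, hn⟩))))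
  · exact fun n hn => h (.inr (.inr (.inr (.inr ⟨n, hn⟩))))

theorem mem_perpA (ψ : Aa K k s a c →ₗ[K] K) (z : Aa K k s a c) :
    z ∈ perp K k s a c ψ ↔ ∀ m : Aa K k s a c, m ^ 2 ∈ cm K (Aa K k s a c) → ψ (z * m) = 0 := by
  simp only [perp, Submodule.mem_iInf]
  rfl

end

end QTP

open QT MvPolynomial in
/-- char K = 2, k ≥ 2, c = d² with d ≠ 0.  Then
Z(A^{k,s}(a,c))/T₁(A^{k,s}(a,c))^⊥ ≅ K[U,Y]/(U^{⌈(k+1)/2⌉}, Y^{⌈(s+1)/2⌉}, UY).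
Here U, Y are the variables X 0, X 1 (and ⌈(k+1)/2⌉ = (k+2)/2, ⌈(s+1)/2⌉ = (s+2)/2
as natural-number divisions), and the Külshammer ideal T₁^⊥ is realised as the ideal
of the centre whose elements are exactly those central elements lying in the
orthogonal space of T₁ with respect to the symmetrising form ψ. -/
theorem statement14 (K : Type) [Field K] [CharP K 2] (k s : ℕ)
    (hk : 2 ≤ k) (hs : 3 ≤ s) (a c d : K) (ha : a ≠ 0) (hd : d ≠ 0) (hc : c = d ^ 2)
    (ψ : Aa K k s a c →ₗ[K] K) (hψ : IsPsi K k s a c ψ) :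
    ∃ I : Ideal (Subalgebra.center K (Aa K k s a c)),
      (∀ z : Subalgebra.center K (Aa K k s a c),
        z ∈ I ↔ (z : Aa K k s a c) ∈ perp K k s a c ψ) ∧
      Nonempty ((Subalgebra.center K (Aa K k s a c) ⧸ I) ≃ₐ[K]
        (MvPolynomial (Fin 2) K ⧸
          (Ideal.span {(X 0 : MvPolynomial (Fin 2) K) ^ ((k + 2) / 2),
            (X 1) ^ ((s + 2) / 2), X 0 * X 1}))) := by
  obtain ⟨I, h, hI⟩ := (QTP.sysA K k s a c hk hs).main (QTP.trA K k s a c hk hs ψ hψ) hd hc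
  exact ⟨I, fun z => (h z).trans (QTP.mem_perpA K k s a c ψ z).symm, hI⟩
end
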